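/- arXiv:2501.11281 — 2 statements merged into one kernel-verified Lean document; each statement's English description precedes it below -/
import Mathlib

section
/- If G is a connected 3-sparse graph with maximum degree Δ containing an edge xy with d_G(x) + d_G(y) < Δ + 3, then G admits an acyclic edge coloring with at most Δ + 1 colors. -/
/-- A proper edge coloring: distinct edges sharing a vertex get distinct colors. -/
def ProperEC {V : Type*} (G : SimpleGraph V) (c : Sym2 V → ℕ) : Prop :=
  ∀ ⦃e₁⦄, e₁ ∈ G.edgeSet → ∀ ⦃e₂⦄, e₂ ∈ G.edgeSet → e₁ ≠ e₂ →
    (∃ x, x ∈ e₁ ∧ x ∈ e₂) → c e₁ ≠ c e₂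

/-- An acyclic edge coloring: proper and no cycle is bichromatic (its edges
colored with exactly two colors). -/
def AcyclicEC {V : Type*} (G : SimpleGraph V) (c : Sym2 V → ℕ) : Prop :=
  ProperEC G c ∧ ∀ (v : V) (w : G.Walk v v), w.IsCycle →
    ¬ ∃ a b : ℕ, a ≠ b ∧ ∀ e ∈ w.edges, c e = a ∨ c e = b

/-- `G` has an acyclic edge coloring using at most `n` colors. -/
def HasAEC {V : Type*} (G : SimpleGraph V) (n : ℕ) : Prop :=
  ∃ c : Sym2 V → ℕ, AcyclicEC G c ∧ ∀ e ∈ G.edgeSet, c e < n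


namespace AEC

/-- The graph of the edges colored `a` or `b` by the partial coloring `f`. -/
def bi {V K : Type*} (f : V → V → Option K) (a b : K) : SimpleGraph V where
  Adj u v := u ≠ v ∧ ((f u v = some a ∨ f u v = some b) ∧ (f v u = some a ∨ f v u = some b))
  symm := ⟨fun _ _ h => ⟨h.1.symm, h.2.2, h.2.1⟩⟩
  loopless := ⟨fun _ h => h.1 rfl⟩

/-- Partial acyclic edge colorings. -/
structure PC {V K : Type*} (f : V → V → Option K) : Prop where
  symm : ∀ u v, f u v = f v u
  loop : ∀ u, f u u = none
  prop : ∀ u v w a, f u v = some a → f u w = some a → v = w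
  acyc : ∀ a b, a ≠ b → (bi f a b).IsAcyclic

/-- Color `a` is missing at `v`. -/
def Miss {V K : Type*} (f : V → V → Option K) (v : V) (a : K) : Prop := ∀ w, f v w ≠ some a

/-- Reachability by edges colored `a` or `b`. -/
def R {V K : Type*} (f : V → V → Option K) (a b : K) (u v : V) : Prop := (bi f a b).Reachable u v

/-- Update a symmetric function on a pair. -/
def upd {V K : Type*} [DecidableEq V] (f : V → V → Option K) (u v : V) (o : Option K) :
    V → V → Option K :=
  fun p q => if (p = u ∧ q = v) ∨ (p = v ∧ q = u) then o else f p q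

section
variable {V K : Type*} {f f' : V → V → Option K}

lemma bi_comm (f : V → V → Option K) (a b : K) : bi f a b = bi f b a := by
  ext u v; simp only [bi]; tauto

lemma R.symm {a b : K} {u v : V} (h : R f a b u v) : R f a b v u := SimpleGraph.Reachable.symm h

lemma R.trans {a b : K} {u v w : V} (h : R f a b u v) (h' : R f a b v w) : R f a b u w :=
  SimpleGraph.Reachable.trans h h'

lemma R_comm {a b : K} {u v : V} : R f a b u v ↔ R f b a u v := by
  unfold R; rw [bi_comm]

lemma R.swap {a b : K} {u v : V} (h : R f a b u v) : R f b a u v := R_comm.1 h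

lemma bi_adj (h : PC f) {a b : K} {u v : V} :
    (bi f a b).Adj u v ↔ f u v = some a ∨ f u v = some b := by
  simp only [bi]
  constructor
  · exact fun h => h.2.1
  · intro h1
    refine ⟨?_, h1, by rwa [h.symm v u]⟩
    rintro rfl
    simp [h.loop] at h1

lemma R.mono {a b : K} {u v : V} (h : R f a b u v)
    (hm : ∀ p q c, (c = a ∨ c = b) → f p q = some c → f' p q = some c) : R f' a b u v := by
  refine SimpleGraph.Reachable.mono ?_ h
  intro p q hpq
  obtain ⟨h1, h2, h3⟩ := hpq
  refine ⟨h1, ?_, ?_⟩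
  · rcases h2 with h2 | h2
    · exact Or.inl (hm _ _ _ (Or.inl rfl) h2)
    · exact Or.inr (hm _ _ _ (Or.inr rfl) h2)
  · rcases h3 with h2 | h2
    · exact Or.inl (hm _ _ _ (Or.inl rfl) h2)
    · exact Or.inr (hm _ _ _ (Or.inr rfl) h2)

/-- A vertex missing both colors reaches only itself. -/
lemma R.iso {a b : K} {u v : V} (h : R f a b u v) (ha : Miss f u a) (hb : Miss f u b) : u = v := by
  obtain ⟨w⟩ := h
  cases w with
  | nil => rfl
  | cons h p =>
    rcases h.2.1 with h | h
    · exact absurd h (ha _)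
    · exact absurd h (hb _)

lemma ends_unique {B : SimpleGraph V}
    (hdeg : ∀ u n1 n2 n3, B.Adj u n1 → B.Adj u n2 → B.Adj u n3 → n1 = n2 ∨ n1 = n3 ∨ n2 = n3)
    {q r : V} (hr : ∀ n1 n2, B.Adj r n1 → B.Adj r n2 → n1 = n2)
    {u : V} (P1 : B.Walk u q) (hP1 : P1.IsPath)
    (hq : ∀ n1 n2, B.Adj q n1 → B.Adj q n2 → n1 = n2) :
    ∀ (P2 : B.Walk u r) (_ : P2.IsPath) (prev : V) (_ : B.Adj u prev)
    (_ : prev ∉ P1.support) (_ : prev ∉ P2.support), q = r := by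
  induction P1 with
  | nil =>
    intro P2 hP2 prev hadj h1 h2
    cases P2 with
    | nil => rfl
    | cons h p =>
      exfalso
      have := hq _ _ hadj h
      subst this
      simp at h2
  | cons h p ih =>
    intro P2 hP2 prev hadj h1 h2
    cases P2 with
    | nil =>
      exfalso
      have := hr _ _ hadj h
      subst this
      simp at h1
    | cons h' p' =>
      rename_i u v w v'
      simp only [SimpleGraph.Walk.support_cons, List.mem_cons, not_or] at h1 h2
      have hv : v = v' := by
        rcases hdeg _ _ _ _ hadj h h' with e | e | e
        · subst e; simp at h1
        · subst e; simp at h2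
        · exact e
      subst hv
      rw [SimpleGraph.Walk.cons_isPath_iff] at hP1 hP2
      exact ih hP1.1 hq p' hP2.1 u h.symm hP1.2 hP2.2

/-- Key lemma: a two-colored component has at most two ends. -/
lemma key (h : PC f) {a b : K} {p q r : V} (hp : Miss f p a ∨ Miss f p b)
    (hq : Miss f q a ∨ Miss f q b) (hr : Miss f r a ∨ Miss f r b)
    (hpq : p ≠ q) (hpr : p ≠ r) (hqr : q ≠ r) (h1 : R f a b p q) (h2 : R f a b p r) : False := by
  classical
  have hend : ∀ q, (Miss f q a ∨ Miss f q b) →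
      ∀ n1 n2, (bi f a b).Adj q n1 → (bi f a b).Adj q n2 → n1 = n2 := by
    intro q hq n1 n2 h1 h2
    rw [bi_adj h] at h1 h2
    rcases hq with hq | hq
    · exact h.prop _ _ _ _ (h1.resolve_left (hq _)) (h2.resolve_left (hq _))
    · exact h.prop _ _ _ _ (h1.resolve_right (hq _)) (h2.resolve_right (hq _))
  have hdeg : ∀ u n1 n2 n3, (bi f a b).Adj u n1 → (bi f a b).Adj u n2 → (bi f a b).Adj u n3 →
      n1 = n2 ∨ n1 = n3 ∨ n2 = n3 := by
    intro u n1 n2 n3 h1 h2 h3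
    rw [bi_adj h] at h1 h2 h3
    have := h.prop u
    grind
  obtain ⟨P1, hP1⟩ := h1.exists_isPath
  obtain ⟨P2, hP2⟩ := h2.exists_isPath
  cases P1 with
  | nil => exact hpq rfl
  | cons k1 P1 =>
    cases P2 with
    | nil => exact hpr rfl
    | cons k2 P2 =>
      have := hend p hp _ _ k1 k2
      subst this
      rw [SimpleGraph.Walk.cons_isPath_iff] at hP1 hP2
      exact hqr (ends_unique hdeg (hend r hr) P1 hP1.1 (hend q hq) P2 hP2.1 p k1.symm hP1.2 hP2.2)

/-- Peeling off an end vertex. -/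
lemma R.peel (h : PC f) {a e : K} {y p s : V} (hR : R f a e y s) (hys : y ≠ s)
    (he : Miss f y e) (hp : f y p = some a)
    (hag : ∀ u v c, u ≠ y → v ≠ y → (c = a ∨ c = e) → f u v = some c → f' u v = some c) :
    R f' a e p s := by
  classical
  obtain ⟨P, hP⟩ := SimpleGraph.Reachable.exists_isPath hR
  cases P with
  | nil => exact absurd rfl hys
  | cons k P =>
    rw [SimpleGraph.Walk.cons_isPath_iff] at hP
    have k' := ((bi_adj h).1 k).resolve_right (he _)
    have := h.prop _ _ _ _ hp k'
    subst this
    obtain ⟨-, hP⟩ := hP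
    clear k k' hp hR
    induction P with
    | nil => exact SimpleGraph.Reachable.refl _
    | cons k P ih =>
      simp only [SimpleGraph.Walk.support_cons, List.mem_cons, not_or] at hP
      refine R.trans ?_ (ih hys hP.2)
      refine SimpleGraph.Adj.reachable ?_
      have hne := hP.2
      rename_i u v w
      have hvy : v ≠ y := by
        rintro rfl
        exact hP.2 (by simp)
      have huy : u ≠ y := fun e => hP.1 e.symm
      refine ⟨k.1, ?_, ?_⟩
      · rcases k.2.1 with k | k
        · exact Or.inl (hag _ _ _ huy hvy (Or.inl rfl) k)
        · exact Or.inr (hag _ _ _ huy hvy (Or.inr rfl) k)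
      · rcases k.2.2 with k | k
        · exact Or.inl (hag _ _ _ hvy huy (Or.inl rfl) k)
        · exact Or.inr (hag _ _ _ hvy huy (Or.inr rfl) k)

lemma R.stub [DecidableEq V] (h : PC f) {a e : K} {y p s : V} (hR : R f a e y s)
    (he : Miss f y e) (hp : f y p = some a) (hpe : Miss f p e) : y = s ∨ p = s := by
  by_cases hys : y = s
  · exact Or.inl hys
  right
  have := R.peel (f' := upd f y p none) h hR hys he hp (by
    intro u v c hu hv _ h
    simp only [upd]
    grind)
  refine R.iso this ?_ ?_
  · intro w hw
    have := h.prop p y w a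
    have := h.symm y p
    simp only [upd] at hw
    grind
  · intro w hw
    have := hpe w
    simp only [upd] at hw
    grind



lemma PC.of_le (h : PC f) (hs : ∀ u v, f' u v = f' v u)
    (hm : ∀ p q c, f' p q = some c → f p q = some c) : PC f' := by
  refine ⟨hs, ?_, ?_, ?_⟩
  · intro u
    by_contra hn
    obtain ⟨c, hc⟩ := Option.ne_none_iff_exists'.1 hn
    have := hm _ _ _ hc
    simp [h.loop] at this
  · intro u v w a h1 h2
    exact h.prop _ _ _ _ (hm _ _ _ h1) (hm _ _ _ h2)
  · intro a b hab
    refine (h.acyc a b hab).anti ?_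
    intro u v huv
    exact ⟨huv.1, huv.2.1.imp (hm _ _ _) (hm _ _ _), huv.2.2.imp (hm _ _ _) (hm _ _ _)⟩

lemma PC.del [DecidableEq V] (h : PC f) (u v : V) : PC (upd f u v none) := by
  refine h.of_le ?_ ?_
  · intro p q
    have := h.symm p q
    simp only [upd]; grind
  · intro p q c
    simp only [upd]; grind

lemma PC.add [DecidableEq V] (h : PC f) {u v : V} {a : K} (huv : u ≠ v)
    (hu : Miss f u a) (hv : Miss f v a)
    (hR : ∀ g, g ≠ a → ¬ Miss f u g → ¬ Miss f v g → ¬ R f a g u v) :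
    PC (upd f u v (some a)) := by
  have hsy : ∀ p q, upd f u v (some a) p q = upd f u v (some a) q p := by
    intro p q
    have := h.symm p q
    simp only [upd]; grind
  have hR' : ∀ g, g ≠ a → ¬ R f a g u v := by
    intro g hg hr
    by_cases h1 : Miss f u g
    · exact huv (hr.iso hu h1)
    by_cases h2 : Miss f v g
    · exact huv (hr.symm.iso hv h2).symm
    exact hR g hg h1 h2 hr
  have hac : ∀ g, g ≠ a → (bi (upd f u v (some a)) a g).IsAcyclic := by
    intro g hg
    refine ((h.acyc a g (Ne.symm hg)).sup_edge_of_not_reachable (hR' g hg)).anti ?_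
    intro p q hpq
    have h2 := hpq.2
    by_cases hc : (p = u ∧ q = v) ∨ (p = v ∧ q = u)
    · refine Or.inr ?_
      simp only [SimpleGraph.edge_adj]
      grind
    · refine Or.inl ⟨hpq.1, ?_⟩
      simp only [upd] at h2
      grind
  refine ⟨hsy, ?_, ?_, ?_⟩
  · intro p
    have := h.loop p
    simp only [upd]; grind
  · intro p q r c h1 h2
    have h3 := h.prop p q r c
    have h4 := h.symm u v
    simp only [upd] at h1 h2
    simp only [Miss] at hu hv
    grind
  · intro c d hcd
    by_cases hc : c = a
    · subst hc
      exact hac d (Ne.symm hcd)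
    by_cases hd : d = a
    · subst hd
      rw [bi_comm]
      exact hac c hcd
    refine (h.acyc c d hcd).anti ?_
    intro p q hpq
    refine ⟨hpq.1, ?_⟩
    have h2 := hpq.2
    simp only [upd] at h2
    grind

end
end AEC

namespace AEC
section
variable {V K : Type*} {f f' : V → V → Option K}

/-- Same support. -/
def SS {V K : Type*} (f f' : V → V → Option K) : Prop := ∀ u v, (f' u v).isSome = (f u v).isSome

lemma SS.refl (f : V → V → Option K) : SS f f := fun _ _ => rfl

lemma SS.trans {f f' f'' : V → V → Option K} (h : SS f f') (h' : SS f' f'') : SS f f'' :=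
  fun u v => (h' u v).trans (h u v)

lemma not_miss {v : V} {a : K} : ¬ Miss f v a ↔ ∃ w, f v w = some a := by
  simp [Miss]

lemma upd_upd [DecidableEq V] (f : V → V → Option K) (u v : V) (o o' : Option K) :
    upd (upd f u v o) u v o' = upd f u v o' := by
  funext p q; simp only [upd]; grind

lemma PC.recolor [DecidableEq V] (h : PC f) {u v : V} {a b : K} (huv : u ≠ v) (hb : f u v = some b)
    (hu : Miss f u a) (hv : Miss f v a)
    (hR : ∀ g, g ≠ a → g ≠ b → ¬ Miss f u g → ¬ Miss f v g → ¬ R f a g u v) :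
    PC (upd f u v (some a)) := by
  have := (h.del u v).add (a := a) huv (fun w => by have := hu w; simp only [upd]; grind)
    (fun w => by have := hv w; simp only [upd]; grind) (by
      intro g hga h1 h2 h3
      have hgb : g ≠ b := by
        rintro rfl
        obtain ⟨w, hw⟩ := not_miss.1 h1
        have := h.prop u v w g hb
        simp only [upd] at hw
        grind
      refine hR g hga hgb ?_ ?_ ?_
      · obtain ⟨w, hw⟩ := not_miss.1 h1
        refine not_miss.2 ⟨w, ?_⟩
        simp only [upd] at hw
        grind
      · obtain ⟨w, hw⟩ := not_miss.1 h2
        refine not_miss.2 ⟨w, ?_⟩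
        simp only [upd] at hw
        grind
      · refine h3.mono ?_
        intro p q c _ hc
        simp only [upd] at hc
        grind)
  rwa [upd_upd] at this

lemma SS.upd [DecidableEq V] (h : PC f) {u v : V} {a b : K} (hb : f u v = some b) :
    SS f (upd f u v (some a)) := by
  intro p q
  have := h.symm u v
  simp only [AEC.upd]
  grind

/-- Swap of two edges at `y`. -/
def swp [DecidableEq V] (f : V → V → Option K) (y p q : V) (a b : K) : V → V → Option K :=
  upd (upd f y p (some b)) y q (some a)

lemma swp_PC [DecidableEq V] (h : PC f) {y p q : V} {a b : K} (hpq : p ≠ q)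
    (hp : f y p = some a) (hq : f y q = some b) (hpb : Miss f p b) (hqa : Miss f q a)
    (h1 : ∀ g w, g ≠ a → g ≠ b → f y w = some g → ¬ Miss f p g → Miss f w b)
    (h2 : ∀ g w, g ≠ a → g ≠ b → f y w = some g → ¬ Miss f q g → Miss f w a) :
    PC (swp f y p q a b) := by
  have hyp : y ≠ p := by rintro rfl; simp [h.loop] at hp
  have hyq : y ≠ q := by rintro rfl; simp [h.loop] at hq
  have hab : a ≠ b := by
    rintro rfl
    exact hpq (h.prop _ _ _ _ hp hq)
  have sy := h.symm
  have pr := h.prop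
  have pc1 := (h.del y p).del y q
  have pc2 : PC (upd (upd (upd f y p none) y q none) y p (some b)) := by
    refine pc1.add hyp ?_ ?_ ?_
    · intro w hw
      simp only [upd] at hw
      grind
    · intro w hw
      have := hpb w
      simp only [upd] at hw
      grind
    · intro g hg hm1 hm2 hR
      obtain ⟨w, hw⟩ := not_miss.1 hm1
      obtain ⟨w', hw'⟩ := not_miss.1 hm2
      have hga : g ≠ a := by simp only [upd] at hw; grind
      have hyw : f y w = some g := by simp only [upd] at hw; grind
      have hm := h1 g w hga hg hyw (not_miss.2 ⟨w', by simp only [upd] at hw'; grind⟩)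
      have := R.stub pc1 (R.swap hR) (fun z hz => by simp only [upd] at hz; grind) hw
        (fun z hz => hm z (by simp only [upd] at hz; grind))
      grind
  have e2 : upd (upd (upd f y p none) y q none) y p (some b) =
      upd (upd f y p (some b)) y q none := by
    funext u v; simp only [upd]; grind
  rw [e2] at pc2
  have pc3 : PC (upd (upd (upd f y p (some b)) y q none) y q (some a)) := by
    refine pc2.add hyq ?_ ?_ ?_
    · intro w hw
      simp only [upd] at hw
      grind
    · intro w hw
      have := hqa w
      simp only [upd] at hw
      grind
    · intro g hg hm1 hm2 hR
      obtain ⟨w, hw⟩ := not_miss.1 hm1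
      obtain ⟨w', hw'⟩ := not_miss.1 hm2
      have hgb : g ≠ b := by
        have := sy q y
        simp only [upd] at hw'; grind
      have hyw : f y w = some g := by simp only [upd] at hw; grind
      have hm := h2 g w hg hgb hyw (not_miss.2 ⟨w', by simp only [upd] at hw'; grind⟩)
      have hwp : w ≠ p := by grind
      have := R.stub pc2 (R.swap hR) (fun z hz => by simp only [upd] at hz; grind) hw
        (fun z hz => hm z (by simp only [upd] at hz; grind))
      grind
  rwa [upd_upd] at pc3

lemma swp_SS [DecidableEq V] (h : PC f) {y p q : V} {a b : K}
    (hp : f y p = some a) (hq : f y q = some b) : SS f (swp f y p q a b) := by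
  intro u v
  have := h.symm y p
  have := h.symm y q
  simp only [swp, upd]
  grind

lemma swp_R [DecidableEq V] (h : PC f) {y p q s : V} {a b e : K}
    (hp : f y p = some a) (he : Miss f y e) (hys : y ≠ s)
    (hR : R f a e y s) : R (swp f y p q a b) a e p s := by
  refine hR.peel h hys he hp ?_
  intro u v c hu hv _ hc
  simp only [swp, upd]; grind

lemma swp_R' [DecidableEq V] (h : PC f) {y p q s : V} {a b e : K}
    (hq : f y q = some b) (he : Miss f y e) (hys : y ≠ s)
    (hR : R f b e y s) : R (swp f y p q a b) b e q s := by
  refine hR.peel h hys he hq ?_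
  intro u v c hu hv _ hc
  simp only [swp, upd]; grind

lemma swp_R_iff [DecidableEq V] (h : PC f) {y p q s t : V} {a b g k : K}
    (hp : f y p = some a) (hq : f y q = some b)
    (hga : g ≠ a) (hgb : g ≠ b) (hka : k ≠ a) (hkb : k ≠ b) :
    R (swp f y p q a b) g k s t ↔ R f g k s t := by
  have := h.symm y p
  have := h.symm y q
  constructor
  · refine fun hR => hR.mono ?_
    intro u v c hc
    simp only [swp, upd]
    grind
  · refine fun hR => hR.mono ?_
    intro u v c hc
    simp only [swp, upd]
    grind

lemma SS.none {f f' : V → V → Option K} (h : SS f f') {u v : V} (hn : f u v = none) : f' u v = none := by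
  have := h u v
  rw [hn] at this
  simpa using this

lemma SS.some {f f' : V → V → Option K} (h : SS f f') {u v : V} {a : K} (hn : f' u v = some a) :
    ∃ b, f u v = some b := by
  have := h u v
  rw [hn] at this
  exact Option.isSome_iff_exists.1 (by simpa using this.symm)

variable [Fintype K]

open Classical in
/-- Set of colors at a vertex. -/
noncomputable def Cs (f : V → V → Option K) (v : V) : Finset K :=
  Finset.univ.filter (fun a => ¬ Miss f v a)

lemma mem_Cs {v : V} {a : K} : a ∈ Cs f v ↔ ¬ Miss f v a := by
  simp [Cs]

lemma Cs_card_le (v : V) (S : Finset V) (hS : ∀ w a, f v w = some a → w ∈ S) :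
    (Cs f v).card ≤ S.card := by
  classical
  have hex : ∀ a ∈ Cs f v, ∃ w, f v w = some a := by
    intro a ha
    exact not_miss.1 (mem_Cs.1 ha)
  have : Nonempty V := ⟨v⟩
  choose! g hg using hex
  refine Finset.card_le_card_of_injOn g ?_ ?_
  · intro a ha
    exact hS _ _ (hg a ha)
  · intro a ha b hb hab
    have h1 := hg a ha
    have h2 := hg b hb
    rw [hab, h2] at h1
    simpa using h1.symm

lemma exists_miss [DecidableEq K] (v : V) (S : Finset K) (h : (Cs f v).card + S.card < Fintype.card K) :
    ∃ a, Miss f v a ∧ a ∉ S := by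
  by_contra hn
  push Not at hn
  have : (Finset.univ : Finset K) ⊆ Cs f v ∪ S := by
    intro a _
    by_cases ha : Miss f v a
    · simp [hn a ha]
    · simp [mem_Cs.2 ha]
  have h1 := Finset.card_le_card this
  have h2 := Finset.card_union_le (Cs f v) S
  rw [Finset.card_univ] at h1
  omega

lemma inter_unique [DecidableEq K] {y p : V} (hmis : ∀ e, Miss f y e → ¬ Miss f p e)
    (hc : (Cs f p).card + (Cs f y).card ≤ Fintype.card K + 1) {a g : K}
    (ha : ¬ Miss f y a) (ha' : ¬ Miss f p a) (hg : ¬ Miss f y g) (hg' : ¬ Miss f p g) : g = a := by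
  have h1 : Cs f p ∪ Cs f y = Finset.univ := by
    ext e
    simp only [Finset.mem_union, mem_Cs, Finset.mem_univ, iff_true]
    have := hmis e
    tauto
  have h2 := Finset.card_union_add_card_inter (Cs f p) (Cs f y)
  rw [h1, Finset.card_univ] at h2
  have h3 : (Cs f p ∩ Cs f y).card ≤ 1 := by omega
  rw [Finset.card_le_one] at h3
  exact h3 g (by simp [mem_Cs, hg, hg']) a (by simp [mem_Cs, ha, ha'])

/-- Blocking principle for the uncolored edge `xy`. -/
def Blk (f : V → V → Option K) (x y : V) : Prop :=
  ∀ f', PC f' → SS f f' → ∀ e, Miss f' x e → Miss f' y e →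
    ∃ g, g ≠ e ∧ ¬ Miss f' x g ∧ ¬ Miss f' y g ∧ R f' g e x y

lemma case_two [DecidableEq V] [DecidableEq K] (h : PC f) {x y x1 : V} {c1 : K} (hxy : x ≠ y)
    (hx1 : f x x1 = some c1) (hx : ∀ w a, f x w = some a → w = x1) (hfxy : f x y = none)
    (hB : Blk f x y) (hcx1 : (Cs f x1).card < Fintype.card K)
    (hcy : (Cs f y).card + 2 ≤ Fintype.card K)
    (hp : ∀ p a, f y p = some a → (Cs f p).card + (Cs f y).card ≤ Fintype.card K + 1) : False := by
  have sy := h.symm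
  have pr := h.prop
  have hfyx : f y x = none := by rw [sy]; exact hfxy
  have hx1y : x1 ≠ y := by rintro rfl; simp [hx1] at hfxy
  have hxx1 : x ≠ x1 := by rintro rfl; simp [h.loop] at hx1
  have hxc : ∀ g, ¬ Miss f x g → g = c1 := by
    intro g hg
    obtain ⟨w, hw⟩ := not_miss.1 hg
    have := hx w g hw
    grind
  have hxm : ∀ e, e ≠ c1 → Miss f x e := by
    intro e he
    by_contra hn
    exact he (hxc e hn)
  obtain ⟨e0, he0, he0c⟩ := exists_miss (f := f) y {c1} (by simp; omega)
  simp only [Finset.mem_singleton] at he0c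
  have hc1y : ¬ Miss f y c1 := by
    obtain ⟨g, -, hg1, hg2, -⟩ := hB f h (SS.refl f) e0 (hxm _ he0c) he0
    rwa [hxc g hg1] at hg2
  obtain ⟨y1, hy1⟩ := not_miss.1 hc1y
  have hec1 : ∀ e, Miss f y e → e ≠ c1 := by
    rintro e he rfl
    exact hc1y he
  have hR1 : ∀ e, Miss f y e → R f c1 e x y := by
    intro e he
    obtain ⟨g, -, hg1, hg2, hg⟩ := hB f h (SS.refl f) e (hxm _ (hec1 e he)) he
    rwa [hxc g hg1] at hg
  have hxy1 : x ≠ y1 := by rintro rfl; simp [hfyx] at hy1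
  have hy1e : ∀ e, Miss f y e → ¬ Miss f y1 e := by
    intro e he hn
    rcases (hR1 e he).symm.stub h he hy1 hn with h1 | h1
    · exact hxy h1.symm
    · exact hxy1 h1.symm
  have hy1u : ∀ g, ¬ Miss f y g → ¬ Miss f y1 g → g = c1 := fun g hg hg' =>
    inter_unique hy1e (hp _ _ hy1) hc1y (not_miss.2 ⟨y, by rw [sy]; exact hy1⟩) hg hg'
  obtain ⟨γ, hγ, -⟩ := exists_miss (f := f) x1 ∅ (by simpa using hcx1)
  have hγc : γ ≠ c1 := by
    rintro rfl
    exact hγ x (by rw [sy]; exact hx1)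
  have hγy : ¬ Miss f y γ := by
    intro hn
    rcases (hR1 γ hn).stub h (hxm _ hγc) hx1 hγ with h1 | h1
    · exact hxy h1
    · exact hx1y h1
  obtain ⟨y2, hy2⟩ := not_miss.1 hγy
  have hxy2 : x ≠ y2 := by rintro rfl; simp [hfyx] at hy2
  have hx1y2 : x1 ≠ y2 := by rintro rfl; exact hγ y (by rw [sy]; exact hy2)
  have hy2e : ∀ e, Miss f y e → ¬ Miss f y2 e := by
    intro e he hn
    have pc2 : PC (upd f x x1 (some γ)) := h.recolor hxx1 hx1 (hxm _ hγc) hγ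
      (fun g _ hgc hm => absurd (hxc g hm) hgc)
    have hee : e ≠ γ := by rintro rfl; exact hγy he
    have hm2 : Miss (upd f x x1 (some γ)) y e := by
      intro w hw
      have := he w
      simp only [upd] at hw; grind
    have hm1 : Miss (upd f x x1 (some γ)) x e := by
      intro w hw
      have := hxm e (hec1 e he) w
      simp only [upd] at hw; grind
    obtain ⟨g, -, hg1, hg2, hg⟩ := hB _ pc2 (SS.upd h hx1) e hm1 hm2
    have hgγ : g = γ := by
      obtain ⟨w, hw⟩ := not_miss.1 hg1
      simp only [upd] at hw
      grind
    rw [hgγ] at hg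
    rcases hg.symm.stub pc2 hm2 (p := y2) (by simp only [upd]; grind) (by
      intro w hw
      have := hn w
      simp only [upd] at hw; grind) with h1 | h1
    · exact hxy h1.symm
    · exact hxy2 h1.symm
  have hy2u : ∀ g, ¬ Miss f y g → ¬ Miss f y2 g → g = γ := fun g hg hg' =>
    inter_unique hy2e (hp _ _ hy2) hγy (not_miss.2 ⟨y, by rw [sy]; exact hy2⟩) hg hg'
  have hy12 : y1 ≠ y2 := by
    rintro rfl
    rw [hy1] at hy2
    grind
  have hm1 : Miss f y1 γ := by
    by_contra hn
    exact hγc (hy1u _ hγy hn)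
  have hm2 : Miss f y2 c1 := by
    by_contra hn
    exact hγc (hy2u _ hc1y hn).symm
  have pc3 := swp_PC h hy12 hy1 hy2 hm1 hm2
    (fun g w hg1 hg2 hw hn => absurd (hy1u g (not_miss.2 ⟨w, hw⟩) hn) hg1)
    (fun g w hg1 hg2 hw hn => absurd (hy2u g (not_miss.2 ⟨w, hw⟩) hn) hg2)
  have he3 : Miss (swp f y y1 y2 c1 γ) y e0 := by
    intro w hw
    have := he0 w
    simp only [swp, upd] at hw; grind
  have hx3 : ∀ e, e ≠ c1 → Miss (swp f y y1 y2 c1 γ) x e := by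
    intro e he w hw
    have := hxm e he w
    simp only [swp, upd] at hw; grind
  obtain ⟨g, -, hg1, hg2, hg⟩ := hB _ pc3 (swp_SS h hy1 hy2) e0 (hx3 _ he0c) he3
  have hgc : g = c1 := by
    by_contra hn
    exact hg1 (hx3 g hn)
  rw [hgc] at hg
  have hr := swp_R (q := y2) (b := γ) h hy1 he0 hxy.symm (hR1 e0 he0).symm
  refine key pc3 (p := x) (q := y) (r := y1) (Or.inr (hx3 _ he0c)) (Or.inr he3) (Or.inl ?_) hxy hxy1
    ?_ hg hr.symm
  · intro w hw
    have := h.loop y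
    simp only [swp, upd] at hw; grind
  · rintro rfl
    simp [h.loop] at hy1

end
end AEC

namespace AEC
section
variable {V K : Type*} {f : V → V → Option K} [Fintype K] [DecidableEq V] [DecidableEq K]

lemma four {p : V} (hc : (Cs f p).card ≤ 3) {a b c d : K} (ha : ¬ Miss f p a) (hb : ¬ Miss f p b)
    (hcc : ¬ Miss f p c) (hd : ¬ Miss f p d) :
    a = b ∨ a = c ∨ a = d ∨ b = c ∨ b = d ∨ c = d := by
  by_contra hn
  push Not at hn
  have : ({a, b, c, d} : Finset K) ⊆ Cs f p := by
    intro e he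
    simp only [Finset.mem_insert, Finset.mem_singleton] at he
    rcases he with rfl | rfl | rfl | rfl <;> exact mem_Cs.2 (by assumption)
  have h1 := Finset.card_le_card this
  have h2 : ({a, b, c, d} : Finset K).card = 4 := by
    rw [Finset.card_insert_of_notMem, Finset.card_insert_of_notMem, Finset.card_insert_of_notMem,
      Finset.card_singleton] <;> simp <;> grind
  omega

/-- Case I, both colors of `x` appear at `y`. -/
lemma case_I_2 (h : PC f) {x y x1 x2 y1 y2 : V} {c1 c2 α β γ : K} (hxy : x ≠ y)
    (hx1 : f x x1 = some c1) (hx2 : f x x2 = some c2)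
    (hx : ∀ w a, f x w = some a → w = x1 ∨ w = x2) (hfxy : f x y = none)
    (hB : Blk f x y)
    (hp : ∀ p a, f y p = some a → (Cs f p).card ≤ 3)
    (hy1 : f y y1 = some c1) (hy2 : f y y2 = some c2) (h12 : c1 ≠ c2)
    (hα : Miss f y α) (hβ : Miss f y β) (hγ : Miss f y γ) (hαβ : α ≠ β) (hαγ : α ≠ γ) (hβγ : β ≠ γ)
    (hα1 : ¬ Miss f y1 α) (hβ1 : ¬ Miss f y1 β) (hγ2 : ¬ Miss f y2 γ) : False := by
  have sy := h.symm
  have pr := h.prop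
  have hfyx : f y x = none := by rw [sy]; exact hfxy
  have hyy1 : y ≠ y1 := by rintro rfl; simp [h.loop] at hy1
  have hxy1 : x ≠ y1 := by rintro rfl; simp [hfyx] at hy1
  have hxy2 : x ≠ y2 := by rintro rfl; simp [hfyx] at hy2
  have hy12 : y1 ≠ y2 := by rintro rfl; rw [hy1] at hy2; grind
  have h1c : ¬ Miss f y1 c1 := not_miss.2 ⟨y, by rw [sy]; exact hy1⟩
  have h2c : ¬ Miss f y2 c2 := not_miss.2 ⟨y, by rw [sy]; exact hy2⟩
  have hac : ∀ e, Miss f y e → e ≠ c1 ∧ e ≠ c2 := by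
    intro e he
    exact ⟨fun h => he y1 (by rw [hy1, h]), fun h => he y2 (by rw [hy2, h])⟩
  have k1 := hac α hα
  have k2 := hac β hβ
  have k3 := hac γ hγ
  have hy1s : ∀ g, ¬ Miss f y1 g → g = c1 ∨ g = α ∨ g = β := by
    intro g hg
    have := four (hp _ _ hy1) h1c hα1 hβ1 hg
    grind
  have pc2 : PC (upd f y y1 (some γ)) := by
    refine h.recolor hyy1 hy1 hγ ?_ ?_
    · by_contra hn
      have := hy1s _ hn
      grind
    · intro g hg1 hg2 hg3 hg4
      rcases hy1s g hg4 with rfl | rfl | rfl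
      · exact absurd rfl hg2
      · exact absurd hα hg3
      · exact absurd hβ hg3
  obtain ⟨e, hey, he2, hec, heγ⟩ : ∃ e, Miss f y e ∧ Miss f y2 e ∧ (e ≠ c1 ∧ e ≠ c2) ∧ e ≠ γ := by
    by_cases hm : Miss f y2 α
    · exact ⟨α, hα, hm, k1, hαγ⟩
    by_cases hm' : Miss f y2 β
    · exact ⟨β, hβ, hm', k2, hβγ⟩
    have := four (hp _ _ hy2) h2c hγ2 hm hm'
    grind
  have hmy : Miss (upd f y y1 (some γ)) y e := by
    intro w hw
    have := hey w
    simp only [upd] at hw; grind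
  obtain ⟨g, -, hg1, hg2, hg⟩ := hB _ pc2 (SS.upd h hy1) e (by
    intro w hw
    simp only [upd] at hw; grind) hmy
  have hgc : g = c2 := by
    obtain ⟨w, hw⟩ := not_miss.1 hg1
    obtain ⟨w', hw'⟩ := not_miss.1 hg2
    simp only [upd] at hw hw'
    grind
  rw [hgc] at hg
  rcases hg.symm.stub pc2 hmy (p := y2) (by simp only [upd]; grind) (by
      intro w hw
      have := he2 w
      simp only [upd] at hw; grind) with h1 | h1
  · exact hxy h1.symm
  · exact hxy2 h1.symm

/-- Case I, count 0. -/
lemma case_I_rec2 (h : PC f) {y yg w w3 : V} {γ p q ε1 ε2 ε3 : K}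
    (hp : ∀ p a, f y p = some a → (Cs f p).card ≤ 3)
    (hyg : f y yg = some γ) (hw : f y w = some p) (hw3 : f y w3 = some q)
    (h1 : Miss f y ε1) (h2 : Miss f y ε2) (h3 : Miss f y ε3)
    (h12 : ε1 ≠ ε2) (h13 : ε1 ≠ ε3) (h23 : ε2 ≠ ε3)
    (g1 : Miss f yg ε1) (g2 : Miss f yg ε2)
    (hpγ : p ≠ γ) (hqγ : q ≠ γ) (hgp : ¬ Miss f yg p) (hgq : ¬ Miss f yg q)
    (w1 : ¬ Miss f w ε1) (w2 : ¬ Miss f w ε2) (w33 : ¬ Miss f w3 ε3) :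
    ∃ ε, (ε = ε1 ∨ ε = ε2) ∧ PC (upd (upd f y w (some ε3)) y yg (some ε)) ∧
      (∀ g, ¬ Miss f w g → g = p ∨ g = ε1 ∨ g = ε2) := by
  have sy := h.symm
  have pr := h.prop
  have lo := h.loop
  have hwp : ¬ Miss f w p := not_miss.2 ⟨y, by rw [sy]; exact hw⟩
  have hwq : ¬ Miss f w3 q := not_miss.2 ⟨y, by rw [sy]; exact hw3⟩
  have hgγ : ¬ Miss f yg γ := not_miss.2 ⟨y, by rw [sy]; exact hyg⟩
  have hne : ∀ e z g, Miss f y e → f y z = some g → e ≠ g := by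
    intro e z g he hz hh
    exact he z (by rw [hz, hh])
  have n1 := hne _ _ _ h1 hw
  have n2 := hne _ _ _ h2 hw
  have n3 := hne _ _ _ h3 hw
  have n4 := hne _ _ _ h1 hw3
  have n5 := hne _ _ _ h2 hw3
  have n6 := hne _ _ _ h3 hw3
  have n7 := hne _ _ _ h1 hyg
  have n8 := hne _ _ _ h2 hyg
  have hws : ∀ g, ¬ Miss f w g → g = p ∨ g = ε1 ∨ g = ε2 := by
    intro g hg
    have := four (hp _ _ hw) hwp w1 w2 hg
    grind
  have hm3 : Miss f w ε3 := by
    by_contra hn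
    have := hws _ hn
    grind
  have hpq : p ≠ q := by
    rintro rfl
    have := pr _ _ _ _ hw hw3
    subst this
    exact w33 hm3
  have hww3 : w ≠ w3 := by rintro rfl; exact w33 hm3
  have hwyg : w ≠ yg := by rintro rfl; grind
  have hw3yg : w3 ≠ yg := by rintro rfl; grind
  have hyw : y ≠ w := by rintro rfl; simp [lo] at hw
  have hyyg : y ≠ yg := by rintro rfl; simp [lo] at hyg
  obtain ⟨ε, hε, hε3⟩ : ∃ ε, (ε = ε1 ∨ ε = ε2) ∧ Miss f w3 ε := by
    by_cases hm : Miss f w3 ε1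
    · exact ⟨_, Or.inl rfl, hm⟩
    by_cases hm' : Miss f w3 ε2
    · exact ⟨_, Or.inr rfl, hm'⟩
    have := four (hp _ _ hw3) hwq hm hm' w33
    grind
  have hεy : Miss f y ε := by rcases hε with rfl | rfl <;> assumption
  have hεg : Miss f yg ε := by rcases hε with rfl | rfl <;> assumption
  have hεε : ε ≠ ε3 := by grind
  have hgs : ∀ g, ¬ Miss f yg g → g = γ ∨ g = p ∨ g = q := by
    intro g hg
    have := four (hp _ _ hyg) hgγ hgp hgq hg
    grind
  refine ⟨ε, hε, ?_, hws⟩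
  have pc2 : PC (upd f y w (some ε3)) := by
    refine h.recolor hyw hw h3 hm3 ?_
    intro g _ hg2 hg3 hg4
    rcases hws g hg4 with rfl | rfl | rfl
    · exact absurd rfl hg2
    · exact absurd h1 hg3
    · exact absurd h2 hg3
  have hmy : Miss (upd f y w (some ε3)) y ε := by
    intro z hz
    have := hεy z
    simp only [upd] at hz; grind
  refine pc2.recolor (b := γ) hyyg (by simp only [upd]; grind) hmy ?_ ?_
  · intro z hz
    have := hεg z
    simp only [upd] at hz; grind
  · intro g hg1 hg2 hg3 hg4 hR
    obtain ⟨z, hz⟩ := not_miss.1 hg3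
    obtain ⟨z', hz'⟩ := not_miss.1 hg4
    have hgq' : g = q := by
      have := hgs g (not_miss.2 ⟨z', by simp only [upd] at hz'; grind⟩)
      simp only [upd] at hz
      grind
    subst hgq'
    rcases hR.swap.stub pc2 hmy (p := w3) (by simp only [upd]; grind) (by
      intro w hw
      have := hε3 w
      simp only [upd] at hw; grind) with h1 | h1
    · exact hyyg h1
    · exact hw3yg h1

end
end AEC

namespace AEC
section
variable {V K : Type*} {f : V → V → Option K} [Fintype K] [DecidableEq V] [DecidableEq K]

/-- Case I, one common color, first subcase. -/
lemma case_I_1a (h : PC f) {x y x1 x2 y1 : V} {c1 c2 α β γ : K} (hxy : x ≠ y)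
    (hx1 : f x x1 = some c1) (hx2 : f x x2 = some c2)
    (hx : ∀ w a, f x w = some a → w = x1 ∨ w = x2) (hfxy : f x y = none)
    (hB : Blk f x y)
    (hp : ∀ p a, f y p = some a → (Cs f p).card ≤ 3)
    (hy1 : f y y1 = some c1) (hc2 : Miss f y c2) (h12 : c1 ≠ c2)
    (hα : Miss f y α) (hβ : Miss f y β) (hαβ : α ≠ β) (hα2 : α ≠ c2) (hβ2 : β ≠ c2)
    (hα1 : ¬ Miss f y1 α) (hβ1 : ¬ Miss f y1 β)
    (hRα : R f c1 α x y) (hRβ : R f c1 β x y)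
    (hγ1 : Miss f x1 γ) (hγ2 : γ ≠ c2) (hγy : ¬ Miss f y γ) : False := by
  have sy := h.symm
  have pr := h.prop
  have lo := h.loop
  have hfyx : f y x = none := by rw [sy]; exact hfxy
  have hyy1 : y ≠ y1 := by rintro rfl; simp [h.loop] at hy1
  have hxy1 : x ≠ y1 := by rintro rfl; simp [hfyx] at hy1
  have hx1y : x1 ≠ y := by rintro rfl; simp [hx1] at hfxy
  have hγc1 : γ ≠ c1 := by
    rintro rfl
    exact hγ1 x (by rw [sy]; exact hx1)
  obtain ⟨yg, hyg⟩ := not_miss.1 hγy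
  have hxyg : x ≠ yg := by rintro rfl; simp [hfyx] at hyg
  have hyyg : y ≠ yg := by rintro rfl; simp [h.loop] at hyg
  have hx1yg : x1 ≠ yg := by rintro rfl; exact hγ1 y (by rw [sy]; exact hyg)
  have hy1g : y1 ≠ yg := by rintro rfl; grind
  have h1c : ¬ Miss f y1 c1 := not_miss.2 ⟨y, by rw [sy]; exact hy1⟩
  have hgγ : ¬ Miss f yg γ := not_miss.2 ⟨y, by rw [sy]; exact hyg⟩
  have hne : ∀ e z g, Miss f y e → f y z = some g → e ≠ g := by
    intro e z g he hz hh
    exact he z (by rw [hz, hh])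
  have hy1s : ∀ g, ¬ Miss f y1 g → g = c1 ∨ g = α ∨ g = β := by
    intro g hg
    have := four (hp _ _ hy1) h1c hα1 hβ1 hg
    have := hne _ _ _ hα hy1
    have := hne _ _ _ hβ hy1
    grind
  have hxm : ∀ e, e ≠ c1 → e ≠ c2 → Miss f x e := by
    intro e h1 h2 w hw
    have := hx w e hw
    grind
  have fin : ∀ f2, PC f2 → SS f f2 → Miss f2 y γ → Miss f2 x1 γ → (∀ w, f2 x w = f x w) →
      (∀ w, f2 y w = some c2 → Miss f2 w γ) → False := by
    intro f2 pc ss m1 m2 hfx m3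
    have mx : Miss f2 x γ := by
      intro w hw
      rw [hfx] at hw
      exact hxm γ hγc1 hγ2 w hw
    obtain ⟨g, -, hg1, hg2, hg⟩ := hB _ pc ss γ mx m1
    have hgc : g = c1 ∨ g = c2 := by
      by_contra hn
      push Not at hn
      obtain ⟨w, hw⟩ := not_miss.1 hg1
      rw [hfx] at hw
      exact hxm g hn.1 hn.2 w hw
    rcases hgc with rfl | rfl
    · rcases hg.stub pc mx (p := x1) (by rw [hfx, hx1]) m2 with h1 | h1
      · exact hxy h1
      · exact hx1y h1
    · obtain ⟨w, hw⟩ := not_miss.1 hg2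
      rcases hg.symm.stub pc m1 hw (m3 w hw) with h1 | h1
      · exact hxy h1.symm
      · subst h1
        rw [pc.symm, hfx, hfxy] at hw
        cases hw
  have reca : ∀ ε, Miss f y ε → (ε = c2 ∨ R f c1 ε x y ∧ Miss f x ε) → Miss f yg ε →
      ∃ p w, p ≠ γ ∧ p ≠ c1 ∧ f y w = some p ∧ ¬ Miss f yg p ∧ ¬ Miss f w ε := by
    intro ε hεy hε hεg
    by_contra hn
    push Not at hn
    have hεγ := hne _ _ _ hεy hyg
    have hεc1 := hne _ _ _ hεy hy1
    have pc2 : PC (upd f y yg (some ε)) := by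
      refine h.recolor hyyg hyg hεy hεg ?_
      intro g hg1 hg2 hg3 hg4 hR
      by_cases hgc : g = c1
      · subst hgc
        rcases hε with rfl | ⟨hε, hεx⟩
        · have : Miss f y1 ε := by
            by_contra hn
            have := hy1s _ hn
            grind
          rcases hR.swap.stub h hεy hy1 this with h1 | h1
          · exact hyyg h1
          · exact hy1g h1
        · exact key h (p := y) (q := x) (r := yg) (Or.inr hεy) (Or.inr hεx) (Or.inr hεg)
            hxy.symm hyyg hxyg hε.symm hR.swap
      · obtain ⟨w, hw⟩ := not_miss.1 hg3
        rcases hR.swap.stub h hεy hw (hn g w hg2 hgc hw hg4) with h1 | h1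
        · exact hyyg h1
        · subst h1; grind
    refine fin _ pc2 (SS.upd h hyg) ?_ ?_ ?_ ?_
    · intro w hw
      simp only [upd] at hw; grind
    · intro w hw
      have := hγ1 w
      simp only [upd] at hw; grind
    · intro w
      simp only [upd]; grind
    · intro w hw z hz
      have := hc2 w
      simp only [upd] at hw hz; grind
  let T : K → Prop := fun ε => Miss f y ε ∧ (ε = c2 ∨ R f c1 ε x y ∧ Miss f x ε)
  have hT : ∀ ε, T ε → ε ≠ γ ∧ ε ≠ c1 := fun ε hε => ⟨hne _ _ _ hε.1 hyg, hne _ _ _ hε.1 hy1⟩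
  have hTp : ∀ ε p w, T ε → f y w = some p → ε ≠ p := fun ε p w hε hp => hne _ _ _ hε.1 hp
  have two : ∀ ε1 ε2 ε3, T ε1 → T ε2 → T ε3 → ε1 ≠ ε2 → ε1 ≠ ε3 → ε2 ≠ ε3 →
      ¬ Miss f yg ε1 → ¬ Miss f yg ε2 → False := by
    intro ε1 ε2 ε3 t1 t2 t3 n12 n13 n23 g1 g2
    have k1 := hT _ t1
    have k2 := hT _ t2
    have k3 := hT _ t3
    by_cases g3 : Miss f yg ε3
    · obtain ⟨p, w, p1, p2, p3, p4, p5⟩ := reca ε3 t3.1 t3.2 g3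
      have := hTp _ _ _ t1 p3
      have := hTp _ _ _ t2 p3
      have := four (hp _ _ hyg) hgγ g1 g2 p4
      grind
    · have := four (hp _ _ hyg) hgγ g1 g2 g3
      grind
  have tα : T α := ⟨hα, Or.inr ⟨hRα, hxm _ (hne _ _ _ hα hy1) hα2⟩⟩
  have tβ : T β := ⟨hβ, Or.inr ⟨hRβ, hxm _ (hne _ _ _ hβ hy1) hβ2⟩⟩
  have tc : T c2 := ⟨hc2, Or.inl rfl⟩
  have one : ∀ ε1 ε2 ε0, T ε1 → T ε2 → T ε0 → ε1 ≠ ε2 → ε1 ≠ ε0 → ε2 ≠ ε0 →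
      ¬ Miss f yg ε0 → Miss f yg ε1 → Miss f yg ε2 → False := by
    intro ε1 ε2 ε0 t1 t2 t0 n12 n10 n20 g0 g1 g2
    have k1 := hT _ t1
    have k2 := hT _ t2
    have k0 := hT _ t0
    obtain ⟨p, w, p1, p2, p3, p4, p5⟩ := reca ε1 t1.1 t1.2 g1
    obtain ⟨q, w', q1, q2, q3, q4, q5⟩ := reca ε2 t2.1 t2.2 g2
    have m1 := hTp _ _ _ t0 p3
    have m2 := hTp _ _ _ t0 q3
    have m3 := hTp _ _ _ t1 p3
    have m4 := hTp _ _ _ t2 p3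
    have hpq : p = q := by
      have := four (hp _ _ hyg) hgγ g0 p4 q4
      grind
    subst hpq
    have := pr _ _ _ _ p3 q3
    subst this
    have hwp : ¬ Miss f w p := not_miss.2 ⟨y, by rw [sy]; exact p3⟩
    have hwc : Miss f w c1 := by
      by_contra hn
      have := four (hp _ _ p3) hwp p5 q5 hn
      grind
    have hm1 : Miss f y1 γ := by
      by_contra hn
      have := hy1s _ hn
      have := hT _ tα
      have := hT _ tβ
      grind
    have hgs : ∀ g, ¬ Miss f yg g → g = γ ∨ g = ε0 ∨ g = p := by
      intro g hg
      have := four (hp _ _ hyg) hgγ g0 p4 hg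
      grind
    have hm2 : Miss f yg c1 := by
      by_contra hn
      have := hgs _ hn
      grind
    have pc3 := swp_PC h hy1g hy1 hyg hm1 hm2 (by
      intro g z hg1 hg2 hz hn
      rcases hy1s g hn with rfl | rfl | rfl
      · exact absurd rfl hg1
      · exact absurd hz (hα z)
      · exact absurd hz (hβ z)) (by
      intro g z hg1 hg2 hz hn
      rcases hgs g hn with rfl | rfl | rfl
      · exact absurd rfl hg2
      · exact absurd hz (t0.1 z)
      · rwa [pr _ _ _ _ hz p3])
    have he3 : ∀ e, Miss f y e → Miss (swp f y y1 yg c1 γ) y e := by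
      intro e he w hw
      have := he w
      simp only [swp, upd] at hw; grind
    have hx3 : ∀ e, e ≠ c1 → e ≠ c2 → Miss (swp f y y1 yg c1 γ) x e := by
      intro e he he' w hw
      have := hxm e he he' w
      simp only [swp, upd] at hw; grind
    have hac1 := (hT _ tα).2
    obtain ⟨g, -, hg1, hg2, hg⟩ := hB _ pc3 (swp_SS h hy1 hyg) α (hx3 _ hac1 hα2) (he3 _ hα)
    have hgc : g = c1 := by
      by_contra hn
      by_cases hg2' : g = c2
      · subst hg2'
        exact hg2 (he3 _ hc2)
      · exact hg1 (hx3 g hn hg2')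
    rw [hgc] at hg
    have hr := swp_R (q := yg) (b := γ) h hy1 hα hxy.symm hRα.symm
    refine key pc3 (p := x) (q := y) (r := y1) (Or.inr (hx3 _ hac1 hα2)) (Or.inr (he3 _ hα)) (Or.inl ?_)
      hxy hxy1 hyy1 hg hr.symm
    intro w hw
    have k1 := pr y1 y w c1
    have k2 := sy y1 y
    clear reca fin two hTp hT hne t1 t2 t0 tα tβ tc hp hx hxm hy1s sy pr hx3 he3
    simp only [swp, upd] at hw; grind
  have zero : ∀ ε1 ε2 ε3 p w q w3, T ε1 → T ε2 → T ε3 → ε1 ≠ ε2 → ε1 ≠ ε3 → ε2 ≠ ε3 →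
      Miss f yg ε1 → Miss f yg ε2 → p ≠ γ → q ≠ γ → f y w = some p → f y w3 = some q →
      ¬ Miss f yg p → ¬ Miss f yg q → ¬ Miss f w ε1 → ¬ Miss f w ε2 → ¬ Miss f w3 ε3 → False := by
    intro ε1 ε2 ε3 p w q w3 t1 t2 t3 n12 n13 n23 g1 g2 hpγ hqγ hw hw3 hgp hgq w1 w2 w33
    obtain ⟨ε, hε, pc2, hws⟩ := case_I_rec2 h hp hyg hw hw3 t1.1 t2.1 t3.1 n12 n13 n23 g1 g2 hpγ hqγ
      hgp hgq w1 w2 w33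
    have k1 := hT _ t1
    have k2 := hT _ t2
    have k3 := hT _ t3
    have hxw : x ≠ w := by rintro rfl; simp [hfyx] at hw
    have hyw : y ≠ w := by rintro rfl; simp [h.loop] at hw
    have hwyg : w ≠ yg := by rintro rfl; grind
    have hwγ : Miss f w γ := by
      by_contra hn
      have := hws _ hn
      grind
    have pc1 : ∀ p q, (upd f y w (some ε3)) p q = (upd f y w (some ε3)) q p := by
      intro p q
      have := sy p q
      simp only [upd]; grind
    have mε : Miss f y ε := by rcases hε with rfl | rfl; exacts [t1.1, t2.1]
    have hεγ := (hne _ _ _ mε hyg)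
    have hpr := fun w => pr y yg w γ hyg
    have hpr2 := fun w => pr yg y w γ (by rw [sy]; exact hyg)
    have fin' := fin _ pc2
    clear reca fin two one hTp hT t1 t2 t3 tα tβ tc hp hx hxm hy1s hws pc1 hne pr
    refine fin' ?_ ?_ ?_ ?_ ?_
    · intro u v
      have := sy y w
      have := sy y yg
      simp only [upd]; grind
    · intro w hw
      simp only [upd] at hw; grind
    · intro w hw
      have := hγ1 w
      simp only [upd] at hw; grind
    · intro w
      simp only [upd]; grind
    · intro z hz z' hz'
      have := hc2 z
      have := hwγ z'
      simp only [upd] at hz hz'; grind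
  by_cases ga : Miss f yg α <;> by_cases gb : Miss f yg β <;> by_cases gc : Miss f yg c2
  · obtain ⟨p, w, p1, p2, p3, p4, p5⟩ := reca α tα.1 tα.2 ga
    obtain ⟨q, w', q1, q2, q3, q4, q5⟩ := reca β tβ.1 tβ.2 gb
    obtain ⟨r, w'', r1, r2, r3, r4, r5⟩ := reca c2 tc.1 tc.2 gc
    have := four (hp _ _ hyg) hgγ p4 q4 r4
    have : p = q ∨ p = r ∨ q = r := by grind
    rcases this with rfl | rfl | rfl
    · have := pr _ _ _ _ p3 q3
      subst this
      exact zero α β c2 p w r w'' tα tβ tc hαβ hα2 hβ2 ga gb p1 r1 p3 r3 p4 r4 p5 q5 r5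
    · have := pr _ _ _ _ p3 r3
      subst this
      exact zero α c2 β p w q w' tα tc tβ hα2 hαβ hβ2.symm ga gc p1 q1 p3 q3 p4 q4 p5 r5 q5
    · have := pr _ _ _ _ q3 r3
      subst this
      exact zero β c2 α q w' p w tβ tc tα hβ2 hαβ.symm hα2.symm gb gc q1 p1 q3 p3 q4 p4 q5 r5 p5
  · exact one α β c2 tα tβ tc hαβ hα2 hβ2 gc ga gb
  · exact one α c2 β tα tc tβ hα2 hαβ hβ2.symm gb ga gc
  · exact two β c2 α tβ tc tα hβ2 hαβ.symm hα2.symm gb gc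
  · exact one β c2 α tβ tc tα hβ2 hαβ.symm hα2.symm ga gb gc
  · exact two α c2 β tα tc tβ hα2 hαβ hβ2.symm ga gc
  · exact two α β c2 tα tβ tc hαβ hα2 hβ2 ga gb
  · exact two α β c2 tα tβ tc hαβ hα2 hβ2 ga gb

/-- Case I, one common color, second subcase. -/
lemma case_I_1b (h : PC f) {x y x1 x2 y1 : V} {c1 c2 α β : K} (hxy : x ≠ y)
    (hx1 : f x x1 = some c1) (hx2 : f x x2 = some c2)
    (hx : ∀ w a, f x w = some a → w = x1 ∨ w = x2) (hfxy : f x y = none)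
    (hB : Blk f x y) (hcx2 : (Cs f x2).card < Fintype.card K)
    (hp : ∀ p a, f y p = some a → (Cs f p).card ≤ 3)
    (hy1 : f y y1 = some c1) (hc2 : Miss f y c2) (h12 : c1 ≠ c2)
    (hα : Miss f y α) (hβ : Miss f y β) (hαβ : α ≠ β) (hα2 : α ≠ c2) (hβ2 : β ≠ c2)
    (hα1 : ¬ Miss f y1 α) (hβ1 : ¬ Miss f y1 β)
    (hRα : R f c1 α x y)
    (hm12 : Miss f x1 c2) : False := by
  have sy := h.symm
  have pr := h.prop
  have lo := h.loop
  have hfyx : f y x = none := by rw [sy]; exact hfxy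
  have hyy1 : y ≠ y1 := by rintro rfl; simp [h.loop] at hy1
  have hxy1 : x ≠ y1 := by rintro rfl; simp [hfyx] at hy1
  have hx1y : x1 ≠ y := by rintro rfl; simp [hx1] at hfxy
  have hx2y : x2 ≠ y := by rintro rfl; simp [hx2] at hfxy
  have hxx1 : x ≠ x1 := by rintro rfl; simp [lo] at hx1
  have hxx2 : x ≠ x2 := by rintro rfl; simp [lo] at hx2
  have hx12 : x1 ≠ x2 := by rintro rfl; grind
  have h1c : ¬ Miss f y1 c1 := not_miss.2 ⟨y, by rw [sy]; exact hy1⟩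
  have hne : ∀ e z g, Miss f y e → f y z = some g → e ≠ g := by
    intro e z g he hz hh
    exact he z (by rw [hz, hh])
  have hac1 := hne _ _ _ hα hy1
  have hbc1 := hne _ _ _ hβ hy1
  have hy1s : ∀ g, ¬ Miss f y1 g → g = c1 ∨ g = α ∨ g = β := by
    intro g hg
    have := four (hp _ _ hy1) h1c hα1 hβ1 hg
    grind
  have hxm : ∀ e, e ≠ c1 → e ≠ c2 → Miss f x e := by
    intro e h1 h2 w hw
    have := hx w e hw
    grind
  by_cases hm21 : Miss f x2 c1
  · have pc3 := swp_PC h hx12 hx1 hx2 hm12 hm21 (by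
      intro g z hg1 hg2 hz hn
      exact absurd hz (hxm g hg1 hg2 z)) (by
      intro g z hg1 hg2 hz hn
      exact absurd hz (hxm g hg1 hg2 z))
    have he3 : ∀ e, Miss f y e → Miss (swp f x x1 x2 c1 c2) y e := by
      intro e he w hw
      have := he w
      simp only [swp, upd] at hw; grind
    have hx3 : ∀ e, e ≠ c1 → e ≠ c2 → Miss (swp f x x1 x2 c1 c2) x e := by
      intro e he he' w hw
      have := hxm e he he' w
      simp only [swp, upd] at hw; grind
    obtain ⟨g, -, hg1, hg2, hg⟩ := hB _ pc3 (swp_SS h hx1 hx2) α (hx3 _ hac1 hα2) (he3 _ hα)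
    have hgc : g = c1 := by
      by_contra hn
      by_cases hg2' : g = c2
      · subst hg2'
        exact hg2 (he3 _ hc2)
      · exact hg1 (hx3 g hn hg2')
    rw [hgc] at hg
    have hr := swp_R (q := x2) (b := c2) h hx1 (hxm _ hac1 hα2) hxy hRα
    refine key pc3 (p := y) (q := x) (r := x1) (Or.inr (he3 _ hα)) (Or.inr (hx3 _ hac1 hα2)) (Or.inl ?_)
      hxy.symm hx1y.symm hxx1 hg.symm hr.symm
    intro w hw
    simp only [swp, upd] at hw; grind
  obtain ⟨δ, hδ, -⟩ := exists_miss (f := f) x2 ∅ (by simpa using hcx2)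
  have hδ2 : δ ≠ c2 := by
    rintro rfl
    exact hδ x (by rw [sy]; exact hx2)
  have hδ1 : δ ≠ c1 := by
    rintro rfl
    exact hm21 hδ
  have pc2 : PC (upd (upd f x x1 (some c2)) x x2 (some δ)) := by
    have p1 : PC (upd (upd f x x2 none) x x1 (some c2)) := by
      refine (h.del x x2).recolor (b := c1) hxx1 (by simp only [upd]; grind) ?_ ?_ ?_
      · intro w hw
        simp only [upd] at hw; grind
      · intro w hw
        have := hm12 w
        simp only [upd] at hw; grind
      · intro g hg1 hg2 hg3
        obtain ⟨w, hw⟩ := not_miss.1 hg3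
        have := hxm g hg2 hg1 w
        simp only [upd] at hw; grind
    have := p1.add (u := x) (v := x2) (a := δ) hxx2 ?_ ?_ ?_
    · convert this using 1
      funext u v
      simp only [upd]; grind
    · intro w hw
      have := hxm δ hδ1 hδ2 w
      simp only [upd] at hw; grind
    · intro w hw
      have := hδ w
      simp only [upd] at hw; grind
    · intro g hg hg1 hg2
      obtain ⟨w, hw⟩ := not_miss.1 hg1
      obtain ⟨w', hw'⟩ := not_miss.1 hg2
      have hgc : g = c2 := by
        have := hx w g
        simp only [upd] at hw; grind
      subst hgc
      have := pr x2 x w' g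
      have := sy x2 x
      simp only [upd] at hw'; grind
  set f2 := upd (upd f x x1 (some c2)) x x2 (some δ) with hf2
  have ss2 : SS f f2 := by
    intro u v
    have := sy x x1
    have := sy x x2
    simp only [hf2, upd]; grind
  have hfy : ∀ w, f2 y w = f y w := by
    intro w
    simp only [hf2, upd]; grind
  have hx2m : ∀ e, e ≠ c2 → e ≠ δ → Miss f2 x e := by
    intro e he he' w hw
    have := hx w e
    simp only [hf2, upd] at hw; grind
  have hB2 : ∀ e, e ≠ c2 → e ≠ δ → Miss f y e → R f2 δ e x y ∧ ¬ Miss f y δ := by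
    intro e he1 he2 he
    have hee : Miss f2 y e := by intro w; rw [hfy]; exact he w
    obtain ⟨g, -, hg1, hg2, hg⟩ := hB _ pc2 ss2 e (hx2m e he1 he2) hee
    have hgδ : g = δ := by
      by_contra hn
      by_cases hgc : g = c2
      · subst hgc
        exact hg2 (by intro w; rw [hfy]; exact hc2 w)
      · exact hg1 (hx2m g hgc hn)
    subst hgδ
    refine ⟨hg, fun hn => hg2 (by intro w; rw [hfy]; exact hn w)⟩
  have hδy : ¬ Miss f y δ := by
    by_cases hαδ : α = δ
    · exact (hB2 β hβ2 (by grind) hβ).2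
    · exact (hB2 α hα2 hαδ hα).2
  obtain ⟨yd, hyd⟩ := not_miss.1 hδy
  have hαδ := hne _ _ _ hα hyd
  have hβδ := hne _ _ _ hβ hyd
  have hyyd : y ≠ yd := by rintro rfl; simp [h.loop] at hyd
  have hxyd : x ≠ yd := by rintro rfl; simp [hfyx] at hyd
  have hyd2 : f2 y yd = some δ := by rw [hfy]; exact hyd
  have hin : ∀ e, e ≠ c2 → e ≠ δ → Miss f y e → ¬ Miss f yd e := by
    intro e he1 he2 he hn
    have hee : Miss f2 y e := by intro w; rw [hfy]; exact he w
    rcases (hB2 e he1 he2 he).1.symm.stub pc2 hee hyd2 (by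
      intro w hw
      have := hn w
      simp only [hf2, upd] at hw; grind) with h1 | h1
    · exact hxy h1.symm
    · exact hxyd h1.symm
  have hαd := hin α hα2 hαδ hα
  have hβd := hin β hβ2 hβδ hβ
  have hyds : ∀ g, ¬ Miss f yd g → g = δ ∨ g = α ∨ g = β := by
    intro g hg
    have := four (hp _ _ hyd) (not_miss.2 ⟨y, by rw [sy]; exact hyd⟩) hαd hβd hg
    grind
  have hydx1 : yd ≠ x1 := by
    rintro rfl
    have := hyds c1 (not_miss.2 ⟨x, by rw [sy]; exact hx1⟩)
    grind
  have hydx2 : yd ≠ x2 := by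
    rintro rfl
    have := hyds c2 (not_miss.2 ⟨x, by rw [sy]; exact hx2⟩)
    grind
  have hy1x1 : y1 ≠ x1 := by
    rintro rfl
    exact hxy (pr y1 x y c1 (by rw [sy]; exact hx1) (by rw [sy]; exact hy1))
  have hy1x2 : y1 ≠ x2 := by
    rintro rfl
    have := hy1s c2 (not_miss.2 ⟨x, by rw [sy]; exact hx2⟩)
    grind
  have hy1d : y1 ≠ yd := by rintro rfl; grind
  have hfy1 : ∀ w, f2 y1 w = f y1 w := by
    intro w
    simp only [hf2, upd]; grind
  have hfyd : ∀ w, f2 yd w = f yd w := by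
    intro w
    simp only [hf2, upd]; grind
  have hy12 : f2 y y1 = some c1 := by rw [hfy]; exact hy1
  have tr1 : ∀ g, Miss f2 y1 g ↔ Miss f y1 g := by intro g; simp only [Miss, hfy1]
  have trd : ∀ g, Miss f2 yd g ↔ Miss f yd g := by intro g; simp only [Miss, hfyd]
  have hm1 : Miss f2 y1 δ := by
    rw [tr1]
    by_contra hn
    have := hy1s _ hn
    grind
  have hm2 : Miss f2 yd c1 := by
    rw [trd]
    by_contra hn
    have := hyds _ hn
    grind
  have pc3 := swp_PC pc2 hy1d hy12 hyd2 hm1 hm2 (by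
    intro g z hg1 hg2 hz hn
    rw [tr1] at hn
    rw [hfy] at hz
    rcases hy1s g hn with rfl | rfl | rfl
    · exact absurd rfl hg1
    · exact absurd hz (hα z)
    · exact absurd hz (hβ z)) (by
    intro g z hg1 hg2 hz hn
    rw [trd] at hn
    rw [hfy] at hz
    rcases hyds g hn with rfl | rfl | rfl
    · exact absurd rfl hg2
    · exact absurd hz (hα z)
    · exact absurd hz (hβ z))
  have he3 : ∀ e, Miss f y e → Miss (swp f2 y y1 yd c1 δ) y e := by
    intro e he w hw
    have := he w
    have := hfy w
    simp only [swp, upd] at hw; grind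
  have hx3 : ∀ e, e ≠ c2 → e ≠ δ → Miss (swp f2 y y1 yd c1 δ) x e := by
    intro e he he' w hw
    have := hx2m e he he' w
    simp only [swp, upd] at hw; grind
  obtain ⟨g, -, hg1, hg2, hg⟩ := hB _ pc3 (ss2.trans (swp_SS pc2 hy12 hyd2)) α (hx3 _ hα2 hαδ) (he3 _ hα)
  have hgc : g = δ := by
    by_contra hn
    by_cases hg2' : g = c2
    · subst hg2'
      exact hg2 (he3 _ hc2)
    · exact hg1 (hx3 g hg2' hn)
  rw [hgc] at hg
  have hr := swp_R' (p := y1) (a := c1) pc2 hyd2 (by intro w; rw [hfy]; exact hα w) hxy.symm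
    (hB2 α hα2 hαδ hα).1.symm
  refine key pc3 (p := x) (q := y) (r := yd) (Or.inr (hx3 _ hα2 hαδ)) (Or.inr (he3 _ hα)) (Or.inl ?_)
    hxy hxyd hyyd hg hr.symm
  intro w hw
  have := pc2.prop yd y w δ
  have := pc2.symm y yd
  simp only [swp, upd] at hw; grind

end
end AEC

namespace AEC
section
variable {V K : Type*} {f : V → V → Option K} [Fintype K] [DecidableEq V] [DecidableEq K]

/-- Case I, one common color. -/
lemma case_I_1 (h : PC f) {x y x1 x2 y1 : V} {c1 c2 : K} (hxy : x ≠ y)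
    (hx1 : f x x1 = some c1) (hx2 : f x x2 = some c2)
    (hx : ∀ w a, f x w = some a → w = x1 ∨ w = x2) (hfxy : f x y = none)
    (hB : Blk f x y) (hcx1 : (Cs f x1).card < Fintype.card K)
    (hcx2 : (Cs f x2).card < Fintype.card K) (hcy : (Cs f y).card + 3 ≤ Fintype.card K)
    (hp : ∀ p a, f y p = some a → (Cs f p).card ≤ 3)
    (hy1 : f y y1 = some c1) (hc2 : Miss f y c2) (h12 : c1 ≠ c2) : False := by
  have sy := h.symm
  have hfyx : f y x = none := by rw [sy]; exact hfxy
  have hxy1 : x ≠ y1 := by rintro rfl; simp [hfyx] at hy1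
  have hx1y : x1 ≠ y := by rintro rfl; simp [hx1] at hfxy
  have hne : ∀ e z g, Miss f y e → f y z = some g → e ≠ g := by
    intro e z g he hz hh
    exact he z (by rw [hz, hh])
  have hxm : ∀ e, e ≠ c1 → e ≠ c2 → Miss f x e := by
    intro e h1 h2 w hw
    have := hx w e hw
    grind
  have hR : ∀ e, Miss f y e → e ≠ c2 → R f c1 e x y ∧ ¬ Miss f y1 e := by
    intro e he he2
    obtain ⟨g, -, hg1, hg2, hg⟩ := hB f h (SS.refl f) e (hxm _ (hne _ _ _ he hy1) he2) he
    have hgc : g = c1 := by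
      by_contra hn
      by_cases hg2' : g = c2
      · subst hg2'
        exact hg2 hc2
      · exact hg1 (hxm g hn hg2')
    subst hgc
    refine ⟨hg, fun hn => ?_⟩
    rcases hg.symm.stub h he hy1 hn with h1 | h1
    · exact hxy h1.symm
    · exact hxy1 h1.symm
  obtain ⟨α, hα, hα2⟩ := exists_miss (f := f) y {c2} (by simp; omega)
  simp only [Finset.mem_singleton] at hα2
  obtain ⟨β, hβ, hβ2⟩ := exists_miss (f := f) y {c2, α} (by
    have := Finset.card_le_two (a := c2) (b := α)
    omega)
  simp only [Finset.mem_insert, Finset.mem_singleton, not_or] at hβ2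
  obtain ⟨γ, hγ, -⟩ := exists_miss (f := f) x1 ∅ (by simpa using hcx1)
  by_cases hγ2 : γ = c2
  · subst hγ2
    exact case_I_1b h hxy hx1 hx2 hx hfxy hB hcx2 hp hy1 hc2 h12 hα hβ (Ne.symm hβ2.2) hα2 hβ2.1
      (hR α hα hα2).2 (hR β hβ hβ2.1).2 (hR α hα hα2).1 hγ
  · refine case_I_1a h hxy hx1 hx2 hx hfxy hB hp hy1 hc2 h12 hα hβ (Ne.symm hβ2.2) hα2 hβ2.1
      (hR α hα hα2).2 (hR β hβ hβ2.1).2 (hR α hα hα2).1 (hR β hβ hβ2.1).1 hγ hγ2 ?_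
    intro hn
    rcases (hR γ hn hγ2).1.stub h (hxm _ (hne _ _ _ hn hy1) hγ2) hx1 hγ with h1 | h1
    · exact hxy h1
    · exact hx1y h1

/-- Case I: `x` of degree 3 and `y` of degree at least 4. -/
lemma case_I (h : PC f) {x y x1 x2 : V} {c1 c2 : K} (hxy : x ≠ y)
    (hx1 : f x x1 = some c1) (hx2 : f x x2 = some c2)
    (hx : ∀ w a, f x w = some a → w = x1 ∨ w = x2) (hfxy : f x y = none)
    (hB : Blk f x y) (hcx1 : (Cs f x1).card < Fintype.card K)
    (hcx2 : (Cs f x2).card < Fintype.card K) (hcy : (Cs f y).card + 3 ≤ Fintype.card K)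
    (hp : ∀ p a, f y p = some a → (Cs f p).card ≤ 3) (h12 : c1 ≠ c2) : False := by
  have sy := h.symm
  have hfyx : f y x = none := by rw [sy]; exact hfxy
  have hxm : ∀ e, e ≠ c1 → e ≠ c2 → Miss f x e := by
    intro e h1 h2 w hw
    have := hx w e hw
    grind
  have hxc : ∀ g, ¬ Miss f x g → g = c1 ∨ g = c2 := by
    intro g hg
    by_contra hn
    push Not at hn
    exact hg (hxm g hn.1 hn.2)
  have hne : ∀ e z g, Miss f y e → f y z = some g → e ≠ g := by
    intro e z g he hz hh
    exact he z (by rw [hz, hh])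
  by_cases hc1 : Miss f y c1
  · by_cases hc2 : Miss f y c2
    · obtain ⟨α, hα, hα2⟩ := exists_miss (f := f) y {c1, c2} (by
        have := Finset.card_le_two (a := c1) (b := c2)
        omega)
      simp only [Finset.mem_insert, Finset.mem_singleton, not_or] at hα2
      obtain ⟨g, -, hg1, hg2, hg⟩ := hB f h (SS.refl f) α (hxm _ hα2.1 hα2.2) hα
      rcases hxc g hg1 with rfl | rfl
      · exact hg2 hc1
      · exact hg2 hc2
    · obtain ⟨y2, hy2⟩ := not_miss.1 hc2
      exact case_I_1 h hxy hx2 hx1 (fun w a hw => (hx w a hw).symm) hfxy hB hcx2 hcx1 hcy hp hy2 hc1 h12.symm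
  obtain ⟨y1, hy1⟩ := not_miss.1 hc1
  by_cases hc2 : Miss f y c2
  · exact case_I_1 h hxy hx1 hx2 hx hfxy hB hcx1 hcx2 hcy hp hy1 hc2 h12
  obtain ⟨y2, hy2⟩ := not_miss.1 hc2
  have hxy1 : x ≠ y1 := by rintro rfl; simp [hfyx] at hy1
  have hxy2 : x ≠ y2 := by rintro rfl; simp [hfyx] at hy2
  have hR : ∀ e, Miss f y e → ¬ Miss f y1 e ∨ ¬ Miss f y2 e := by
    intro e he
    obtain ⟨g, -, hg1, hg2, hg⟩ := hB f h (SS.refl f) e (hxm _ (hne _ _ _ he hy1) (hne _ _ _ he hy2)) he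
    rcases hxc g hg1 with rfl | rfl
    · left
      intro hn
      rcases hg.symm.stub h he hy1 hn with h1 | h1
      · exact hxy h1.symm
      · exact hxy1 h1.symm
    · right
      intro hn
      rcases hg.symm.stub h he hy2 hn with h1 | h1
      · exact hxy h1.symm
      · exact hxy2 h1.symm
  obtain ⟨α, hα, -⟩ := exists_miss (f := f) y ∅ (by simp; omega)
  obtain ⟨β, hβ, hβ2⟩ := exists_miss (f := f) y {α} (by simp; omega)
  obtain ⟨γ, hγ, hγ2⟩ := exists_miss (f := f) y {α, β} (by
    have := Finset.card_le_two (a := α) (b := β)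
    omega)
  simp only [Finset.mem_insert, Finset.mem_singleton, not_or] at hβ2 hγ2
  have main : ∀ α β γ, Miss f y α → Miss f y β → Miss f y γ → α ≠ β → α ≠ γ → β ≠ γ →
      ((¬ Miss f y1 α ∧ ¬ Miss f y1 β) ∨ (¬ Miss f y2 α ∧ ¬ Miss f y2 β)) → False := by
    intro α β γ hα hβ hγ n1 n2 n3 hh
    rcases hh with ⟨k1, k2⟩ | ⟨k1, k2⟩
    · refine case_I_2 h hxy hx1 hx2 hx hfxy hB hp hy1 hy2 h12 hα hβ hγ n1 n2 n3 k1 k2 ?_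
      refine (hR γ hγ).resolve_left (fun hn => ?_)
      have := four (hp _ _ hy1) (not_miss.2 ⟨y, by rw [sy]; exact hy1⟩) k1 k2 hn
      have := hne _ _ _ hα hy1
      have := hne _ _ _ hβ hy1
      have := hne _ _ _ hγ hy1
      grind
    · refine case_I_2 h hxy hx2 hx1 (fun w a hw => (hx w a hw).symm) hfxy hB hp hy2 hy1 h12.symm
        hα hβ hγ n1 n2 n3 k1 k2 ?_
      refine (hR γ hγ).resolve_right (fun hn => ?_)
      have := four (hp _ _ hy2) (not_miss.2 ⟨y, by rw [sy]; exact hy2⟩) k1 k2 hn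
      have := hne _ _ _ hα hy2
      have := hne _ _ _ hβ hy2
      have := hne _ _ _ hγ hy2
      grind
  have h1 := main α β γ hα hβ hγ (Ne.symm hβ2) (Ne.symm hγ2.1) (Ne.symm hγ2.2)
  have h2 := main α γ β hα hγ hβ (Ne.symm hγ2.1) (Ne.symm hβ2) hγ2.2
  have h3 := main β γ α hβ hγ hα (Ne.symm hγ2.2) hβ2 hγ2.1
  have r1 := hR α hα
  have r2 := hR β hβ
  have r3 := hR γ hγ
  clear main hR hp hx hxm hxc hne hcx1 hcx2 hcy hB
  generalize Miss f y1 α = A1 at *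
  generalize Miss f y1 β = A2 at *
  generalize Miss f y1 γ = A3 at *
  generalize Miss f y2 α = B1 at *
  generalize Miss f y2 β = B2 at *
  generalize Miss f y2 γ = B3 at *
  by_cases A1 <;> by_cases A2 <;> by_cases A3 <;> simp_all

end
end AEC

namespace AEC

/-- Extension of a coloring by the edges `x x1`, `x x2`, `y u1`, `y u2`. -/
def ext4 {V K : Type*} [DecidableEq V] (f : V → V → Option K) (x y x1 x2 u1 u2 : V) (a b c d : K) :
    V → V → Option K :=
  upd (upd (upd (upd f x x1 (some a)) x x2 (some b)) y u1 (some c)) y u2 (some d)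

/-- The configuration in Case II. -/
structure Cfg {V K : Type*} [Fintype K] (F f : V → V → Option K) (x y x1 x2 u1 u2 : V) : Prop where
  pc : PC f
  xy : x ≠ y
  x12 : x1 ≠ x2
  u12 : u1 ≠ u2
  xx1 : x ≠ x1
  xx2 : x ≠ x2
  xu1 : x ≠ u1
  xu2 : x ≠ u2
  yx1 : y ≠ x1
  yx2 : y ≠ x2
  yu1 : y ≠ u1
  yu2 : y ≠ u2
  ix : ∀ w, f x w = none
  iy : ∀ w, f y w = none
  hB : Blk F x y
  hS : ∀ p q, (F p q).isSome ↔ ((f p q).isSome ∨ (p = x ∧ (q = x1 ∨ q = x2)) ∨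
    (q = x ∧ (p = x1 ∨ p = x2)) ∨ (p = y ∧ (q = u1 ∨ q = u2)) ∨ (q = y ∧ (p = u1 ∨ p = u2)))

section
variable {V K : Type*} {F f : V → V → Option K}

lemma R_avoid {f' : V → V → Option K} {c d : K} {x p u v : V}
    (hx : ∀ w, (bi f c d).Adj x w → w = p)
    (hag : ∀ u v, u ≠ x → v ≠ x → f u v = f' u v)
    (hR : R f c d u v) (hu : u ≠ x) (hv : v ≠ x) : R f' c d u v := by
  obtain ⟨W⟩ := hR
  have main : ∀ {u v} (_ : (bi f c d).Walk u v), v ≠ x →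
      (u ≠ x → R f' c d u v) ∧ (u = x → R f' c d p v) := by
    intro u v W
    induction W with
    | nil => exact fun h => ⟨fun _ => SimpleGraph.Reachable.refl _, fun h' => absurd h' h⟩
    | cons k W ih =>
      rename_i u w v
      intro hv
      have ih := ih hv
      refine ⟨fun hu => ?_, fun hu => ?_⟩
      · by_cases hw : w = x
        · have : u = p := hx u (hw ▸ k.symm)
          rw [this]
          exact ih.2 hw
        · refine R.trans ?_ (ih.1 hw)
          refine SimpleGraph.Adj.reachable ?_
          refine ⟨k.1, ?_, ?_⟩
          · rw [← hag _ _ hu hw]; exact k.2.1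
          · rw [← hag _ _ hw hu]; exact k.2.2
      · have hwp : w = p := hx w (hu ▸ k)
        have hwx : w ≠ x := by
          rintro rfl
          exact k.1 hu
        rw [← hwp]
        exact ih.1 hwx
  exact (main W hv).1 hu

variable [DecidableEq V] {x y x1 x2 u1 u2 : V} {a b c d : K}

lemma R_pend {f' : V → V → Option K} (h : PC f') {c d : K} {x p u v : V} {a : K}
    (hx : ∀ w g, f' x w = some g → (g = c ∨ g = d) → w = p)
    (hag : ∀ u v, u ≠ x → v ≠ x → f' u v = f u v)
    (hR : R f' c d u v) (hu : u ≠ x) (hv : v ≠ x) : R f c d u v := by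
  refine R_avoid (f := f') (p := p) ?_ hag hR hu hv
  intro w hw
  rw [bi_adj h] at hw
  rcases hw with hw | hw
  · exact hx w _ hw (Or.inl rfl)
  · exact hx w _ hw (Or.inr rfl)

variable [Fintype K]

lemma Cfg.symm (h : Cfg F f x y x1 x2 u1 u2) : Cfg F f y x u1 u2 x1 x2 where
  pc := h.pc
  xy := h.xy.symm
  x12 := h.u12
  u12 := h.x12
  xx1 := h.yu1
  xx2 := h.yu2
  xu1 := h.yx1
  xu2 := h.yx2
  yx1 := h.xu1
  yx2 := h.xu2
  yu1 := h.xx1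
  yu2 := h.xx2
  ix := h.iy
  iy := h.ix
  hB := by
    intro f' h1 h2 e h3 h4
    obtain ⟨g, k1, k2, k3, k4⟩ := h.hB f' h1 h2 e h4 h3
    exact ⟨g, k1, k3, k2, k4.symm⟩
  hS := by
    intro p q
    have := h.hS p q
    tauto

lemma Cfg.swapx (h : Cfg F f x y x1 x2 u1 u2) : Cfg F f x y x2 x1 u1 u2 where
  pc := h.pc
  xy := h.xy
  x12 := h.x12.symm
  u12 := h.u12
  xx1 := h.xx2
  xx2 := h.xx1
  xu1 := h.xu1
  xu2 := h.xu2
  yx1 := h.yx2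
  yx2 := h.yx1
  yu1 := h.yu1
  yu2 := h.yu2
  ix := h.ix
  iy := h.iy
  hB := h.hB
  hS := by
    intro p q
    have := h.hS p q
    tauto

lemma Cfg.swapu (h : Cfg F f x y x1 x2 u1 u2) : Cfg F f x y x1 x2 u2 u1 := h.symm.swapx.symm

lemma Cfg.swp (h : Cfg F f x y x1 x2 u1 u2) {t p q : V} (hp : f t p = some a) (hq : f t q = some b)
    (pc : PC (swp f t p q a b)) : Cfg F (swp f t p q a b) x y x1 x2 u1 u2 := by
  have ss := swp_SS h.pc hp hq
  exact { h with
    pc := pc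
    ix := fun w => ss.none (h.ix w)
    iy := fun w => ss.none (h.iy w)
    hS := fun p q => by rw [ss p q]; exact h.hS p q }

set_option maxHeartbeats 2000000 in
/-- Extension lemma. -/
lemma Cfg.ext (h : Cfg F f x y x1 x2 u1 u2)
    (ha : Miss f x1 a) (hb : Miss f x2 b) (hc : Miss f u1 c) (hd : Miss f u2 d)
    (hab : a ≠ b) (hcd : c ≠ d)
    (c11 : x1 = u1 → a ≠ c) (c12 : x1 = u2 → a ≠ d) (c21 : x2 = u1 → b ≠ c) (c22 : x2 = u2 → b ≠ d)
    (r1 : ¬ R f a b x1 x2) (r2 : ¬ R f c d u1 u2)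
    (hmix : (a = c ∧ b = d) ∨ (a = d ∧ b = c) → (x1 ≠ u1 ∧ x1 ≠ u2 ∧ x2 ≠ u1 ∧ x2 ≠ u2) ∧
      ((Miss f x1 b) ∨ (Miss f x2 a) ∨ Miss f u1 d ∨ Miss f u2 c)) :
    PC (ext4 f x y x1 x2 u1 u2 a b c d) := by
  obtain ⟨pc, xy, x12, u12, xx1, xx2, xu1, xu2, yx1, yx2, yu1, yu2, ix, iy, -, -⟩ := h
  have sy := pc.symm
  have ix' : ∀ w, f w x = none := fun w => by rw [sy]; exact ix w
  have iy' : ∀ w, f w y = none := fun w => by rw [sy]; exact iy w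
  have p1 : PC (upd f x x1 (some a)) := by
    refine pc.add xx1 (fun w => by simp [ix]) ha ?_
    intro g hg h1
    exact absurd (fun w => by simp [ix]) h1
  have p1' : PC (upd f x x2 (some b)) := by
    refine pc.add xx2 (fun w => by simp [ix]) hb ?_
    intro g hg h1
    exact absurd (fun w => by simp [ix]) h1
  have p2 : PC (upd (upd f x x1 (some a)) x x2 (some b)) := by
    have mx : Miss (upd f x x1 (some a)) x b := by
      intro w hw
      have := ix w
      simp only [upd] at hw; grind
    refine p1.add xx2 mx ?_ ?_
    · intro w hw
      have := hb w
      simp only [upd] at hw; grind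
    · intro g hg h1 h2 hR
      obtain ⟨w, hw⟩ := not_miss.1 h1
      have hga : g = a := by
        have := ix w
        simp only [upd] at hw; grind
      subst hga
      refine r1 (hR.swap.peel p1 xx2 mx (p := x1) (by simp [upd]) ?_)
      intro u v c hu hv _ huv
      simp only [upd] at huv; grind
  set f2 := upd (upd f x x1 (some a)) x x2 (some b) with hf2
  have r2' : ¬ R f2 c d u1 u2 := by
    intro hR
    by_cases hm : (a = c ∧ b = d) ∨ (a = d ∧ b = c)
    · obtain ⟨⟨k1, k2, k3, k4⟩, hm'⟩ := hmix hm
      have hm1 : (Miss f x1 c ∧ Miss f x1 d) ∨ (Miss f x2 c ∧ Miss f x2 d) ∨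
          (Miss f u1 c ∧ Miss f u1 d) ∨ (Miss f u2 c ∧ Miss f u2 d) := by
        rcases hm with ⟨rfl, rfl⟩ | ⟨rfl, rfl⟩ <;> tauto
      rcases hm1 with ⟨m1, m2⟩ | ⟨m1, m2⟩ | ⟨m1, m2⟩ | ⟨m1, m2⟩
      · have e1 : R (upd f x x2 (some b)) c d u1 u2 := by
          refine R_pend p2 (x := x1) (p := x) (a := a) ?_ ?_ hR k1.symm k2.symm
          · intro w g hw hg
            have := m1 w
            have := m2 w
            simp only [hf2, upd] at hw; grind
          · intro u v hu hv
            simp only [hf2, upd]; grind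
        refine r2 (R_pend p1' (x := x) (p := x2) (a := a) ?_ ?_ e1 xu1.symm xu2.symm)
        · intro w g hw _
          have := ix w
          simp only [upd] at hw; grind
        · intro u v hu hv
          simp only [upd]; grind
      · have e1 : R (upd f x x1 (some a)) c d u1 u2 := by
          refine R_pend p2 (x := x2) (p := x) (a := a) ?_ ?_ hR k3.symm k4.symm
          · intro w g hw hg
            have := m1 w
            have := m2 w
            simp only [hf2, upd] at hw; grind
          · intro u v hu hv
            simp only [hf2, upd]; grind
        refine r2 (R_pend p1 (x := x) (p := x1) (a := a) ?_ ?_ e1 xu1.symm xu2.symm)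
        · intro w g hw _
          have := ix w
          simp only [upd] at hw; grind
        · intro u v hu hv
          simp only [upd]; grind
      · refine u12 (hR.iso ?_ ?_)
        · intro w hw
          have := m1 w
          simp only [hf2, upd] at hw; grind
        · intro w hw
          have := m2 w
          simp only [hf2, upd] at hw; grind
      · refine u12 (hR.symm.iso ?_ ?_).symm
        · intro w hw
          have := m1 w
          simp only [hf2, upd] at hw; grind
        · intro w hw
          have := m2 w
          simp only [hf2, upd] at hw; grind
    · by_cases hac : a = c ∨ a = d
      · refine r2 (R_pend p2 (x := x) (p := x1) (a := a) ?_ ?_ hR xu1.symm xu2.symm)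
        · intro w g hw _
          have := ix w
          simp only [hf2, upd] at hw; grind
        · intro u v hu hv
          simp only [hf2, upd]; grind
      · refine r2 (R_pend p2 (x := x) (p := x2) (a := a) ?_ ?_ hR xu1.symm xu2.symm)
        · intro w g hw _
          have := ix w
          simp only [hf2, upd] at hw; grind
        · intro u v hu hv
          simp only [hf2, upd]; grind
  have iy2 : ∀ w, f2 y w = none := by
    intro w
    have := iy w
    simp only [hf2, upd]; grind
  have mu1 : Miss f2 u1 c := by
    intro w hw
    have := hc w
    simp only [hf2, upd] at hw; grind
  have mu2 : Miss f2 u2 d := by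
    intro w hw
    have := hd w
    simp only [hf2, upd] at hw; grind
  have p3 : PC (upd f2 y u1 (some c)) := by
    refine p2.add yu1 (fun w => by simp [iy2]) mu1 ?_
    intro g hg h1
    exact absurd (fun w => by simp [iy2]) h1
  have my : Miss (upd f2 y u1 (some c)) y d := by
    intro w hw
    have := iy2 w
    simp only [upd] at hw; grind
  refine p3.add yu2 my ?_ ?_
  · intro w hw
    have := mu2 w
    simp only [upd] at hw; grind
  · intro g hg h1 h2 hR
    obtain ⟨w, hw⟩ := not_miss.1 h1
    have hga : g = c := by
      have := iy2 w
      simp only [upd] at hw; grind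
    subst hga
    refine r2' (hR.swap.peel p3 yu2 my (p := u1) (by simp [upd]) ?_)
    intro u v c hu hv _ huv
    simp only [upd] at huv; grind

/-- Blocking lemma. -/
lemma Cfg.blk (h : Cfg F f x y x1 x2 u1 u2) (pc4 : PC (ext4 f x y x1 x2 u1 u2 a b c d)) {e : K}
    (ea : e ≠ a) (eb : e ≠ b) (ec : e ≠ c) (ed : e ≠ d) :
    (a = c ∧ R f a e x1 u1) ∨ (a = d ∧ R f a e x1 u2) ∨ (b = c ∧ R f b e x2 u1) ∨
    (b = d ∧ R f b e x2 u2) := by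
  obtain ⟨pc, xy, x12, u12, xx1, xx2, xu1, xu2, yx1, yx2, yu1, yu2, ix, iy, hB, hS⟩ := h
  have sy := pc.symm
  have ix' : ∀ w, f w x = none := fun w => by rw [sy]; exact ix w
  have iy' : ∀ w, f w y = none := fun w => by rw [sy]; exact iy w
  have ex : ∀ w g, ext4 f x y x1 x2 u1 u2 a b c d x w = some g → (w = x1 ∧ g = a) ∨ (w = x2 ∧ g = b) := by
    intro w g hw
    have := ix w
    simp only [ext4, upd] at hw; grind
  have ey : ∀ w g, ext4 f x y x1 x2 u1 u2 a b c d y w = some g → (w = u1 ∧ g = c) ∨ (w = u2 ∧ g = d) := by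
    intro w g hw
    have := iy w
    simp only [ext4, upd] at hw; grind
  have mx : Miss (ext4 f x y x1 x2 u1 u2 a b c d) x e := by
    intro w hw
    have := ex w e hw
    grind
  have my : Miss (ext4 f x y x1 x2 u1 u2 a b c d) y e := by
    intro w hw
    have := ey w e hw
    grind
  obtain ⟨g, hge, hg1, hg2, hR⟩ := hB _ pc4 (by
    intro p q
    have h1 := hS p q
    rw [Bool.eq_iff_iff, h1]
    simp only [ext4, upd]
    clear ex ey mx my hS hB pc4 h1 ix iy ix' iy'
    split_ifs <;> grind) e mx my
  obtain ⟨w, hw⟩ := not_miss.1 hg1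
  obtain ⟨w', hw'⟩ := not_miss.1 hg2
  have s1 := ex w g hw
  have s2 := ey w' g hw'
  have h1 : R (upd (upd f y u1 (some c)) y u2 (some d)) g e w y := by
    refine hR.peel pc4 xy mx hw ?_
    intro u v c' hu hv _ huv
    simp only [ext4, upd] at huv ⊢
    clear ex ey mx my hS hB
    grind
  have pc5 : PC (upd (upd f y u1 (some c)) y u2 (some d)) := by
    refine pc4.of_le ?_ ?_
    · intro p q
      have := sy p q
      simp only [upd]
      clear ex ey mx my hS hB sy
      grind
    · intro p q c' hpq
      have h1 := ix p
      have h2 := ix' p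
      have h3 := ix q
      have h4 := ix' q
      simp only [ext4, upd] at hpq ⊢
      clear ex ey mx my hS hB
      grind
  have hwy : y ≠ w := by grind
  have h2 : R f g e w' w := by
    refine h1.symm.peel pc5 hwy ?_ ?_ ?_
    · intro z hz
      have h1 := iy z
      simp only [upd] at hz
      clear ex ey mx my hS hB
      grind
    · simp only [upd]
      clear ex ey mx my hS hB
      grind
    · intro u v c' hu hv _ huv
      simp only [upd] at huv
      clear ex ey mx my hS hB
      grind
  have h3 := h2.symm
  clear ex ey mx my hS hB ix iy ix' iy' sy
  rcases s1 with ⟨rfl, rfl⟩ | ⟨rfl, rfl⟩ <;> rcases s2 with ⟨rfl, rfl⟩ | ⟨rfl, rfl⟩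
  · exact Or.inl ⟨rfl, h3⟩
  · exact Or.inr (Or.inl ⟨rfl, h3⟩)
  · exact Or.inr (Or.inr (Or.inl ⟨rfl, h3⟩))
  · exact Or.inr (Or.inr (Or.inr ⟨rfl, h3⟩))

lemma not_R_of_path {f' : V → V → Option K} (h : PC f') (hab : a ≠ b) {x x1 x2 : V} (x12 : x1 ≠ x2)
    (h1 : f' x x1 = some a) (h2 : f' x x2 = some b) (hx : ∀ w, f x w = none) (hx' : ∀ w, f w x = none)
    (hle : ∀ p q c, f p q = some c → f' p q = some c) : ¬ R f a b x1 x2 := by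
  intro hR
  have hac := h.acyc a b hab
  rw [SimpleGraph.isAcyclic_iff_forall_adj_isBridge] at hac
  have hadj : (bi f' a b).Adj x x2 := (bi_adj h).2 (Or.inr h2)
  have hbr := hac hadj
  rw [SimpleGraph.isBridge_iff] at hbr
  refine hbr ?_
  have hadj1 : (bi f' a b).Adj x x1 := (bi_adj h).2 (Or.inl h1)
  have e1 : ((bi f' a b) \ SimpleGraph.fromEdgeSet {s(x, x2)}).Adj x x1 := by
    rw [SimpleGraph.sdiff_adj]
    refine ⟨hadj1, ?_⟩
    simp only [SimpleGraph.fromEdgeSet_adj, Set.mem_singleton_iff, Sym2.eq_iff]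
    have := hadj1.1
    have := hadj.1
    grind
  refine e1.reachable.trans (SimpleGraph.Reachable.mono ?_ hR)
  intro p q hpq
  rw [SimpleGraph.sdiff_adj]
  refine ⟨⟨hpq.1, hpq.2.1.imp (hle _ _ _) (hle _ _ _), hpq.2.2.imp (hle _ _ _) (hle _ _ _)⟩, ?_⟩
  simp only [SimpleGraph.fromEdgeSet_adj, Set.mem_singleton_iff, Sym2.eq_iff]
  rintro ⟨⟨rfl, rfl⟩ | ⟨rfl, rfl⟩, -⟩
  · have := hpq.2.1
    simp [hx] at this
  · have := hpq.2.1
    simp [hx'] at this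

end
end AEC

namespace AEC

/-- Case II with degree data. -/
structure Sit {V K : Type*} [Fintype K] (F f : V → V → Option K) (dg : V → ℕ)
    (x y x1 x2 u1 u2 : V) : Prop extends Cfg F f x y x1 x2 u1 u2 where
  le : ∀ v, (Cs f v).card ≤ dg v
  dn : ∀ v, dg v + 1 ≤ Fintype.card K
  tm : ∀ v, (v = x1 ∨ v = x2 ∨ v = u1 ∨ v = u2) → (Cs f v).card + 1 ≤ dg v
  co : ∀ v, (v = x1 ∨ v = x2) → (v = u1 ∨ v = u2) → (Cs f v).card + 2 ≤ dg v
  sp : ∀ v z a, f v z = some a → dg v ≤ 3 ∨ dg z ≤ 3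
  n5 : 5 ≤ Fintype.card K

section
variable {V K : Type*} [Fintype K] [DecidableEq V] [DecidableEq K] {F f : V → V → Option K} {dg : V → ℕ}
  {x y x1 x2 u1 u2 : V} {a b c d e : K}

lemma Sit.symm (h : Sit F f dg x y x1 x2 u1 u2) : Sit F f dg y x u1 u2 x1 x2 :=
  { h.toCfg.symm with
    le := h.le
    dn := h.dn
    tm := fun v hv => h.tm v (by tauto)
    co := fun v h1 h2 => h.co v h2 h1
    sp := h.sp
    n5 := h.n5 }

lemma Sit.swapx (h : Sit F f dg x y x1 x2 u1 u2) : Sit F f dg x y x2 x1 u1 u2 :=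
  { h.toCfg.swapx with
    le := h.le
    dn := h.dn
    tm := fun v hv => h.tm v (by tauto)
    co := fun v h1 h2 => h.co v h1.symm h2
    sp := h.sp
    n5 := h.n5 }

lemma Sit.swapu (h : Sit F f dg x y x1 x2 u1 u2) : Sit F f dg x y x1 x2 u2 u1 := h.symm.swapx.symm

lemma Cfg.go1 (h : Cfg F f x y x1 x2 u1 u2) (a b d e : K)
    (ha : Miss f x1 a) (hb : Miss f x2 b) (hc : Miss f u1 a) (hd : Miss f u2 d)
    (hab : a ≠ b) (had : a ≠ d) (hbd : b ≠ d) (x1u1 : x1 ≠ u1)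
    (r1 : ¬ R f a b x1 x2) (r2 : ¬ R f a d u1 u2)
    (ea : e ≠ a) (eb : e ≠ b) (ed : e ≠ d) : R f a e x1 u1 := by
  have h1 := h.blk (h.ext ha hb hc hd hab had (fun k => absurd k x1u1) (fun _ => had) (fun _ => hab.symm)
    (fun _ => hbd) r1 r2 (by tauto)) ea eb ea ed
  have := hab.symm
  tauto

lemma Cfg.go2 (h : Cfg F f x y x1 x2 u1 u2) (a b e : K)
    (ha : Miss f x1 a) (hb : Miss f x2 b) (hc : Miss f u1 a) (hd : Miss f u2 b)
    (hab : a ≠ b)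
    (r1 : ¬ R f a b x1 x2) (r2 : ¬ R f a b u1 u2)
    (hmix : (x1 ≠ u1 ∧ x1 ≠ u2 ∧ x2 ≠ u1 ∧ x2 ≠ u2) ∧
      ((Miss f x1 b) ∨ (Miss f x2 a) ∨ Miss f u1 b ∨ Miss f u2 a))
    (ea : e ≠ a) (eb : e ≠ b) : R f a e x1 u1 ∨ R f b e x2 u2 := by
  have h1 := h.blk (h.ext ha hb hc hd hab hab (by tauto) (by tauto) (by tauto) (by tauto)
     r1 r2 (fun _ => hmix)) ea eb ea eb
  have := hab.symm
  tauto

lemma Sit.two (h : Sit F f dg x y x1 x2 u1 u2) {v : V} (hv : v = x1 ∨ v = x2 ∨ v = u1 ∨ v = u2) (a : K) :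
    ∃ b, b ≠ a ∧ Miss f v b := by
  have h1 := h.tm v hv
  have h2 := h.dn v
  obtain ⟨b, hb, hb'⟩ := exists_miss (f := f) v {a} (by rw [Finset.card_singleton]; omega)
  exact ⟨b, by simpa using hb', hb⟩

lemma Sit.three (h : Sit F f dg x y x1 x2 u1 u2) {v : V} (hv : v = x1 ∨ v = x2) (hv' : v = u1 ∨ v = u2)
    (a a' : K) : ∃ b, b ≠ a ∧ b ≠ a' ∧ Miss f v b := by
  have h1 := h.co v hv hv'
  have h2 := h.dn v
  have h3 := Finset.card_insert_le a ({a'} : Finset K)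
  rw [Finset.card_singleton] at h3
  obtain ⟨b, hb, hb'⟩ := exists_miss (f := f) v {a, a'} (by omega)
  simp only [Finset.mem_insert, Finset.mem_singleton, not_or] at hb'
  exact ⟨b, hb'.1, hb'.2, hb⟩

lemma card_Cs_ge {v : V} (S : Finset K) (hS : ∀ a, Miss f v a → a ∈ S) :
    Fintype.card K ≤ (Cs f v).card + S.card := by
  by_contra hn
  obtain ⟨a, h1, h2⟩ := exists_miss (f := f) v S (by omega)
  exact h2 (hS a h1)

lemma Sit.deg4 (h : Sit F f dg x y x1 x2 u1 u2) {v : V} (hv : v = x1 ∨ v = x2 ∨ v = u1 ∨ v = u2)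
    (hm : ∀ c, Miss f v c → c = a ∨ c = b) : 4 ≤ dg v := by
  have h1 := h.tm v hv
  have h2 := h.n5
  have h3 := card_Cs_ge (f := f) (v := v) {a, b} (fun c hc => by simpa using hm c hc)
  have h4 := Finset.card_le_two (a := a) (b := b)
  omega

lemma Sit.deg4' (h : Sit F f dg x y x1 x2 u1 u2) {v : V} (hv : v = x1 ∨ v = x2) (hv' : v = u1 ∨ v = u2)
    (hm : ∀ c, Miss f v c → c = a ∨ c = b ∨ c = d) : 4 ≤ dg v := by
  have h1 := h.co v hv hv'
  have h2 := h.n5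
  have h3 := card_Cs_ge (f := f) (v := v) {a, b, d} (fun c hc => by simpa using hm c hc)
  have h4 := Finset.card_le_three (a := a) (b := b) (c := d)
  omega

lemma Sit.fresh (h : Sit F f dg x y x1 x2 u1 u2) (a b c d : K) :
    ∃ e, e ≠ a ∧ e ≠ b ∧ e ≠ c ∧ e ≠ d := by
  have h2 := h.n5
  have h4 := Finset.card_le_four (a := a) (b := b) (c := c) (d := d)
  obtain ⟨e, -, he⟩ := Finset.exists_mem_notMem_of_card_lt_card (s := {a, b, c, d}) (t := (Finset.univ : Finset K))
    (by rw [Finset.card_univ]; omega)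
  simp only [Finset.mem_insert, Finset.mem_singleton, not_or] at he
  exact ⟨e, he⟩

/-- Hypotheses of the case with exactly one common color. -/
structure One {V K : Type*} [Fintype K] (F f : V → V → Option K) (dg : V → ℕ)
    (x y x1 x2 u1 u2 : V) (o t s : K) : Prop extends Sit F f dg x y x1 x2 u1 u2 where
  mx1 : Miss f x1 o
  mx2 : Miss f x2 t
  mu1 : Miss f u1 o
  mu2 : Miss f u2 s
  ot : o ≠ t
  os : o ≠ s
  ts : t ≠ s
  x1u1 : x1 ≠ u1
  r12 : ¬ R f o t x1 x2
  r13 : ¬ R f o s u1 u2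

variable {o t s : K}

lemma One.symm (h : One F f dg x y x1 x2 u1 u2 o t s) : One F f dg y x u1 u2 x1 x2 o s t :=
  { h.toSit.symm with
    mx1 := h.mu1
    mx2 := h.mu2
    mu1 := h.mx1
    mu2 := h.mx2
    ot := h.os
    os := h.ot
    ts := h.ts.symm
    x1u1 := h.x1u1.symm
    r12 := h.r13
    r13 := h.r12 }

lemma One.hR (h : One F f dg x y x1 x2 u1 u2 o t s) {α : K} (h1 : α ≠ o) (h2 : α ≠ t) (h3 : α ≠ s) :
    R f o α x1 u1 :=
  h.go1 o t s α h.mx1 h.mx2 h.mu1 h.mu2 h.ot h.os h.ts h.x1u1 h.r12 h.r13 h1 h2 h3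

lemma One.lx1 (h : One F f dg x y x1 x2 u1 u2 o t s) {α : K} (h1 : α ≠ o) (h2 : α ≠ t) (h3 : α ≠ s) :
    ¬ Miss f x1 α := fun hm => h.x1u1 ((h.hR h1 h2 h3).iso h.mx1 hm)

lemma One.lu1 (h : One F f dg x y x1 x2 u1 u2 o t s) {α : K} (h1 : α ≠ o) (h2 : α ≠ t) (h3 : α ≠ s) :
    ¬ Miss f u1 α := h.symm.lx1 h1 h3 h2

lemma One.lx2 (h : One F f dg x y x1 x2 u1 u2 o t s) {δ : K} (d1 : δ ≠ o) (d2 : δ ≠ t) (d3 : δ ≠ s) :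
    ¬ Miss f x2 δ := by
  intro hδ
  have pc := h.pc
  have x2u1 : x2 ≠ u1 := by
    intro k
    exact h.lu1 d1 d2 d3 (k ▸ hδ)
  have n1 : ¬ R f o δ x1 x2 := fun hR =>
    key pc (Or.inl h.mx1) (Or.inl h.mu1) (Or.inr hδ) h.x1u1 h.x12 x2u1.symm (h.hR d1 d2 d3) hR
  have R1 : R f o t x1 u1 := h.go1 o δ s t h.mx1 hδ h.mu1 h.mu2 d1.symm h.os d3 h.x1u1 n1 h.r13
    h.ot.symm d2.symm h.ts
  have a1 : ¬ Miss f x1 t := fun k => h.x1u1 (R1.iso h.mx1 k)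
  have a2 : ¬ Miss f u1 t := fun k => h.x1u1 (R1.symm.iso h.mu1 k).symm
  have a3 : Miss f x1 s := by
    obtain ⟨b, hb, hb'⟩ := h.two (v := x1) (by tauto) o
    by_cases e1 : b = s
    · exact e1 ▸ hb'
    · by_cases e2 : b = t
      · exact absurd (e2 ▸ hb') a1
      · exact absurd hb' (h.lx1 hb e2 e1)
  have b1 : ∀ δ', δ' ≠ o → δ' ≠ t → δ' ≠ s → ¬ Miss f u2 δ' := by
    intro δ' e1 e2 e3 hm
    have x1u2 : x1 ≠ u2 := by
      intro k
      exact h.lx1 e1 e2 e3 (k ▸ hm)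
    have R2 := h.go1 o t δ' s h.mx1 h.mx2 h.mu1 hm h.ot e1.symm e2.symm h.x1u1 h.r12 (fun hR =>
      key pc (Or.inl h.mu1) (Or.inl h.mx1) (Or.inr hm) h.x1u1.symm h.u12 x1u2 (h.hR e1 e2 e3).symm hR)
      h.os.symm h.ts.symm e3.symm
    exact h.x1u1 (R2.iso h.mx1 a3)
  have x1u2 : x1 ≠ u2 := by
    intro k
    obtain ⟨b, e1, e2, e3⟩ := h.three (v := x1) (by tauto) (by tauto) o s
    by_cases e4 : b = t
    · exact a1 (e4 ▸ e3)
    · exact h.lx1 e1 e4 e2 e3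
  obtain ⟨b, e1, e2⟩ := h.two (v := u2) (by tauto) s
  by_cases e3 : b = o
  · subst e3
    have n2 : ¬ R f b s u2 u1 := fun k => h.r13 k.symm
    have a4 : Miss f u1 s := by
      obtain ⟨b', hb, hb'⟩ := h.two (v := u1) (by tauto) b
      by_cases e1 : b' = s
      · exact e1 ▸ hb'
      · by_cases e2 : b' = t
        · exact absurd (e2 ▸ hb') a2
        · exact absurd hb' (h.lu1 hb e2 e1)
    have R3 := h.swapu.go1 b t s δ h.mx1 h.mx2 e2 a4 h.ot h.os h.ts x1u2 h.r12 n2 d1 d2 d3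
    exact key pc (Or.inl h.mx1) (Or.inl h.mu1) (Or.inl e2) h.x1u1 x1u2 h.u12 (h.hR d1 d2 d3) R3
  · by_cases e4 : b = t
    · subst e4
      have R3 := h.go1 o δ b s h.mx1 hδ h.mu1 e2 d1.symm h.ot d2 h.x1u1 n1 (fun hR =>
        key pc (Or.inl h.mu1) (Or.inl h.mx1) (Or.inr e2) h.x1u1.symm h.u12 x1u2 R1.symm hR) h.os.symm d3.symm h.ts.symm
      exact h.x1u1 (R3.iso h.mx1 a3)
    · exact b1 b e3 e4 e1 e2

lemma One.lu2 (h : One F f dg x y x1 x2 u1 u2 o t s) {δ : K} (d1 : δ ≠ o) (d2 : δ ≠ t) (d3 : δ ≠ s) :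
    ¬ Miss f u2 δ := h.symm.lx2 d1 d3 d2

end
end AEC

namespace AEC
section
variable {V K : Type*} [Fintype K] [DecidableEq V] [DecidableEq K] {F f : V → V → Option K} {dg : V → ℕ}
  {x y x1 x2 u1 u2 : V} {o t s : K}

lemma nR1 {f : V → V → Option K} {a b : K} {u v : V} (ha : Miss f u a) (hb : Miss f u b) (huv : u ≠ v) :
    ¬ R f a b u v := fun k => huv (k.iso ha hb)

lemma nR2 {f : V → V → Option K} {a b : K} {u v : V} (ha : Miss f v a) (hb : Miss f v b) (huv : u ≠ v) :
    ¬ R f a b u v := fun k => huv (k.symm.iso ha hb).symm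

lemma One.al (h : One F f dg x y x1 x2 u1 u2 o t s) : ∃ α, α ≠ o ∧ α ≠ t ∧ α ≠ s := by
  obtain ⟨e, h1, h2, h3, -⟩ := h.fresh o t s s
  exact ⟨e, h1, h2, h3⟩

lemma One.kx2 (h : One F f dg x y x1 x2 u1 u2 o t s) {α : K} (a1 : α ≠ o) (a2 : α ≠ t) (a3 : α ≠ s)
    (m : Miss f x2 o) (x2u1 : x2 ≠ u1) (hR : R f o α x2 u1) : False :=
  key h.pc (Or.inl h.mu1) (Or.inl h.mx1) (Or.inl m) h.x1u1.symm x2u1.symm h.x12 (h.hR a1 a2 a3).symm hR.symm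

lemma One.N0 (h : One F f dg x y x1 x2 u1 u2 o t s) (m1 : Miss f x1 t) (m2 : Miss f x2 o)
    (x2u1 : x2 ≠ u1) : False := by
  obtain ⟨α, a1, a2, a3⟩ := h.al
  exact h.kx2 a1 a2 a3 m2 x2u1 (h.swapx.go1 o t s α m2 m1 h.mu1 h.mu2 h.ot h.os h.ts x2u1
    (fun k => h.r12 k.symm) h.r13 a1 a2 a3)

lemma One.N1 (h : One F f dg x y x1 x2 u1 u2 o t s) (m1 : Miss f x1 s) (m2 : Miss f x2 o)
    (m3 : Miss f u1 t) (m4 : Miss f u2 t) (x2u1 : x2 ≠ u1) : False := by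
  obtain ⟨α, a1, a2, a3⟩ := h.al
  exact h.kx2 a1 a2 a3 m2 x2u1 (h.swapx.go1 o s t α m2 m1 h.mu1 m4 h.os h.ot h.ts.symm x2u1
    (nR2 h.mx1 m1 h.x12.symm) (nR1 h.mu1 m3 h.u12) a1 a3 a2)

lemma One.ex1 (h : One F f dg x y x1 x2 u1 u2 o t s) : Miss f x1 t ∨ Miss f x1 s := by
  obtain ⟨b, hb, hb'⟩ := h.two (v := x1) (by tauto) o
  by_cases e1 : b = s
  · exact Or.inr (e1 ▸ hb')
  · by_cases e2 : b = t
    · exact Or.inl (e2 ▸ hb')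
    · exact absurd hb' (h.lx1 hb e2 e1)

lemma One.ex2 (h : One F f dg x y x1 x2 u1 u2 o t s) : Miss f x2 o ∨ Miss f x2 s := by
  obtain ⟨b, hb, hb'⟩ := h.two (v := x2) (by tauto) t
  by_cases e1 : b = s
  · exact Or.inr (e1 ▸ hb')
  · by_cases e2 : b = o
    · exact Or.inl (e2 ▸ hb')
    · exact absurd hb' (h.lx2 e2 hb e1)

lemma One.T1 (h : One F f dg x y x1 x2 u1 u2 o t s) : x2 ≠ u2 := by
  intro k
  have x2u1 : x2 ≠ u1 := fun k' => h.u12 (k'.symm.trans k)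
  have mo : Miss f x2 o := by
    obtain ⟨b, e1, e2, e3⟩ := h.three (v := x2) (by tauto) (by tauto) t s
    by_cases e4 : b = o
    · exact e4 ▸ e3
    · exact absurd e3 (h.lx2 e4 e1 e2)
  rcases h.ex1 with h1 | h1
  · exact h.N0 h1 mo x2u1
  · have x1u2 : u2 ≠ x1 := fun k' => h.x12 (k'.symm.trans k.symm)
    rcases h.symm.ex1 with h2 | h2
    · exact h.symm.N0 h2 (k ▸ mo) x1u2
    · exact h.N1 h1 mo h2 (k ▸ h.mx2) x2u1

lemma One.T2 (h : One F f dg x y x1 x2 u1 u2 o t s) : x2 ≠ u1 := by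
  intro k
  have x2u2 := h.T1
  have ms : Miss f x2 s := by
    obtain ⟨b, e1, e2, e3⟩ := h.three (v := x2) (by tauto) (by tauto) o t
    by_cases e4 : b = s
    · exact e4 ▸ e3
    · exact absurd e3 (h.lx2 e1 e2 e4)
  have mt := h.mx2
  have mo : Miss f x2 o := k ▸ h.mu1
  have mt' : Miss f u1 t := k ▸ mt
  have ms' : Miss f u1 s := k ▸ ms
  have mu2 : Miss f u2 t := by
    by_cases x1u2 : x1 = u2
    · obtain ⟨b, e1, e2, e3⟩ := h.three (v := x1) (by tauto) (by tauto) o s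
      by_cases e4 : b = t
      · exact x1u2 ▸ e4 ▸ e3
      · exact absurd e3 (h.lx1 e1 e4 e2)
    · rcases h.symm.ex2 with h1 | h1
      · exact (h.symm.N0 ms' h1 (Ne.symm x1u2)).elim
      · exact h1
  have Rt : ∀ α, α ≠ o → α ≠ t → α ≠ s → R f t α x2 u2 := fun α a1 a2 a3 =>
    h.swapx.swapu.go1 t o s α mt h.mx1 mu2 ms' h.ot.symm h.ts h.os x2u2
      (nR1 mt mo h.x12.symm) (nR2 mt' ms' h.u12.symm) a2 a1 a3
  have Rs : ∀ α, α ≠ o → α ≠ t → α ≠ s → R f s α x2 u2 := fun α a1 a2 a3 =>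
    h.swapx.swapu.go1 s o t α ms h.mx1 h.mu2 mt' h.os.symm h.ts.symm h.ot x2u2
      (nR1 ms mo h.x12.symm) (nR2 ms' mt' h.u12.symm) a3 a1 a2
  obtain ⟨α, a1, a2, a3⟩ := h.al
  have Rt := Rt α a1 a2 a3
  have Rs := Rs α a1 a2 a3
  have Ro := h.hR a1 a2 a3
  by_cases x1u2 : x1 = u2
  · rw [← x1u2] at Rt Rs mu2
    rw [← k] at Ro
    have ms1 : Miss f x1 s := x1u2 ▸ h.mu2
    have d1 : 4 ≤ dg x1 := h.deg4' (v := x1) (a := o) (b := t) (d := s) (by tauto) (by tauto) (by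
      intro c hc
      by_contra hn
      push Not at hn
      exact h.lx1 hn.1 hn.2.1 hn.2.2 hc)
    have d2 : 4 ≤ dg x2 := h.deg4' (v := x2) (a := o) (b := t) (d := s) (by tauto) (by tauto) (by
      intro c hc
      by_contra hn
      push Not at hn
      exact h.lx2 hn.1 hn.2.1 hn.2.2 hc)
    obtain ⟨z, hz⟩ := not_miss.1 (h.lx1 a1 a2 a3)
    have dz : dg z ≤ 3 := by
      have := h.sp _ _ _ hz
      omega
    have zx2 : z ≠ x2 := by rintro rfl; omega
    have p : ∀ g, Miss f x1 g → R f g α x1 x2 → ¬ Miss f z g := by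
      intro g m hR hm
      rcases hR.swap.stub h.pc m hz hm with h1 | h1
      · exact h.x12 h1
      · exact zx2 h1
    have p1 := p o h.mx1 Ro
    have p2 := p t mu2 Rt.symm
    have p3 := p s ms1 Rs.symm
    have p4 : ¬ Miss f z α := fun hm => hm x1 (by rw [h.pc.symm]; exact hz)
    have := four ((h.le z).trans dz) p1 p2 p3 p4
    have := h.ot
    have := h.os
    have := h.ts
    grind
  · have x1x2 := h.x12
    rw [← k] at ms' mt'
    have k' : ∀ g, Miss f x1 g → Miss f x2 g → Miss f u2 g → R f g α x2 u2 → R f g α x1 u1 → False := by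
      intro g m1 m2 m3 h1 h2
      rw [← k] at h2
      exact key h.pc (Or.inl m2) (Or.inl m1) (Or.inl m3) h.x12.symm x2u2 x1u2 h2.symm h1
    rcases h.ex1 with h1 | h1
    · exact k' t h1 mt mu2 Rt (h.go1 t o s α h1 mo (k ▸ mt) h.mu2 h.ot.symm h.ts h.os h.x1u1
        (nR2 mt mo h.x12) (nR1 (k ▸ mt) (k ▸ ms) h.u12) a2 a1 a3)
    · exact k' s h1 ms h.mu2 Rs (h.go1 s o t α h1 mo (k ▸ ms) mu2 h.os.symm h.ts.symm h.ot h.x1u1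
        (nR2 ms mo h.x12) (nR1 (k ▸ ms) (k ▸ mt) h.u12) a3 a1 a2)

lemma One.Fl (h : One F f dg x y x1 x2 u1 u2 o t s) (m1 : Miss f x1 s) (m2 : ¬ Miss f x1 t)
    (du1 : 4 ≤ dg u1) (du2 : 4 ≤ dg u2) (x1u2 : x1 ≠ u2)
    (hs : ∀ α, α ≠ o → α ≠ t → α ≠ s → R f s α x1 u2) : False := by
  obtain ⟨α, a1, a2, a3⟩ := h.al
  obtain ⟨β, b1, b2, b3, b4⟩ := h.fresh o t s α
  have d1 : 4 ≤ dg x1 := h.deg4 (v := x1) (a := o) (b := s) (by tauto) (by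
      intro c hc
      by_contra hn
      push Not at hn
      by_cases ht : c = t
      · exact m2 (ht ▸ hc)
      · exact h.lx1 hn.1 ht hn.2 hc)
  have p : ∀ γ z, γ ≠ o → γ ≠ t → γ ≠ s → f x1 z = some γ → z ≠ u1 ∧ ∀ g, ¬ Miss f z g → g = γ ∨ g = o ∨ g = s := by
    intro γ z g1 g2 g3 hz
    have dz : dg z ≤ 3 := by
      have := h.sp _ _ _ hz
      omega
    have z1 : z ≠ u1 := by rintro rfl; omega
    have z2 : z ≠ u2 := by rintro rfl; omega
    refine ⟨z1, ?_⟩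
    have q1 : ¬ Miss f z o := by
      intro hm
      rcases (h.hR g1 g2 g3).swap.stub h.pc h.mx1 hz hm with h1 | h1
      · exact h.x1u1 h1
      · exact z1 h1
    have q2 : ¬ Miss f z s := by
      intro hm
      rcases (hs γ g1 g2 g3).swap.stub h.pc m1 hz hm with h1 | h1
      · exact x1u2 h1
      · exact z2 h1
    have q3 : ¬ Miss f z γ := fun hm => hm x1 (by rw [h.pc.symm]; exact hz)
    intro g hg
    have := four ((h.le z).trans dz) q1 q2 q3 hg
    have := h.os
    grind
  obtain ⟨z, hz⟩ := not_miss.1 (h.lx1 a1 a2 a3)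
  obtain ⟨z', hz'⟩ := not_miss.1 (h.lx1 b1 b2 b3)
  obtain ⟨zu, pz⟩ := p α z a1 a2 a3 hz
  obtain ⟨zu', pz'⟩ := p β z' b1 b2 b3 hz'
  have zz' : z ≠ z' := by
    rintro rfl
    rw [hz] at hz'
    exact b4 (Option.some.inj hz').symm
  have mz : Miss f z β := by
    by_contra hn
    have := pz β hn
    tauto
  have mz' : Miss f z' α := by
    by_contra hn
    have := pz' α hn
    have := b4.symm
    tauto
  have pc' := swp_PC h.pc zz' hz hz' mz mz' (by
    intro g w ga gb hw hg
    rcases pz g hg with k | k | k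
    · exact absurd k ga
    · exact absurd (k ▸ hw) (h.mx1 w)
    · exact absurd (k ▸ hw) (m1 w)) (by
    intro g w ga gb hw hg
    rcases pz' g hg with k | k | k
    · exact absurd k gb
    · exact absurd (k ▸ hw) (h.mx1 w)
    · exact absurd (k ▸ hw) (m1 w))
  have C' := h.toCfg.swp hz hz' pc'
  have mm : ∀ v g, g ≠ α → g ≠ β → Miss f v g → Miss (swp f x1 z z' α β) v g := by
    intro v g ga gb hm w hw
    have := hm w
    simp only [swp, upd] at hw
    grind
  have R1 := C'.go1 o t s α (mm _ _ a1.symm b1.symm h.mx1) (mm _ _ a2.symm b2.symm h.mx2)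
    (mm _ _ a1.symm b1.symm h.mu1) (mm _ _ a3.symm b3.symm h.mu2) h.ot h.os h.ts h.x1u1
    (fun hR => h.r12 ((swp_R_iff h.pc hz hz' a1.symm b1.symm a2.symm b2.symm).1 hR))
    (fun hR => h.r13 ((swp_R_iff h.pc hz hz' a1.symm b1.symm a3.symm b3.symm).1 hR)) a1 a2 a3
  have R2 : R (swp f x1 z z' α β) α o z u1 := swp_R h.pc hz h.mx1 h.x1u1 (h.hR a1 a2 a3).swap
  have zx1 : z ≠ x1 := by rintro rfl; rw [h.pc.loop] at hz; cases hz
  have mz2 : Miss (swp f x1 z z' α β) z α := by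
    intro w hw
    have h1 := h.pc.prop z w x1 α
    have h2 := h.pc.symm z x1
    simp only [swp, upd] at hw
    grind
  exact key pc' (Or.inl (mm _ _ a1.symm b1.symm h.mu1)) (Or.inl (mm _ _ a1.symm b1.symm h.mx1)) (Or.inr mz2)
    h.x1u1.symm zu.symm zx1.symm R1.symm R2.swap.symm

lemma One.F1 (h : One F f dg x y x1 x2 u1 u2 o t s) (m1 : Miss f x1 s) (m2 : Miss f x2 s)
    (m3 : Miss f u1 s) (m4 : Miss f u2 t) (x1u2 : x1 ≠ u2) (x2u1 : x2 ≠ u1) : False := by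
  have x2u2 := h.T1
  have e1 : ¬ Miss f x1 t := by
    intro e
    rcases h.swapu.go2 t s o e m2 m4 m3 h.ts (nR2 h.mx2 m2 h.x12) (nR1 m4 h.mu2 h.u12.symm)
      ⟨⟨x1u2, h.x1u1, x2u2, x2u1⟩, Or.inl m1⟩ h.ot h.os with k | k
    · exact x1u2 (k.iso e h.mx1)
    · exact x2u1 (k.symm.iso m3 h.mu1).symm
  have e2 : ¬ Miss f u1 t := by
    intro e
    rcases h.go2 o t s h.mx1 h.mx2 h.mu1 m4 h.ot h.r12 (nR1 h.mu1 e h.u12)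
      ⟨⟨h.x1u1, x1u2, x2u1, x2u2⟩, Or.inr (Or.inr (Or.inl e))⟩ h.os.symm h.ts.symm with k | k
    · exact h.x1u1 (k.iso h.mx1 m1)
    · exact x2u2 (k.iso h.mx2 m2)
  have e3 : ¬ Miss f u2 o := fun e => h.symm.N0 m3 e x1u2.symm
  refine h.Fl m1 e1 ?_ ?_ x1u2 ?_
  · refine h.deg4 (v := u1) (a := o) (b := s) (by tauto) ?_
    intro c hc
    by_contra hn
    push Not at hn
    by_cases ht : c = t
    · exact e2 (ht ▸ hc)
    · exact h.lu1 hn.1 ht hn.2 hc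
  · refine h.deg4 (v := u2) (a := t) (b := s) (by tauto) ?_
    intro c hc
    by_contra hn
    push Not at hn
    by_cases ht : c = o
    · exact e3 (ht ▸ hc)
    · exact h.lu2 ht hn.1 hn.2 hc
  · intro α a1 a2 a3
    exact h.swapu.go1 s t o α m1 h.mx2 h.mu2 h.mu1 h.ts.symm h.os.symm h.ot.symm x1u2
      (nR2 m2 h.mx2 h.x12) (fun k => h.r13 k.symm.swap) a3 a2 a1

lemma One.F2 (h : One F f dg x y x1 x2 u1 u2 o t s) (m1 : Miss f x1 s) (m2 : Miss f x2 o)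
    (m3 : Miss f u1 t) (m4 : Miss f u2 o) (x1u2 : x1 ≠ u2) (x2u1 : x2 ≠ u1) : False := by
  have x2u2 := h.T1
  have e1 : ¬ Miss f x1 t := fun e => h.N0 e m2 x2u1
  have e2 : ¬ Miss f u1 s := fun e => h.symm.N0 e m4 x1u2.symm
  have e3 : ¬ Miss f u2 t := fun e => h.N1 m1 m2 m3 e x2u1
  refine h.Fl m1 e1 ?_ ?_ x1u2 ?_
  · refine h.deg4 (v := u1) (a := o) (b := t) (by tauto) ?_
    intro c hc
    by_contra hn
    push Not at hn
    by_cases ht : c = s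
    · exact e2 (ht ▸ hc)
    · exact h.lu1 hn.1 hn.2 ht hc
  · refine h.deg4 (v := u2) (a := o) (b := s) (by tauto) ?_
    intro c hc
    by_contra hn
    push Not at hn
    by_cases ht : c = t
    · exact e3 (ht ▸ hc)
    · exact h.lu2 hn.1 ht hn.2 hc
  · intro α a1 a2 a3
    rcases h.swapu.go2 s o α m1 m2 h.mu2 h.mu1 h.os.symm (nR1 m1 h.mx1 h.x12) (fun k => h.r13 k.symm.swap)
      ⟨⟨x1u2, h.x1u1, x2u2, x2u1⟩, Or.inl h.mx1⟩ a3 a1 with k | k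
    · exact k
    · exact (h.kx2 a1 a2 a3 m2 x2u1 k).elim

lemma One.N2 (h : One F f dg x y x1 x2 u1 u2 o t s) (m1 : Miss f x1 s) (m2 : Miss f x2 o)
    (m4 : Miss f u2 t) (x1u2 : x1 ≠ u2) (x2u1 : x2 ≠ u1) : False := by
  have x2u2 := h.T1
  rcases h.swapu.go2 s o t m1 m2 h.mu2 h.mu1 h.os.symm (nR1 m1 h.mx1 h.x12) (fun k => h.r13 k.symm.swap)
      ⟨⟨x1u2, h.x1u1, x2u2, x2u1⟩, Or.inl h.mx1⟩ h.ts h.ot.symm with k | k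
  · exact x1u2 (k.symm.iso h.mu2 m4).symm
  · exact x2u1 (k.iso m2 h.mx2)

lemma One.N3 (h : One F f dg x y x1 x2 u1 u2 o t s) (m1 : Miss f x1 s) (m2 : Miss f x2 s)
    (m3 : Miss f u1 t) (m4 : Miss f u2 t) (x1u2 : x1 ≠ u2) (x2u1 : x2 ≠ u1) : False := by
  have x2u2 := h.T1
  rcases h.go2 o t s h.mx1 h.mx2 h.mu1 m4 h.ot h.r12 (nR1 h.mu1 m3 h.u12)
      ⟨⟨h.x1u1, x1u2, x2u1, x2u2⟩, Or.inr (Or.inr (Or.inl m3))⟩ h.os.symm h.ts.symm with k | k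
  · exact h.x1u1 (k.iso h.mx1 m1)
  · exact x2u2 (k.iso h.mx2 m2)

lemma One.N4 (h : One F f dg x y x1 x2 u1 u2 o t s) (m1 : Miss f x1 t) (m2 : Miss f x2 s)
    (m3 : Miss f u1 s) (m4 : Miss f u2 t) (x1u2 : x1 ≠ u2) (x2u1 : x2 ≠ u1) : False := by
  have x2u2 := h.T1
  rcases h.swapu.go2 t s o m1 m2 m4 m3 h.ts (nR2 h.mx2 m2 h.x12) (nR1 m4 h.mu2 h.u12.symm)
      ⟨⟨x1u2, h.x1u1, x2u2, x2u1⟩, Or.inr (Or.inl h.mx2)⟩ h.ot h.os with k | k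
  · exact x1u2 (k.iso m1 h.mx1)
  · exact x2u1 (k.symm.iso m3 h.mu1).symm

lemma One.done (h : One F f dg x y x1 x2 u1 u2 o t s) : False := by
  have x2u1 := h.T2
  have x1u2 : x1 ≠ u2 := h.symm.T2.symm
  have g := h.symm
  rcases h.ex1 with h1 | h1 <;> rcases h.ex2 with h2 | h2 <;> rcases g.ex1 with h3 | h3 <;>
    rcases g.ex2 with h4 | h4
  -- x1 t, x2 o
  · exact h.N0 h1 h2 x2u1
  · exact h.N0 h1 h2 x2u1
  · exact h.N0 h1 h2 x2u1
  · exact h.N0 h1 h2 x2u1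
  -- x1 t, x2 s
  · exact g.N0 h3 h4 x1u2.symm
  · exact h.N4 h1 h2 h3 h4 x1u2 x2u1
  · exact g.N2 h3 h4 h2 x2u1.symm x1u2.symm
  · exact g.F1 h3 h4 h1 h2 x2u1.symm x1u2.symm
  -- x1 s, x2 o
  · exact g.N0 h3 h4 x1u2.symm
  · exact h.N2 h1 h2 h4 x1u2 x2u1
  · exact h.F2 h1 h2 h3 h4 x1u2 x2u1
  · exact h.N1 h1 h2 h3 h4 x2u1
  -- x1 s, x2 s
  · exact g.N0 h3 h4 x1u2.symm
  · exact h.F1 h1 h2 h3 h4 x1u2 x2u1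
  · exact g.N1 h3 h4 h1 h2 x1u2.symm
  · exact h.N3 h1 h2 h3 h4 x1u2 x2u1

end
end AEC

namespace AEC

/-- Hypotheses of the case with two common colors. -/
structure Two {V K : Type*} [Fintype K] (F f : V → V → Option K) (dg : V → ℕ)
    (x y x1 x2 u1 u2 : V) (o t : K) : Prop extends Sit F f dg x y x1 x2 u1 u2 where
  mx1 : Miss f x1 o
  mx2 : Miss f x2 t
  mu1 : Miss f u1 o
  mu2 : Miss f u2 t
  ot : o ≠ t
  x1u1 : x1 ≠ u1
  x2u2 : x2 ≠ u2
  r12 : ¬ R f o t x1 x2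
  r13 : ¬ R f o t u1 u2
  hR : ∀ α, α ≠ o → α ≠ t → R f o α x1 u1 ∨ R f t α x2 u2

section
variable {V K : Type*} [Fintype K] [DecidableEq V] [DecidableEq K] {F f : V → V → Option K} {dg : V → ℕ}
  {x y x1 x2 u1 u2 : V} {o t s : K}

lemma Two.symm (h : Two F f dg x y x1 x2 u1 u2 o t) : Two F f dg y x u1 u2 x1 x2 o t :=
  { h.toSit.symm with
    mx1 := h.mu1
    mx2 := h.mu2
    mu1 := h.mx1
    mu2 := h.mx2
    ot := h.ot
    x1u1 := h.x1u1.symm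
    x2u2 := h.x2u2.symm
    r12 := h.r13
    r13 := h.r12
    hR := fun α a1 a2 => (h.hR α a1 a2).imp R.symm R.symm }

lemma Two.swap (h : Two F f dg x y x1 x2 u1 u2 o t) : Two F f dg x y x2 x1 u2 u1 t o :=
  { h.toSit.swapx.swapu with
    mx1 := h.mx2
    mx2 := h.mx1
    mu1 := h.mu2
    mu2 := h.mu1
    ot := h.ot.symm
    x1u1 := h.x2u2
    x2u2 := h.x1u1
    r12 := fun k => h.r12 k.symm.swap
    r13 := fun k => h.r13 k.symm.swap
    hR := fun α a1 a2 => (h.hR α a2 a1).symm }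

lemma Two.lx2 (h : Two F f dg x y x1 x2 u1 u2 o t) {δ : K} (d1 : δ ≠ o) (d2 : δ ≠ t) :
    ¬ Miss f x2 δ := by
  intro hm
  have R1 : R f o δ x1 u1 := by
    rcases h.hR δ d1 d2 with k | k
    · exact k
    · exact absurd (k.iso h.mx2 hm) h.x2u2
  have x2u1 : x2 ≠ u1 := by
    intro k
    exact h.x1u1 (R1.symm.iso h.mu1 (k ▸ hm)).symm
  have : One F f dg x y x1 x2 u1 u2 o δ t :=
    { h.toSit with
      mx1 := h.mx1
      mx2 := hm
      mu1 := h.mu1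
      mu2 := h.mu2
      ot := d1.symm
      os := h.ot
      ts := d2
      x1u1 := h.x1u1
      r12 := fun hR => key h.pc (Or.inl h.mx1) (Or.inl h.mu1) (Or.inr hm) h.x1u1 h.x12 x2u1.symm R1 hR
      r13 := h.r13 }
  exact this.done

lemma Two.fx2 (h : Two F f dg x y x1 x2 u1 u2 o t) : Miss f x2 o ∧ 4 ≤ dg x2 ∧ x2 ≠ u1 := by
  have h0 : ∀ c, Miss f x2 c → c = o ∨ c = t := by
    intro c hc
    by_contra hn
    push Not at hn
    exact h.lx2 hn.1 hn.2 hc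
  refine ⟨?_, h.deg4 (by tauto) h0, ?_⟩
  · obtain ⟨b, e1, e2⟩ := h.two (v := x2) (by tauto) t
    rcases h0 b e2 with k | k
    · exact k ▸ e2
    · exact absurd k e1
  · intro k
    obtain ⟨b, e1, e2, e3⟩ := h.three (v := x2) (by tauto) (by tauto) o t
    have := h0 b e3
    tauto

lemma Cfg.AB (h : Cfg F f x y x1 x2 u1 u2) (ot : o ≠ t) (n11 : x1 ≠ u1) (n12 : x1 ≠ u2) (n21 : x2 ≠ u1)
    (n22 : x2 ≠ u2)
    (a1 : Miss f x1 o) (a2 : Miss f x1 t) (b1 : Miss f x2 o) (b2 : Miss f x2 t)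
    (c1 : Miss f u1 o) (c2 : Miss f u1 t) (d1 : Miss f u2 o) (d2 : Miss f u2 t) {α : K}
    (αo : α ≠ o) (αt : α ≠ t) : 
    (R f o α x1 u1 ∧ R f t α x1 u2 ∧ R f o α x2 u2) ∨ (R f o α x1 u2 ∧ R f t α x1 u1 ∧ R f o α x2 u1) := by
  have q1 := h.go2 o t α a1 b2 c1 d2 ot (nR1 a1 a2 h.x12) (nR1 c1 c2 h.u12) ⟨⟨n11, n12, n21, n22⟩, Or.inl a2⟩ αo αt
  have q2 := h.go2 t o α a2 b1 c2 d1 ot.symm (nR1 a2 a1 h.x12) (nR1 c2 c1 h.u12)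
    ⟨⟨n11, n12, n21, n22⟩, Or.inl a1⟩ αt αo
  have q3 := h.swapu.go2 o t α a1 b2 d1 c2 ot (nR1 a1 a2 h.x12) (nR1 d1 d2 h.u12.symm)
    ⟨⟨n12, n11, n22, n21⟩, Or.inl a2⟩ αo αt
  have q4 := h.swapu.go2 t o α a2 b1 d2 c1 ot.symm (nR1 a2 a1 h.x12) (nR1 d2 d1 h.u12.symm)
    ⟨⟨n12, n11, n22, n21⟩, Or.inl a1⟩ αt αo
  have k1 : ∀ {p q r : V} {g : K}, Miss f p g → Miss f q g → Miss f r g → p ≠ q → p ≠ r → q ≠ r →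
      R f g α p q → ¬ R f g α p r := fun m1 m2 m3 h1 h2 h3 e1 e2 =>
    key h.pc (Or.inl m1) (Or.inl m2) (Or.inl m3) h1 h2 h3 e1 e2
  have w1 := k1 a1 c1 d1 n11 n12 h.u12
  have w2 := k1 a2 c2 d2 n11 n12 h.u12
  have w3 := k1 b1 c1 d1 n21 n22 h.u12
  have w4 := k1 b2 c2 d2 n21 n22 h.u12
  rcases q1 with q1 | q1
  · have q3 := q3.resolve_left (w1 q1)
    have q2 := q2.resolve_left (fun k => k1 c2 b2 a2 n21.symm n11.symm h.x12.symm q3.symm k.symm)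
    have q4 := q4.resolve_right (fun k => w3 k q2)
    exact Or.inl ⟨q1, q4, q2⟩
  · have q3 := q3.resolve_right (fun k => w4 k q1)
    have q2 := q2.resolve_right (fun k => k1 d1 b1 a1 n22.symm n12.symm h.x12.symm k.symm q3.symm)
    have q4 := q4.resolve_left (w2 q2)
    exact Or.inr ⟨q3, q2, q4⟩

lemma Two.done (h : Two F f dg x y x1 x2 u1 u2 o t) : False := by
  obtain ⟨b1, db, n21⟩ := h.fx2
  obtain ⟨a2, da, n12⟩ := h.swap.fx2
  obtain ⟨d1, dd, -⟩ := h.symm.fx2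
  obtain ⟨c2, dc, -⟩ := h.symm.swap.fx2
  have ab := @Cfg.AB _ _ _ _ _ F f x y x1 x2 u1 u2 o t h.toCfg h.ot h.x1u1 n12 n21 h.x2u2 h.mx1 a2 b1 h.mx2 h.mu1 c2 d1 h.mu2
  obtain ⟨α, a1, a3, -⟩ := h.fresh o t t t
  obtain ⟨β, e1, e2, e3, -⟩ := h.fresh o t α t
  have p : ∀ γ z, γ ≠ o → γ ≠ t → f x1 z = some γ → dg z ≤ 3 ∧ ∀ g, ¬ Miss f z g → g = γ ∨ g = o ∨ g = t := by
    intro γ z g1 g2 hz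
    have dz : dg z ≤ 3 := by
      have := h.sp _ _ _ hz
      omega
    have z1 : z ≠ u1 := by rintro rfl; omega
    have z2 : z ≠ u2 := by rintro rfl; omega
    refine ⟨dz, ?_⟩
    have st : ∀ {g w}, Miss f x1 g → x1 ≠ w → z ≠ w → R f g γ x1 w → ¬ Miss f z g := by
      intro g w m n1 n2 hR hm
      rcases hR.swap.stub h.pc m hz hm with h1 | h1
      · exact n1 h1
      · exact n2 h1
    have q : ¬ Miss f z o ∧ ¬ Miss f z t := by
      rcases ab g1 g2 with ⟨k1, k2, -⟩ | ⟨k1, k2, -⟩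
      · exact ⟨st h.mx1 h.x1u1 z1 k1, st a2 n12 z2 k2⟩
      · exact ⟨st h.mx1 n12 z2 k1, st a2 h.x1u1 z1 k2⟩
    have q3 : ¬ Miss f z γ := fun hm => hm x1 (by rw [h.pc.symm]; exact hz)
    intro g hg
    have := four ((h.le z).trans dz) q.1 q.2 q3 hg
    have := h.ot
    grind
  obtain ⟨z, hz⟩ := not_miss.1 (h.swap.lx2 a3 a1)
  obtain ⟨z', hz'⟩ := not_miss.1 (h.swap.lx2 e2 e1)
  obtain ⟨dz, pz⟩ := p α z a1 a3 hz
  obtain ⟨dz', pz'⟩ := p β z' e1 e2 hz'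
  have z1 : z ≠ u1 := by rintro rfl; omega
  have z2 : z ≠ u2 := by rintro rfl; omega
  have z3 : z ≠ x1 := by rintro rfl; omega
  have z4 : z ≠ x2 := by rintro rfl; omega
  have zz' : z ≠ z' := by
    rintro rfl
    rw [hz] at hz'
    exact e3 (Option.some.inj hz').symm
  have mz : Miss f z β := by
    by_contra hn
    have := pz β hn
    tauto
  have mz' : Miss f z' α := by
    by_contra hn
    have := pz' α hn
    have := e3.symm
    tauto
  have pc' := swp_PC h.pc zz' hz hz' mz mz' (by
    intro g w ga gb hw hg
    rcases pz g hg with k | k | k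
    · exact absurd k ga
    · exact absurd (k ▸ hw) (h.mx1 w)
    · exact absurd (k ▸ hw) (a2 w)) (by
    intro g w ga gb hw hg
    rcases pz' g hg with k | k | k
    · exact absurd k gb
    · exact absurd (k ▸ hw) (h.mx1 w)
    · exact absurd (k ▸ hw) (a2 w))
  have C' := h.toCfg.swp hz hz' pc'
  have mm : ∀ {v g}, g ≠ α → g ≠ β → Miss f v g → Miss (swp f x1 z z' α β) v g := by
    intro v g ga gb hm w hw
    have := hm w
    simp only [swp, upd] at hw
    grind
  have mo : ∀ {v}, Miss f v o → Miss (swp f x1 z z' α β) v o := mm a1.symm e1.symm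
  have mt : ∀ {v}, Miss f v t → Miss (swp f x1 z z' α β) v t := mm a3.symm e2.symm
  have mz2 : Miss (swp f x1 z z' α β) z α := by
    intro w hw
    have h1 := h.pc.prop z w x1 α
    have h2 := h.pc.symm z x1
    simp only [swp, upd] at hw
    grind
  have ab' := C'.AB h.ot h.x1u1 n12 n21 h.x2u2 (mo h.mx1) (mt a2) (mo b1) (mt h.mx2) (mo h.mu1) (mt c2) (mo d1)
    (mt h.mu2) a1 a3
  have fin : ∀ {p w}, Miss f p o → Miss f w o → p ≠ w → z ≠ p → z ≠ w → x1 ≠ w → R f o α x1 w →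
      ¬ R (swp f x1 z z' α β) o α p w := by
    intro p w m1 m2 n1 n2 n3 n4 h1 h2
    have h3 : R (swp f x1 z z' α β) α o z w := swp_R h.pc hz h.mx1 n4 h1.swap
    exact key pc' (Or.inr mz2) (Or.inl (mo m1)) (Or.inl (mo m2)) n2 n3 n1 (h3.swap.trans h2.symm) h3.swap
  rcases ab a1 a3 with ⟨k1, -, -⟩ | ⟨k1, -, -⟩ <;> rcases ab' with ⟨l1, -, l2⟩ | ⟨l1, -, l2⟩
  · exact fin h.mx1 h.mu1 h.x1u1 z3 z1 h.x1u1 k1 l1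
  · exact fin b1 h.mu1 n21 z4 z1 h.x1u1 k1 l2
  · exact fin b1 d1 h.x2u2 z4 z2 n12 k1 l2
  · exact fin h.mx1 d1 n12 z3 z2 n12 k1 l1

/-- Case II. -/
lemma case_II (h : PC f) {dg : V → ℕ} {a b c d : K} (hxy : x ≠ y) (x12 : x1 ≠ x2) (u12 : u1 ≠ u2)
    (hx1 : f x x1 = some a) (hx2 : f x x2 = some b) (hx : ∀ w g, f x w = some g → w = x1 ∨ w = x2)
    (hu1 : f y u1 = some c) (hu2 : f y u2 = some d) (hy : ∀ w g, f y w = some g → w = u1 ∨ w = u2)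
    (hfxy : f x y = none) (hB : Blk f x y)
    (le : ∀ v, v ≠ x → v ≠ y → (Cs f v).card ≤ dg v)
    (dn : ∀ v, dg v + 1 ≤ Fintype.card K)
    (sp : ∀ v z g, f v z = some g → dg v ≤ 3 ∨ dg z ≤ 3)
    (n5 : 5 ≤ Fintype.card K) : False := by
  have sy := h.symm
  have pr := h.prop
  have lp := h.loop
  have hfyx : f y x = none := by rw [sy]; exact hfxy
  have hab : a ≠ b := by rintro rfl; exact x12 (pr _ _ _ _ hx1 hx2)
  have hcd : c ≠ d := by rintro rfl; exact u12 (pr _ _ _ _ hu1 hu2)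
  obtain ⟨f0, hf0⟩ : ∃ f0 : V → V → Option K, f0 = fun p q =>
    if p = x ∨ p = y ∨ q = x ∨ q = y then none else f p q := ⟨_, rfl⟩
  have le0 : ∀ p q g, f0 p q = some g → f p q = some g := by
    intro p q g
    rw [hf0]
    dsimp only
    split_ifs <;> simp
  have pc0 : PC f0 := by
    refine h.of_le ?_ le0
    intro p q
    simp only [hf0, sy p q]
    clear * -
    grind
  have xx1 : x ≠ x1 := by rintro rfl; simp [lp] at hx1
  have xx2 : x ≠ x2 := by rintro rfl; simp [lp] at hx2
  have yu1 : y ≠ u1 := by rintro rfl; simp [lp] at hu1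
  have yu2 : y ≠ u2 := by rintro rfl; simp [lp] at hu2
  have yx1 : y ≠ x1 := by rintro rfl; simp [hfxy] at hx1
  have yx2 : y ≠ x2 := by rintro rfl; simp [hfxy] at hx2
  have xu1 : x ≠ u1 := by rintro rfl; simp [hfyx] at hu1
  have xu2 : x ≠ u2 := by rintro rfl; simp [hfyx] at hu2
  have ix : ∀ w, f0 x w = none := by intro w; simp [hf0]
  have iy : ∀ w, f0 y w = none := by intro w; simp [hf0]
  have ix' : ∀ w, f0 w x = none := by intro w; simp [hf0]
  have iy' : ∀ w, f0 w y = none := by intro w; simp [hf0]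
  have hext : ext4 f0 x y x1 x2 u1 u2 a b c d = f := by
    funext p q
    have s1 := sy p q
    have s2 := sy x x1
    have s3 := sy x x2
    have s4 := sy y u1
    have s5 := sy y u2
    have A : ∀ w, w ≠ x1 → w ≠ x2 → f x w = none := by
      intro w h1 h2
      by_contra hn
      obtain ⟨g, hg⟩ := Option.ne_none_iff_exists'.1 hn
      have := hx w g hg
      tauto
    have B : ∀ w, w ≠ u1 → w ≠ u2 → f y w = none := by
      intro w h1 h2
      by_contra hn
      obtain ⟨g, hg⟩ := Option.ne_none_iff_exists'.1 hn
      have := hy w g hg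
      tauto
    have A1 := A p
    have A2 := A q
    have B1 := B p
    have B2 := B q
    simp only [ext4, upd, hf0]
    clear A B hx hy le dn sp n5 ix iy ix' iy' le0 pc0 hf0 hB pr lp sy h
    split_ifs with k1 k2 k3 k4 k5
    · grind
    · grind
    · grind
    · grind
    · rcases k5 with rfl | rfl | rfl | rfl <;> grind
    · rfl
  have pc4 : PC (ext4 f0 x y x1 x2 u1 u2 a b c d) := hext ▸ h
  have cf : Cfg f f0 x y x1 x2 u1 u2 :=
    { pc := pc0, xy := hxy, x12 := x12, u12 := u12, xx1 := xx1, xx2 := xx2, xu1 := xu1, xu2 := xu2,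
      yx1 := yx1, yx2 := yx2, yu1 := yu1, yu2 := yu2, ix := ix, iy := iy, hB := hB
      hS := by
        intro p q
        rw [← hext]
        simp only [ext4, upd]
        clear * -
        split_ifs <;> grind }
  have mle : ∀ {v g}, Miss f v g → Miss f0 v g := fun hm w hw => hm w (le0 _ _ _ hw)
  have sub : ∀ v, Cs f0 v ⊆ Cs f v := by
    intro v g hg
    rw [mem_Cs] at hg ⊢
    exact fun hm => hg (mle hm)
  have mis : ∀ {w v g}, f w v = some g → (w = x ∨ w = y) → Miss f0 v g ∧ g ∈ Cs f v := by
    intro w v g hw hwxy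
    constructor
    · intro q hq
      have : q = w := pr v q w g (le0 _ _ _ hq) (by rw [sy]; exact hw)
      rcases hwxy with k | k
      · rw [this, k, ix'] at hq; cases hq
      · rw [this, k, iy'] at hq; cases hq
    · rw [mem_Cs]
      exact fun hm => hm w (by rw [sy]; exact hw)
  have m1 := mis hx1 (Or.inl rfl)
  have m2 := mis hx2 (Or.inl rfl)
  have m3 := mis hu1 (Or.inr rfl)
  have m4 := mis hu2 (Or.inr rfl)
  have card1 : ∀ {v g}, Miss f0 v g ∧ g ∈ Cs f v → (Cs f0 v).card + 1 ≤ (Cs f v).card := by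
    intro v g hg
    have : Cs f0 v ⊂ Cs f v := by
      refine Finset.ssubset_iff_subset_ne.2 ⟨sub v, ?_⟩
      intro k
      rw [← k, mem_Cs] at hg
      exact hg.2 hg.1
    exact Finset.card_lt_card this
  have card2 : ∀ {v g g'}, g ≠ g' → Miss f0 v g ∧ g ∈ Cs f v → Miss f0 v g' ∧ g' ∈ Cs f v →
      (Cs f0 v).card + 2 ≤ (Cs f v).card := by
    intro v g g' hgg hg hg'
    have h1 : insert g (insert g' (Cs f0 v)) ⊆ Cs f v := by
      intro k hk
      simp only [Finset.mem_insert] at hk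
      rcases hk with rfl | rfl | hk
      · exact hg.2
      · exact hg'.2
      · exact sub v hk
    have h2 := Finset.card_le_card h1
    rw [Finset.card_insert_of_notMem, Finset.card_insert_of_notMem] at h2
    · exact h2
    · rw [mem_Cs]; exact fun k => k hg'.1
    · rw [Finset.mem_insert, mem_Cs]
      rintro (k | k)
      · exact hgg k
      · exact k hg.1
  have ne' : ∀ {v g g'}, f x v = some g → f y v = some g' → g ≠ g' := by
    rintro v g g' h1 h2 rfl
    exact hxy (pr v x y g (by rw [sy]; exact h1) (by rw [sy]; exact h2))
  have si : Sit f f0 dg x y x1 x2 u1 u2 :=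
    { cf with
      le := by
        intro v
        by_cases h1 : v = x
        · have : Cs f0 v = ∅ := by
            rw [Finset.eq_empty_iff_forall_notMem]
            intro g hg
            rw [mem_Cs] at hg
            exact hg (fun w hw => by rw [h1, ix] at hw; cases hw)
          simp [this]
        · by_cases h2 : v = y
          · have : Cs f0 v = ∅ := by
              rw [Finset.eq_empty_iff_forall_notMem]
              intro g hg
              rw [mem_Cs] at hg
              exact hg (fun w hw => by rw [h2, iy] at hw; cases hw)
            simp [this]
          · exact (Finset.card_le_card (sub v)).trans (le v h1 h2)
      dn := dn
      sp := fun v z g hg => sp v z g (le0 _ _ _ hg)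
      n5 := n5
      tm := by
        rintro v (rfl | rfl | rfl | rfl)
        · exact (card1 m1).trans (le _ xx1.symm yx1.symm)
        · exact (card1 m2).trans (le _ xx2.symm yx2.symm)
        · exact (card1 m3).trans (le _ xu1.symm yu1.symm)
        · exact (card1 m4).trans (le _ xu2.symm yu2.symm)
      co := by
        rintro v (rfl | rfl) (rfl | rfl)
        · exact (card2 (ne' hx1 hu1) m1 m3).trans (le _ xx1.symm yx1.symm)
        · exact (card2 (ne' hx1 hu2) m1 m4).trans (le _ xx1.symm yx1.symm)
        · exact (card2 (ne' hx2 hu1) m2 m3).trans (le _ xx2.symm yx2.symm)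
        · exact (card2 (ne' hx2 hu2) m2 m4).trans (le _ xx2.symm yx2.symm) }
  have r12 : ¬ R f0 a b x1 x2 := not_R_of_path h hab x12 hx1 hx2 ix ix' le0
  have r34 : ¬ R f0 c d u1 u2 := not_R_of_path h hcd u12 hu1 hu2 iy iy' le0
  have bk := fun e => @Cfg.blk _ _ _ _ _ _ _ _ _ _ _ _ _ _ _ _ cf pc4 e
  have n11 : a = c → x1 ≠ u1 := by rintro k rfl; exact ne' hx1 hu1 k
  have n12 : a = d → x1 ≠ u2 := by rintro k rfl; exact ne' hx1 hu2 k
  have n21 : b = c → x2 ≠ u1 := by rintro k rfl; exact ne' hx2 hu1 k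
  have n22 : b = d → x2 ≠ u2 := by rintro k rfl; exact ne' hx2 hu2 k
  have one : ∀ {x1 x2 u1 u2 : V} {a b c d : K}, Sit f f0 dg x y x1 x2 u1 u2 → Miss f0 x1 a → Miss f0 x2 b →
      Miss f0 u1 c → Miss f0 u2 d → a = c → a ≠ b → c ≠ d → b ≠ d → x1 ≠ u1 → ¬ R f0 a b x1 x2 →
      ¬ R f0 c d u1 u2 → False := by
    intro x1 x2 u1 u2 a b c d si h1 h2 h3 h4 e1 e2 e3 e4 e5 e6 e7
    subst e1
    exact One.done (t := b) (s := d) { si with mx1 := h1, mx2 := h2, mu1 := h3, mu2 := h4, ot := e2, os := e3, ts := e4, x1u1 := e5, r12 := e6, r13 := e7 }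
  have r12' : ¬ R f0 b a x2 x1 := fun k => r12 k.symm.swap
  have r34' : ¬ R f0 d c u2 u1 := fun k => r34 k.symm.swap
  by_cases e11 : a = c
  · by_cases e22 : b = d
    · subst e11 e22
      refine Two.done (o := a) (t := b) { si with mx1 := m1.1, mx2 := m2.1, mu1 := m3.1, mu2 := m4.1, ot := hab, x1u1 := n11 rfl, x2u2 := n22 rfl, r12 := r12, r13 := r34, hR := ?_ }
      intro α h1 h2
      rcases bk α h1 h2 h1 h2 with k | k | k | k
      · exact Or.inl k.2
      · exact absurd k.1 hab
      · exact absurd k.1.symm hab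
      · exact Or.inr k.2
    · exact one si m1.1 m2.1 m3.1 m4.1 e11 hab hcd e22 (n11 e11) r12 r34
  · by_cases e12 : a = d
    · by_cases e21 : b = c
      · subst e12 e21
        refine Two.done (o := a) (t := b) { si.swapu with mx1 := m1.1, mx2 := m2.1, mu1 := m4.1, mu2 := m3.1, ot := hab, x1u1 := n12 rfl, x2u2 := n21 rfl, r12 := r12, r13 := r34', hR := ?_ }
        intro α h1 h2
        rcases bk α h1 h2 h2 h1 with k | k | k | k
        · exact absurd k.1 hab
        · exact Or.inl k.2
        · exact Or.inr k.2
        · exact absurd k.1.symm hab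
      · exact one si.swapu m1.1 m2.1 m4.1 m3.1 e12 hab hcd.symm e21 (n12 e12) r12 r34'
    · by_cases e21 : b = c
      · exact one si.swapx m2.1 m1.1 m3.1 m4.1 e21 hab.symm hcd e12 (n21 e21) r12' r34
      · by_cases e22 : b = d
        · exact one si.swapx.swapu m2.1 m1.1 m4.1 m3.1 e22 hab.symm hcd.symm e11 (n22 e22) r12' r34'
        · obtain ⟨e, h1, h2, h3, h4⟩ := si.fresh a b c d
          rcases bk e h1 h2 h3 h4 with k | k | k | k
          · exact e11 k.1
          · exact e12 k.1
          · exact e21 k.1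
          · exact e22 k.1

end
end AEC

namespace AEC

open Classical in
/-- Degree of a vertex. -/
noncomputable def dgr {V : Type*} [Fintype V] (G : SimpleGraph V) (v : V) : ℕ :=
  (Finset.univ.filter (fun w => G.Adj v w)).card

/-- Every nontrivial component has a light edge. -/
def Light {V : Type*} [Fintype V] (G : SimpleGraph V) (k : ℕ) : Prop :=
  ∀ v w, G.Adj v w → ∃ a b, G.Reachable v a ∧ G.Adj a b ∧ dgr G a + dgr G b ≤ k + 2

section
variable {V : Type*} [Fintype V] {G : SimpleGraph V}

lemma dgr_mono {G' : SimpleGraph V} (h : G' ≤ G) (v : V) : dgr G' v ≤ dgr G v := by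
  classical
  refine Finset.card_le_card ?_
  intro w hw
  simp only [Finset.mem_filter, Finset.mem_univ, true_and] at hw ⊢
  exact h hw

lemma dgr_lt {G' : SimpleGraph V} (h : G' ≤ G) {v w : V} (h1 : G.Adj v w) (h2 : ¬ G'.Adj v w) :
    dgr G' v + 1 ≤ dgr G v := by
  classical
  refine Finset.card_lt_card ?_
  refine Finset.ssubset_iff_subset_ne.2 ⟨?_, ?_⟩
  · intro w hw
    simp only [Finset.mem_filter, Finset.mem_univ, true_and] at hw ⊢
    exact h hw
  · intro k
    have : w ∈ Finset.univ.filter (fun w => G.Adj v w) := by simpa using h1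
    rw [← k] at this
    simp only [Finset.mem_filter, Finset.mem_univ, true_and] at this
    exact h2 this

lemma dgr_pos {v w : V} (h : G.Adj v w) : 1 ≤ dgr G v := by
  classical
  exact Finset.card_pos.2 ⟨w, by simpa using h⟩

lemma Cs_le_dgr {K : Type*} [Fintype K] {f : V → V → Option K}
    (hf : ∀ u v, (f u v).isSome ↔ G.Adj u v) (v : V) : (Cs f v).card ≤ dgr G v := by
  classical
  refine Cs_card_le v _ ?_
  intro w a hw
  simp only [Finset.mem_filter, Finset.mem_univ, true_and]
  rw [← hf, hw]; rfl

lemma light_del {k : ℕ} {G' : SimpleGraph V} {x y : V} (hxy : G.Adj x y)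
    (hG' : ∀ p q, G'.Adj p q ↔ G.Adj p q ∧ ¬ ((p = x ∧ q = y) ∨ (p = y ∧ q = x)))
    (hsum : ∀ p q, G.Adj p q → dgr G p + dgr G q ≤ k + 3) (hL : Light G k) : Light G' k := by
  have hle : G' ≤ G := fun p q h => ((hG' p q).1 h).1
  have hr : ∀ {v a}, G.Reachable v a → G'.Reachable v a ∨ G'.Reachable v x ∨ G'.Reachable v y := by
    rintro v a ⟨W⟩
    induction W with
    | nil => exact Or.inl (SimpleGraph.Reachable.refl _)
    | cons k W ih =>
      rename_i u w v
      by_cases h1 : G'.Adj u w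
      · have h2 := h1.reachable
        exact ih.imp h2.trans (Or.imp h2.trans h2.trans)
      · rw [hG'] at h1
        have : (u = x ∧ w = y) ∨ (u = y ∧ w = x) := by tauto
        rcases this with h2 | h2
        · rw [h2.1]; exact Or.inr (Or.inl (SimpleGraph.Reachable.refl _))
        · rw [h2.1]; exact Or.inr (Or.inr (SimpleGraph.Reachable.refl _))
  have hnb : ∀ {v w a}, G'.Adj v w → G'.Reachable v a → ∃ z, G'.Adj a z := by
    rintro v w a h1 h2
    obtain ⟨W⟩ := h2.symm
    cases W with
    | nil => exact ⟨w, h1⟩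
    | cons h p => exact ⟨_, h⟩
  have dx : dgr G' x + 1 ≤ dgr G x := dgr_lt hle hxy (by rw [hG']; tauto)
  have dy : dgr G' y + 1 ≤ dgr G y := dgr_lt hle hxy.symm (by rw [hG']; tauto)
  intro v w hvw
  have hx : ∀ s, s = x ∨ s = y → G'.Reachable v s → 
      ∃ a b, G'.Reachable v a ∧ G'.Adj a b ∧ dgr G' a + dgr G' b ≤ k + 2 := by
    intro s hs hvs
    obtain ⟨z, hz⟩ := hnb hvw hvs
    refine ⟨s, z, hvs, hz, ?_⟩
    have h1 := hsum s z (hle hz)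
    have h2 := dgr_mono hle z
    rcases hs with rfl | rfl <;> omega
  obtain ⟨a, b, h1, h2, h3⟩ := hL v w (hle hvw)
  rcases hr h1 with h4 | h4 | h4
  · by_cases hab : G'.Adj a b
    · refine ⟨a, b, h4, hab, ?_⟩
      have := dgr_mono hle a
      have := dgr_mono hle b
      omega
    · rw [hG'] at hab
      refine hx a ?_ h4
      tauto
  · exact hx x (Or.inl rfl) h4
  · exact hx y (Or.inr rfl) h4

theorem main_ind (k : ℕ) : ∀ (m : ℕ) (G : SimpleGraph V), ∑ v, dgr G v ≤ m → (∀ v, dgr G v ≤ k) →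
    (∀ p q, G.Adj p q → dgr G p ≤ 3 ∨ dgr G q ≤ 3) → Light G k →
    ∃ f : V → V → Option (Fin (k + 1)), PC f ∧ ∀ u v, (f u v).isSome ↔ G.Adj u v := by
  classical
  intro m
  induction m with
  | zero =>
    intro G hm _ _ _
    refine ⟨fun _ _ => none, ⟨by simp, by simp, by simp, ?_⟩, ?_⟩
    · intro a b _ v c hc
      cases c with
      | nil => simp at hc
      | cons h p => simp [bi] at h
    · intro u v
      simp only [Option.isSome_none, Bool.false_eq_true, false_iff]
      intro huv
      have h1 := dgr_pos huv
      have h2 : dgr G u ≤ ∑ v, dgr G v := Finset.single_le_sum (f := fun v => dgr G v) (fun _ _ => Nat.zero_le _) (Finset.mem_univ u)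
      omega
  | succ m ih =>
    intro G hm hk hs hL
    by_cases hne : ∃ p q, G.Adj p q
    swap
    · push Not at hne
      refine ih G ?_ hk hs hL
      have : ∀ v, dgr G v = 0 := by
        intro v
        simp [dgr, hne]
      simp [this]
    obtain ⟨x, y, hxy, hd, hle⟩ : ∃ x y, G.Adj x y ∧ dgr G x + dgr G y ≤ k + 2 ∧ dgr G x ≤ dgr G y := by
      obtain ⟨p, q, hpq⟩ := hne
      obtain ⟨a, b, -, h1, h2⟩ := hL p q hpq
      rcases le_total (dgr G a) (dgr G b) with h | h
      · exact ⟨a, b, h1, h2, h⟩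
      · exact ⟨b, a, h1.symm, by omega, h⟩
    have hsum : ∀ p q, G.Adj p q → dgr G p + dgr G q ≤ k + 3 := by
      intro p q hpq
      have := hs p q hpq
      have := hk p
      have := hk q
      omega
    obtain ⟨G', hG'e⟩ : ∃ G' : SimpleGraph V, G' = G.deleteEdges {s(x, y)} := ⟨_, rfl⟩
    have hG' : ∀ p q, G'.Adj p q ↔ G.Adj p q ∧ ¬ ((p = x ∧ q = y) ∨ (p = y ∧ q = x)) := by
      intro p q
      rw [hG'e, SimpleGraph.deleteEdges_adj, Set.mem_singleton_iff, Sym2.eq_iff]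
    have hGle : G' ≤ G := fun p q h => ((hG' p q).1 h).1
    have mono := dgr_mono hGle
    have dx : dgr G' x + 1 ≤ dgr G x := dgr_lt hGle hxy (by rw [hG']; tauto)
    have dy : dgr G' y + 1 ≤ dgr G y := dgr_lt hGle hxy.symm (by rw [hG']; tauto)
    have hsum' : ∑ v, dgr G' v < ∑ v, dgr G v :=
      Finset.sum_lt_sum (fun v _ => mono v) ⟨x, Finset.mem_univ x, dx⟩
    obtain ⟨f, pc, hf⟩ := ih G' (by omega) (fun v => (mono v).trans (hk v)) (by
      intro p q hpq
      have := hs p q (hGle hpq)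
      have := mono p
      have := mono q
      omega) (light_del hxy hG' hsum hL)
    by_contra hcon
    have hxy' : x ≠ y := hxy.ne
    have adj : ∀ {p q a}, f p q = some a → G'.Adj p q := by
      intro p q a h
      rw [← hf, h]; rfl
    have nadj : ∀ {p q}, ¬ G'.Adj p q → f p q = none := by
      intro p q h
      rw [← hf] at h
      simpa using h
    have hfxy : f x y = none := nadj (by rw [hG']; tauto)
    have hB : Blk f x y := by
      intro f' pc' ss e h1 h2
      by_contra hn
      push Not at hn
      refine hcon ⟨upd f' x y (some e), pc'.add hxy' h1 h2 ?_, ?_⟩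
      · intro g hg h3 h4 hR
        exact hn g hg h3 h4 hR.swap
      · intro u v
        have e1 := ss u v
        have e2 := hf u v
        have e3 := hG' u v
        have e4 := hxy.symm
        simp only [upd]
        split_ifs with hc
        · simp only [Option.isSome_some, true_iff]
          rcases hc with ⟨rfl, rfl⟩ | ⟨rfl, rfl⟩
          · exact hxy
          · exact e4
        · rw [e1, e2, e3]
          tauto
    have cs := Cs_le_dgr hf
    have cK : Fintype.card (Fin (k + 1)) = k + 1 := Fintype.card_fin _
    have csx := cs x
    have csy := cs y
    have hx3 : dgr G x ≤ 3 := by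
      have := hs x y hxy
      omega
    have hky := hk y
    have nbx : ∀ w, w ∈ Finset.univ.filter (fun w => G'.Adj x w) ↔ G'.Adj x w := by simp
    have nby : ∀ w, w ∈ Finset.univ.filter (fun w => G'.Adj y w) ↔ G'.Adj y w := by simp
    have dfx : dgr G x = dgr G' x + 1 := by
      refine le_antisymm ?_ dx
      have : Finset.univ.filter (fun w => G.Adj x w) ⊆ insert y (Finset.univ.filter (fun w => G'.Adj x w)) := by
        intro w hw
        simp only [Finset.mem_filter, Finset.mem_univ, true_and, Finset.mem_insert, hG'] at hw ⊢
        have := hxy.ne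
        tauto
      exact (Finset.card_le_card this).trans (Finset.card_insert_le _ _)
    have dfy : dgr G y = dgr G' y + 1 := by
      refine le_antisymm ?_ dy
      have : Finset.univ.filter (fun w => G.Adj y w) ⊆ insert x (Finset.univ.filter (fun w => G'.Adj y w)) := by
        intro w hw
        simp only [Finset.mem_filter, Finset.mem_univ, true_and, Finset.mem_insert, hG'] at hw ⊢
        have := hxy.ne
        tauto
      exact (Finset.card_le_card this).trans (Finset.card_insert_le _ _)
    have csk : ∀ v, (Cs f v).card < Fintype.card (Fin (k + 1)) := by
      intro v
      have := cs v
      have := mono v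
      have := hk v
      omega
    have some_of : ∀ {p q}, G'.Adj p q → ∃ a, f p q = some a := by
      intro p q h
      rw [← hf] at h
      exact Option.isSome_iff_exists.1 h
    have h0 : dgr G' x = 0 ∨ dgr G' x = 1 ∨ dgr G' x = 2 := by omega
    rcases h0 with h0 | h0 | h0
    · obtain ⟨e, he, -⟩ := exists_miss (f := f) y ∅ (by simpa using csk y)
      have hx0 : ∀ a, Miss f x a := by
        intro a w hw
        have := dgr_pos (adj hw)
        omega
      obtain ⟨g, -, hg, -⟩ := hB f pc (SS.refl f) e (hx0 e) he
      exact hg (hx0 g)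
    · obtain ⟨x1, hx1⟩ := Finset.card_eq_one.1 h0
      have hx1' : G'.Adj x x1 := by rw [← nbx, hx1]; simp
      obtain ⟨c1, hc1⟩ := some_of hx1'
      refine case_two pc hxy' hc1 ?_ hfxy hB (csk x1) (by omega) ?_
      · intro w a hw
        have := adj hw
        rw [← nbx, hx1] at this
        simpa using this
      · intro p a hp
        have h1 := hsum y p (hGle (adj hp))
        have h2 := cs p
        have h3 := mono p
        omega
    · obtain ⟨x1, x2, x12, hx12⟩ := Finset.card_eq_two.1 h0
      have hx1' : G'.Adj x x1 := by rw [← nbx, hx12]; simp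
      have hx2' : G'.Adj x x2 := by rw [← nbx, hx12]; simp
      obtain ⟨c1, hc1⟩ := some_of hx1'
      obtain ⟨c2, hc2⟩ := some_of hx2'
      have hxw : ∀ w a, f x w = some a → w = x1 ∨ w = x2 := by
        intro w a hw
        have := adj hw
        rw [← nbx, hx12] at this
        simpa using this
      by_cases hy4 : 4 ≤ dgr G y
      · refine case_I pc hxy' hc1 hc2 hxw hfxy hB (csk x1) (csk x2) (by omega) ?_ ?_
        · intro p a hp
          have h1 := hs y p (hGle (adj hp))
          have h2 := cs p
          have h3 := mono p
          omega
        · rintro rfl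
          exact x12 (pc.prop _ _ _ _ hc1 hc2)
      · have hy2 : dgr G' y = 2 := by omega
        obtain ⟨u1, u2, u12, hu12⟩ := Finset.card_eq_two.1 hy2
        have hu1' : G'.Adj y u1 := by rw [← nby, hu12]; simp
        have hu2' : G'.Adj y u2 := by rw [← nby, hu12]; simp
        obtain ⟨d1, hd1⟩ := some_of hu1'
        obtain ⟨d2, hd2⟩ := some_of hu2'
        have hyw : ∀ w a, f y w = some a → w = u1 ∨ w = u2 := by
          intro w a hw
          have := adj hw
          rw [← nby, hu12] at this
          simpa using this
        refine case_II pc (dg := dgr G) hxy' x12 u12 hc1 hc2 hxw hd1 hd2 hyw hfxy hB ?_ ?_ ?_ (by omega)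
        · intro v _ _
          exact (cs v).trans (mono v)
        · intro v
          have := hk v
          omega
        · intro v z g hg
          exact hs v z (hGle (adj hg))

end
end AEC

namespace AEC

lemma pick_two {k : ℕ} (hk : 1 ≤ k) (a b : ℕ) (hab : a ≠ b) :
    ∃ a' b' : Fin (k + 1), a' ≠ b' ∧ ∀ g : Fin (k + 1), g.val = a ∨ g.val = b → g = a' ∨ g = b' := by
  by_cases ha : a < k + 1
  · by_cases hb : b < k + 1
    · refine ⟨⟨a, ha⟩, ⟨b, hb⟩, by simpa using hab, ?_⟩
      rintro g (h | h)
      · exact Or.inl (Fin.ext h)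
      · exact Or.inr (Fin.ext h)
    · have : Nontrivial (Fin (k + 1)) := Fin.nontrivial_iff_two_le.2 (by omega)
      obtain ⟨c, hc⟩ := exists_ne (⟨a, ha⟩ : Fin (k + 1))
      refine ⟨⟨a, ha⟩, c, hc.symm, ?_⟩
      rintro g (h | h)
      · exact Or.inl (Fin.ext h)
      · have := g.2
        omega
  · have : Nontrivial (Fin (k + 1)) := Fin.nontrivial_iff_two_le.2 (by omega)
    obtain ⟨b0, hb0⟩ : ∃ b0 : Fin (k + 1), ∀ g : Fin (k + 1), g.val = b → g = b0 := by
      by_cases hb : b < k + 1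
      · exact ⟨⟨b, hb⟩, fun g h => Fin.ext h⟩
      · exact ⟨0, fun g h => by have := g.2; omega⟩
    obtain ⟨c, hc⟩ := exists_ne b0
    refine ⟨c, b0, hc, ?_⟩
    rintro g (h | h)
    · have := g.2
      omega
    · exact Or.inr (hb0 g h)

lemma hasAEC_of_PC {V : Type*} {G : SimpleGraph V} {k : ℕ} (hk : 1 ≤ k) {f : V → V → Option (Fin (k + 1))}
    (h : PC f) (hf : ∀ u v, (f u v).isSome ↔ G.Adj u v) : HasAEC G (k + 1) := by
  let c : Sym2 V → ℕ := Sym2.lift ⟨fun u v => (f u v).elim 0 Fin.val, fun u v => by dsimp only; rw [h.symm u v]⟩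
  have hc : ∀ u v, c s(u, v) = (f u v).elim 0 Fin.val := fun u v => rfl
  have hs : ∀ {u v}, G.Adj u v → ∃ a, f u v = some a ∧ c s(u, v) = a.val := by
    intro u v huv
    obtain ⟨a, ha⟩ := Option.isSome_iff_exists.1 ((hf u v).2 huv)
    exact ⟨a, ha, by rw [hc, ha]; rfl⟩
  refine ⟨c, ⟨?_, ?_⟩, ?_⟩
  · rintro e₁ h1 e₂ h2 hne ⟨x, hx1, hx2⟩ heq
    obtain ⟨p, rfl⟩ := Sym2.mem_iff_exists.1 hx1
    obtain ⟨q, rfl⟩ := Sym2.mem_iff_exists.1 hx2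
    obtain ⟨a, ha, ha'⟩ := hs ((SimpleGraph.mem_edgeSet _).1 h1)
    obtain ⟨b, hb, hb'⟩ := hs ((SimpleGraph.mem_edgeSet _).1 h2)
    have : a = b := Fin.ext (by rw [← ha', ← hb', heq])
    subst this
    exact hne (by rw [h.prop _ _ _ _ ha hb])
  · rintro v w hw ⟨a, b, hab, hcol⟩
    obtain ⟨a', b', hab', hg⟩ := pick_two hk a b hab
    have he : ∀ e ∈ w.edges, e ∈ (bi f a' b').edgeSet := by
      intro e hew
      have h1 := w.edges_subset_edgeSet hew
      have h2 := hcol e hew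
      induction e using Sym2.ind with
      | _ p q =>
        rw [SimpleGraph.mem_edgeSet] at h1 ⊢
        obtain ⟨g, hg1, hg2⟩ := hs h1
        rw [hg2] at h2
        rw [bi_adj h, hg1]
        rcases hg g h2 with rfl | rfl
        · exact Or.inl rfl
        · exact Or.inr rfl
    exact h.acyc a' b' hab' (w.transfer _ he) (hw.transfer he)
  · intro e he
    induction e using Sym2.ind with
    | _ p q =>
      obtain ⟨a, -, ha⟩ := hs ((SimpleGraph.mem_edgeSet _).1 he)
      rw [ha]
      exact a.2

end AEC

/-- If `G` is a connected 3-sparse graph with maximum degree `Δ` containing an edge `xy`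
with `d(x) + d(y) < Δ + 3`, then `G` admits an acyclic edge coloring with at most
`Δ + 1` colors. -/
theorem three_sparse_aci_le_maxDegree_add_one {V : Type*} [Fintype V] [DecidableEq V]
    (G : SimpleGraph V) [DecidableRel G.Adj]
    (hconn : G.Connected)
    (hsparse : ∀ u v : V, G.Adj u v → G.degree u ≤ 3 ∨ G.degree v ≤ 3)
    (x y : V) (hxy : G.Adj x y)
    (hdeg : G.degree x + G.degree y < G.maxDegree + 3) :
    HasAEC G (G.maxDegree + 1) := by
  have hd : ∀ v, AEC.dgr G v = G.degree v := by
    intro v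
    rw [← SimpleGraph.card_neighborFinset_eq_degree, SimpleGraph.neighborFinset_eq_filter]
    unfold AEC.dgr
    congr
  have h1 : 1 ≤ G.maxDegree := by
    have h2 := AEC.dgr_pos hxy
    rw [hd] at h2
    exact h2.trans (G.degree_le_maxDegree x)
  obtain ⟨f, pc, hf⟩ := AEC.main_ind G.maxDegree (∑ v, AEC.dgr G v) G le_rfl
    (fun v => by rw [hd]; exact G.degree_le_maxDegree v)
    (fun p q hpq => by rw [hd, hd]; exact hsparse p q hpq)
    (fun v w _ => ⟨x, y, hconn.preconnected v x, hxy, by rw [hd, hd]; omega⟩)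
  exact AEC.hasAEC_of_PC h1 pc hf
end

section
/- Every 3-sparse graph G with maximum degree Δ satisfies a'(G) ≤ Δ + 2, where a'(G) is the acyclic chromatic index. -/
namespace ThreeSparse

variable {V : Type*}

/-- The bichromatic subgraph. -/
def bi (G : SimpleGraph V) (c : Sym2 V → ℕ) (a b : ℕ) : SimpleGraph V where
  Adj x y := G.Adj x y ∧ (c s(x, y) = a ∨ c s(x, y) = b)
  symm := ⟨fun x y h => by rw [Sym2.eq_swap]; exact ⟨h.1.symm, h.2⟩⟩
  loopless := ⟨fun x h => G.loopless.irrefl x h.1⟩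

/-- Delete an edge. -/
def del (G : SimpleGraph V) (u v : V) : SimpleGraph V where
  Adj x y := G.Adj x y ∧ s(x, y) ≠ s(u, v)
  symm := ⟨fun x y h => by rw [Sym2.eq_swap]; exact ⟨h.1.symm, h.2⟩⟩
  loopless := ⟨fun x h => G.loopless.irrefl x h.1⟩

/-- A good colouring with `k` colours. -/
structure Good (G : SimpleGraph V) (c : Sym2 V → ℕ) (k : ℕ) : Prop where
  proper : ∀ x y z, G.Adj x y → G.Adj x z → c s(x, y) = c s(x, z) → y = z
  acyc : ∀ a b, a ≠ b → (bi G c a b).IsAcyclic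
  lt : ∀ x y, G.Adj x y → c s(x, y) < k

/-- `f` is seen at `v`. -/
def Sees (G : SimpleGraph V) (c : Sym2 V → ℕ) (v : V) (f : ℕ) : Prop :=
  ∃ w, G.Adj v w ∧ c s(v, w) = f

theorem Good.acyclicEC {G : SimpleGraph V} {c : Sym2 V → ℕ} {k : ℕ} (h : Good G c k) :
    HasAEC G k := by
  refine ⟨c, ⟨?_, ?_⟩, ?_⟩
  · rintro e₁ h₁ e₂ h₂ hne ⟨x, hx₁, hx₂⟩ hc
    obtain ⟨y, rfl⟩ := hx₁
    obtain ⟨z, rfl⟩ := hx₂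
    exact hne (by rw [h.proper x y z h₁ h₂ hc])
  · rintro v w hw ⟨a, b, hab, he⟩
    have hq : ∀ e ∈ w.edges, e ∈ (bi G c a b).edgeSet := by
      intro e hew
      have h1 := w.edges_subset_edgeSet hew
      have h2 := he e hew
      induction e with
      | _ x y => exact ⟨h1, h2⟩
    exact h.acyc a b hab _ (hw.transfer hq)
  · intro e he
    induction e with
    | _ x y => exact h.lt x y he

theorem Good.mono {G H : SimpleGraph V} {c : Sym2 V → ℕ} {k : ℕ} (h : Good G c k)
    (hle : ∀ x y, H.Adj x y → G.Adj x y) : Good H c k where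
  proper x y z hy hz := h.proper x y z (hle _ _ hy) (hle _ _ hz)
  acyc a b hab := by
    refine (h.acyc a b hab).anti ?_
    rintro x y ⟨h1, h2⟩
    exact ⟨hle _ _ h1, h2⟩
  lt x y hxy := h.lt x y (hle _ _ hxy)

theorem closed_reach {K : SimpleGraph V} (T : Set V) (hT : ∀ x ∈ T, ∀ y, K.Adj x y → y ∈ T)
    {x y : V} (hx : x ∈ T) (h : K.Reachable x y) : y ∈ T := by
  obtain ⟨p⟩ := h
  induction p with
  | nil => exact hx
  | cons hadj p ih => exact ih (hT _ hx _ hadj)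

theorem block {H : SimpleGraph V} {c : Sym2 V → ℕ} {k : ℕ} (h : Good H c k) {v v1 u : V}
    {f y : ℕ} (hf : ¬ Sees H c v f) (ha : H.Adj v v1) (hy : c s(v, v1) = y)
    (hf1 : ¬ Sees H c v1 f) (hr : (bi H c f y).Reachable v u) : u = v ∨ u = v1 := by
  refine closed_reach {x | x = v ∨ x = v1} ?_ (Or.inl rfl) hr
  rintro x (rfl | rfl) z ⟨hz, hc | hc⟩
  · exact absurd ⟨z, hz, hc⟩ hf
  · exact Or.inr (h.proper _ _ _ hz ha (hc.trans hy.symm))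
  · exact absurd ⟨z, hz, hc⟩ hf1
  · exact Or.inl (h.proper _ _ _ hz ha.symm (by rw [hc, ← hy, Sym2.eq_swap]))

theorem unseen_reach {H : SimpleGraph V} {c : Sym2 V → ℕ} {v u : V}
    {f y : ℕ} (hf : ¬ Sees H c v f) (hy : ¬ Sees H c v y)
    (hr : (bi H c f y).Reachable v u) : u = v := by
  refine closed_reach {x | x = v} ?_ rfl hr
  rintro x rfl z ⟨hz, hc | hc⟩
  · exact absurd ⟨z, hz, hc⟩ hf
  · exact absurd ⟨z, hz, hc⟩ hy

theorem bi_comm (H : SimpleGraph V) (c : Sym2 V → ℕ) (a b : ℕ) : bi H c a b = bi H c b a := by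
  ext x y
  simp only [bi]
  tauto

theorem path_closed {K : SimpleGraph V}
    (hd : ∀ x y₁ y₂ y₃, K.Adj x y₁ → K.Adj x y₂ → K.Adj x y₃ → y₁ = y₂ ∨ y₁ = y₃ ∨ y₂ = y₃)
    {v u : V} (p : K.Walk v u) (hp : p.IsPath)
    (hu : ∀ y₁ y₂, K.Adj u y₁ → K.Adj u y₂ → y₁ = y₂) :
    ∀ y ∈ p.support, y ≠ v → (∀ z, K.Adj y z → z ∈ p.support) ∧
      (y = u ∨ ∃ z₁ z₂, K.Adj y z₁ ∧ K.Adj y z₂ ∧ z₁ ≠ z₂) := by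
  induction p with
  | nil => intro y hy hne; simp at hy; exact absurd hy hne
  | @cons v v' u h p ih =>
    rw [SimpleGraph.Walk.cons_isPath_iff] at hp
    intro y hy hne
    rw [SimpleGraph.Walk.support_cons, List.mem_cons] at hy
    have hy' : y ∈ p.support := hy.resolve_left hne
    rw [SimpleGraph.Walk.support_cons]
    by_cases hyv : y = v'
    · subst hyv
      cases p with
      | nil =>
        refine ⟨fun z hz => ?_, Or.inl rfl⟩
        rw [hu z v hz h.symm]; simp
      | @cons _ v'' _ h' q =>
        have hv : v ≠ v'' := by
          rintro rfl
          apply hp.2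
          simp
        refine ⟨fun z hz => ?_, Or.inr ⟨v, v'', h.symm, h', hv⟩⟩
        rcases hd _ v v'' z h.symm h' hz with h1 | h1 | h1
        · exact absurd h1 hv
        · subst h1; simp
        · subst h1; simp
    · obtain ⟨h1, h2⟩ := ih hp.1 hu y hy' hyv
      exact ⟨fun z hz => List.mem_cons_of_mem _ (h1 z hz), h2⟩

theorem three_leaf {K : SimpleGraph V}
    (hd : ∀ x y₁ y₂ y₃, K.Adj x y₁ → K.Adj x y₂ → K.Adj x y₃ → y₁ = y₂ ∨ y₁ = y₃ ∨ y₂ = y₃)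
    {v u w : V} (hu : ∀ y₁ y₂, K.Adj u y₁ → K.Adj u y₂ → y₁ = y₂)
    (hv : ∀ y₁ y₂, K.Adj v y₁ → K.Adj v y₂ → y₁ = y₂)
    (hw : ∀ y₁ y₂, K.Adj w y₁ → K.Adj w y₂ → y₁ = y₂) (huv : v ≠ u)
    (h1 : K.Reachable v u) (h2 : K.Reachable v w) : w = v ∨ w = u := by
  obtain ⟨p, hp⟩ := h1.exists_isPath
  have key := path_closed hd p hp hu
  have hmem : w ∈ p.support := by
    refine closed_reach {x | x ∈ p.support} ?_ (p.start_mem_support) h2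
    intro x hx y hxy
    by_cases hxv : x = v
    · subst hxv
      cases p with
      | nil => exact absurd rfl huv
      | @cons _ v' _ h q =>
        have := hv y v' hxy h
        subst this
        simp
    · exact (key x hx hxv).1 y hxy
  by_cases hwv : w = v
  · exact Or.inl hwv
  · rcases (key w hmem hwv).2 with h | ⟨z₁, z₂, hz₁, hz₂, hne⟩
    · exact Or.inr h
    · exact absurd (hw _ _ hz₁ hz₂) hne

theorem three_leaf_col {H : SimpleGraph V} {c : Sym2 V → ℕ} {k : ℕ} (h : Good H c k)
    {v u w : V} {f a : ℕ} (hv : ¬ Sees H c v f) (hu : ¬ Sees H c u f) (hw : ¬ Sees H c w f)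
    (huv : v ≠ u) (h1 : (bi H c f a).Reachable v u) (h2 : (bi H c f a).Reachable v w) :
    w = v ∨ w = u := by
  have leaf : ∀ x, ¬ Sees H c x f → ∀ y₁ y₂, (bi H c f a).Adj x y₁ → (bi H c f a).Adj x y₂ →
      y₁ = y₂ := by
    rintro x hx y₁ y₂ ⟨hy₁, h₁ | h₁⟩ ⟨hy₂, h₂ | h₂⟩
    · exact absurd ⟨_, hy₁, h₁⟩ hx
    · exact absurd ⟨_, hy₁, h₁⟩ hx
    · exact absurd ⟨_, hy₂, h₂⟩ hx
    · exact h.proper _ _ _ hy₁ hy₂ (h₁.trans h₂.symm)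
  refine three_leaf ?_ (leaf u hu) (leaf v hv) (leaf w hw) huv h1 h2
  rintro x y₁ y₂ y₃ ⟨hy₁, h₁⟩ ⟨hy₂, h₂⟩ ⟨hy₃, h₃⟩
  have p12 := h.proper _ _ _ hy₁ hy₂
  have p13 := h.proper _ _ _ hy₁ hy₃
  have p23 := h.proper _ _ _ hy₂ hy₃
  grind

theorem Good.add [DecidableEq V] {G : SimpleGraph V} {c : Sym2 V → ℕ} {k : ℕ} {u v : V}
    (hG : G.Adj u v)
    (h : Good (del G u v) c k) {f : ℕ} (hf : f < k)
    (hfu : ¬ Sees (del G u v) c u f) (hfv : ¬ Sees (del G u v) c v f)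
    (hb : ∀ y, Sees (del G u v) c u y → Sees (del G u v) c v y →
      ¬ (bi (del G u v) c f y).Reachable v u) :
    Good G (Function.update c s(u, v) f) k := by
  have huv : u ≠ v := hG.ne
  have hacy : ∀ y, y ≠ f → (bi G (Function.update c s(u, v) f) f y).IsAcyclic := by
    intro y hy
    have hle : bi G (Function.update c s(u, v) f) f y ≤
        bi (del G u v) c f y ⊔ SimpleGraph.edge u v := by
      rintro x z ⟨hxz, hc⟩
      by_cases he : s(x, z) = s(u, v)
      · right
        rw [SimpleGraph.edge_adj]
        exact ⟨by simpa using he, hxz.ne⟩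
      · left
        rw [Function.update_of_ne he] at hc
        exact ⟨⟨hxz, he⟩, hc⟩
    refine SimpleGraph.IsAcyclic.anti hle ?_
    refine SimpleGraph.IsAcyclic.sup_edge_of_not_reachable ?_ (h.acyc f y hy.symm)
    intro hr
    by_cases h1 : Sees (del G u v) c u y
    · by_cases h2 : Sees (del G u v) c v y
      · exact hb y h1 h2 hr.symm
      · exact huv (unseen_reach hfv h2 hr.symm)
    · exact huv (unseen_reach hfu h1 hr).symm
  refine ⟨?_, ?_, ?_⟩
  · intro x y z hy hz hc
    by_cases h1 : s(x, y) = s(u, v)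
    · by_cases h2 : s(x, z) = s(u, v)
      · have := h1.trans h2.symm
        exact Sym2.congr_right.1 this
      · exfalso
        rw [h1, Function.update_self, Function.update_of_ne h2] at hc
        have hs : Sees (del G u v) c x f := ⟨z, ⟨hz, h2⟩, hc.symm⟩
        rcases Sym2.eq_iff.1 h1 with ⟨rfl, rfl⟩ | ⟨rfl, rfl⟩
        · exact hfu hs
        · exact hfv hs
    · by_cases h2 : s(x, z) = s(u, v)
      · exfalso
        rw [h2, Function.update_self, Function.update_of_ne h1] at hc
        have hs : Sees (del G u v) c x f := ⟨y, ⟨hy, h1⟩, hc⟩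
        rcases Sym2.eq_iff.1 h2 with ⟨rfl, rfl⟩ | ⟨rfl, rfl⟩
        · exact hfu hs
        · exact hfv hs
      · rw [Function.update_of_ne h1, Function.update_of_ne h2] at hc
        exact h.proper x y z ⟨hy, h1⟩ ⟨hz, h2⟩ hc
  · intro a b hab
    by_cases ha : a = f
    · subst ha; exact hacy b hab.symm
    · by_cases hb' : b = f
      · subst hb'; rw [bi_comm]; exact hacy a hab
      · refine (h.acyc a b hab).anti ?_
        rintro x z ⟨hxz, hc⟩
        by_cases he : s(x, z) = s(u, v)
        · rw [he, Function.update_self] at hc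
          rcases hc with hc | hc
          · exact absurd hc.symm ha
          · exact absurd hc.symm hb'
        · rw [Function.update_of_ne he] at hc
          exact ⟨⟨hxz, he⟩, hc⟩
  · intro x y hxy
    by_cases he : s(x, y) = s(u, v)
    · rw [he, Function.update_self]; exact hf
    · rw [Function.update_of_ne he]; exact h.lt x y ⟨hxy, he⟩

theorem del_good {G : SimpleGraph V} {c : Sym2 V → ℕ} {k : ℕ} (h : Good G c k) (u v : V) :
    Good (del G u v) c k := h.mono (fun _ _ hxy => hxy.1)

theorem recolor [DecidableEq V] {H : SimpleGraph V} {c : Sym2 V → ℕ} {k : ℕ} (h : Good H c k)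
    {v v1 : V} {a f : ℕ} (hadj : H.Adj v v1) (ha : c s(v, v1) = a) (hf : f < k)
    (hfv : ¬ Sees H c v f) (hf1 : ¬ Sees H c v1 f)
    (hd : ∀ y, Sees H c v1 y → Sees H c v y → y = a) :
    Good H (Function.update c s(v, v1) f) k := by
  refine (del_good h v v1).add hadj hf ?_ ?_ ?_
  · rintro ⟨z, hz, hc⟩; exact hfv ⟨z, hz.1, hc⟩
  · rintro ⟨z, hz, hc⟩; exact hf1 ⟨z, hz.1, hc⟩
  · rintro y ⟨z, hz, hc⟩ ⟨z', hz', hc'⟩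
    have hy := hd y ⟨z', hz'.1, hc'⟩ ⟨z, hz.1, hc⟩
    exfalso
    have := h.proper _ _ _ hz.1 hadj (by rw [hc, hy, ha])
    exact hz.2 (by rw [this])

theorem sees_recolor_other [DecidableEq V] {H : SimpleGraph V} {c : Sym2 V → ℕ} {v v1 z : V}
    {f g : ℕ} (hzv : z ≠ v) (hz1 : z ≠ v1) :
    Sees H (Function.update c s(v, v1) f) z g ↔ Sees H c z g := by
  unfold Sees
  refine exists_congr fun w => ?_
  have : s(z, w) ≠ s(v, v1) := by
    intro h
    rcases Sym2.eq_iff.1 h with ⟨h1, _⟩ | ⟨h1, _⟩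
    · exact hzv h1
    · exact hz1 h1
  rw [Function.update_of_ne this]

theorem sees_recolor_self [DecidableEq V] {H : SimpleGraph V} {c : Sym2 V → ℕ} {k : ℕ}
    (h : Good H c k) {v v1 : V}
    {a f g : ℕ} (hadj : H.Adj v v1) (ha : c s(v, v1) = a) :
    Sees H (Function.update c s(v, v1) f) v g ↔ g = f ∨ (Sees H c v g ∧ g ≠ a) := by
  constructor
  · rintro ⟨z, hz, hc⟩
    by_cases hz1 : z = v1
    · subst hz1
      rw [Function.update_self] at hc
      exact Or.inl hc.symm
    · have : s(v, z) ≠ s(v, v1) := fun h' => hz1 (Sym2.congr_right.1 h')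
      rw [Function.update_of_ne this] at hc
      refine Or.inr ⟨⟨z, hz, hc⟩, ?_⟩
      rintro rfl
      exact hz1 (h.proper _ _ _ hz hadj (by rw [hc, ha]))
  · rintro (rfl | ⟨⟨z, hz, hc⟩, hga⟩)
    · exact ⟨v1, hadj, Function.update_self ..⟩
    · refine ⟨z, hz, ?_⟩
      have : s(v, z) ≠ s(v, v1) := by
        intro h'
        apply hga
        rw [← hc, h', ha]
      rw [Function.update_of_ne this]
      exact hc

theorem core [DecidableEq V] {G : SimpleGraph V} {c : Sym2 V → ℕ} {k : ℕ} {u v v1 w : V}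
    {a b x f : ℕ}
    (hG : G.Adj u v) (hno : ¬ ∃ c, Good G c k) (h : Good (del G u v) c k)
    (hSu : ∀ g, Sees (del G u v) c u g → g = a ∨ g = b)
    (hbv : ¬ Sees (del G u v) c v b)
    (hv1 : (del G u v).Adj v v1) (ha : c s(v, v1) = a)
    (h1 : ∀ g, Sees (del G u v) c v1 g → Sees (del G u v) c v g → g = a)
    (hb1 : ¬ Sees (del G u v) c v1 b)
    (hfk : f < k) (hfv : ¬ Sees (del G u v) c v f)
    (hfc : f = b ∨ (¬ Sees (del G u v) c u f ∧ (bi (del G u v) c f a).Reachable v u))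
    (hw : (del G u v).Adj v w) (hx : c s(v, w) = x) (hxa : x ≠ a)
    (hfw : ¬ Sees (del G u v) c w f) :
    ∃ y w', Sees (del G u v) c w y ∧ y ≠ x ∧ y ≠ a ∧ (del G u v).Adj v w' ∧ c s(v, w') = y ∧
      Sees (del G u v) c w' f := by
  by_contra hcon
  apply hno
  have hnu : ∀ z, (del G u v).Adj v z → z ≠ u := by
    rintro z hz rfl
    exact hz.2 (Sym2.eq_swap)
  have huv : u ≠ v := hG.ne
  have hvx : Sees (del G u v) c v x := ⟨w, hw, hx⟩
  have hxb : x ≠ b := by rintro rfl; exact hbv hvx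
  have hfx : f ≠ x := by rintro rfl; exact hfv hvx
  have hwu : w ≠ u := hnu w hw
  have hwv : w ≠ v := hw.1.ne'
  have hv1u : v1 ≠ u := hnu v1 hv1
  have hv1w : v1 ≠ w := by rintro rfl; exact hxa (hx.symm.trans ha)
  have sub0 : ∀ p q, (del (del G v w) u v).Adj p q → (del G u v).Adj p q :=
    fun p q hpq => ⟨hpq.1.1, hpq.2⟩
  have sees0 : ∀ z g, Sees (del (del G v w) u v) c z g → Sees (del G u v) c z g := by
    rintro z g ⟨t, ht, hc⟩
    exact ⟨t, sub0 _ _ ht, hc⟩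
  have adj0 : ∀ z, (del G u v).Adj v z → z ≠ w → (del (del G v w) u v).Adj v z :=
    fun z hz hzw => ⟨⟨hz.1, fun h' => hzw (Sym2.congr_right.1 h')⟩, hz.2⟩
  have hv0x : ¬ Sees (del (del G v w) u v) c v x := by
    rintro ⟨z, hz, hc⟩
    have : z = w := h.proper _ _ _ (sub0 _ _ hz) hw (hc.trans hx.symm)
    exact hz.1.2 (by rw [this])
  have good0 : Good (del (del G v w) u v) c k := h.mono sub0
  have good1 : Good (del G v w) (Function.update c s(u, v) x) k := by
    have hadj1 : (del G v w).Adj u v := by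
      refine ⟨hG, ?_⟩
      intro h'
      rcases Sym2.eq_iff.1 h' with ⟨h', _⟩ | ⟨h', _⟩
      · exact huv h'
      · exact hwu h'.symm
    refine good0.add hadj1 (by rw [← hx]; exact h.lt _ _ hw) ?_ hv0x ?_
    · intro hs
      rcases hSu _ (sees0 _ _ hs) with h' | h'
      · exact hxa h'
      · exact hxb h'
    · intro y hyu hyv hr
      have hya : y = a := by
        rcases hSu _ (sees0 _ _ hyu) with h' | h'
        · exact h'
        · subst h'; exact absurd (sees0 _ _ hyv) hbv
      subst hya
      rcases block good0 hv0x (adj0 v1 hv1 hv1w) ha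
        (fun hs => hxa (h1 _ (sees0 _ _ hs) hvx)) hr with h' | h'
      · exact huv h'
      · exact hv1u h'.symm
  have sees1 : ∀ z g, g ≠ x → Sees (del G v w) (Function.update c s(u, v) x) z g →
      Sees (del G u v) c z g := by
    rintro z g hgx ⟨t, ht, hc⟩
    have hne : s(z, t) ≠ s(u, v) := by
      intro h'
      rw [h', Function.update_self] at hc
      exact hgx hc.symm
    rw [Function.update_of_ne hne] at hc
    exact ⟨t, ⟨ht.1, hne⟩, hc⟩
  have hfv1 : ¬ Sees (del G v w) (Function.update c s(u, v) x) v f :=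
    fun hs => hfv (sees1 _ _ hfx hs)
  refine ⟨_, good1.add hw.1 hfk hfv1 (fun hs => hfw (sees1 _ _ hfx hs)) ?_⟩
  intro y hyv hyw hr
  have hr := hr.symm
  have hyx : y ≠ x := by
    rintro rfl
    obtain ⟨z, hz, hc⟩ := hyw
    have hne : s(w, z) ≠ s(u, v) := by
      intro h'
      rcases Sym2.eq_iff.1 h' with ⟨h', _⟩ | ⟨h', _⟩
      · exact hwu h'
      · exact hwv h'
    rw [Function.update_of_ne hne] at hc
    have : z = v := h.proper w z v ⟨hz.1, hne⟩ hw.symm (by rw [hc, ← hx, Sym2.eq_swap])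
    subst this
    exact hz.2 Sym2.eq_swap
  obtain ⟨w', hw', hc'⟩ := sees1 _ _ hyx hyv
  have hsw := sees1 _ _ hyx hyw
  have hw'w : w' ≠ w := by rintro rfl; exact hyx (hc'.symm.trans hx)
  have hblock : ¬ Sees (del G u v) c w' f → False := by
    intro hns
    have hne : s(v, w') ≠ s(u, v) := hw'.2
    rcases block good1 hfv1 (adj0 w' hw' hw'w).1
      (by rw [Function.update_of_ne hne]; exact hc')
      (fun hs => hns (sees1 _ _ hfx hs)) hr with h' | h'
    · exact hwv h'
    · exact hw'w h'.symm
  by_cases hya : y = a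
  · subst hya
    have : w' = v1 := h.proper _ _ _ hw' hv1 (hc'.trans ha.symm)
    subst this
    rcases hfc with rfl | ⟨hfu, hreach⟩
    · exact hblock hb1
    · have hr' : (bi (del G u v) c f y).Reachable v w := by
        refine hr.mono ?_
        rintro p q ⟨hpq, hc⟩
        have hne : s(p, q) ≠ s(u, v) := by
          intro h'
          rw [h', Function.update_self] at hc
          rcases hc with hc | hc
          · exact hfx hc.symm
          · exact hyx hc.symm
        rw [Function.update_of_ne hne] at hc
        exact ⟨⟨hpq.1, hne⟩, hc⟩
      rcases three_leaf_col h hfv hfu hfw huv.symm hreach hr' with h' | h'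
      · exact hwv h'
      · exact hwu h'
  · apply hblock
    intro hs
    exact hcon ⟨y, w', hsw, hyx, hya, hw', hc', hs⟩

theorem blocked [DecidableEq V] {G : SimpleGraph V} {c : Sym2 V → ℕ} {k : ℕ} {u v : V} {f : ℕ}
    (hG : G.Adj u v) (hno : ¬ ∃ c, Good G c k) (h : Good (del G u v) c k) (hf : f < k)
    (hfu : ¬ Sees (del G u v) c u f) (hfv : ¬ Sees (del G u v) c v f) :
    ∃ y, Sees (del G u v) c u y ∧ (bi (del G u v) c f y).Reachable v u ∧
      ∃ v1, (del G u v).Adj v v1 ∧ c s(v, v1) = y ∧ Sees (del G u v) c v1 f := by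
  by_contra hcon
  apply hno
  refine ⟨_, h.add hG hf hfu hfv ?_⟩
  rintro y hyu ⟨v1, hv1, hc⟩ hr
  apply hcon
  refine ⟨y, hyu, hr, v1, hv1, hc, ?_⟩
  by_contra hns
  rcases block h hfv hv1 hc hns hr with h' | h'
  · exact hG.ne h'
  · subst h'
    exact hv1.2 Sym2.eq_swap

open Classical in
/-- Set of colours seen at a vertex. -/
noncomputable def S [Fintype V] (H : SimpleGraph V) (c : Sym2 V → ℕ) (v : V) : Finset ℕ :=
  (Finset.univ.filter (fun w => H.Adj v w)).image (fun w => c s(v, w))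

theorem mem_S [Fintype V] {H : SimpleGraph V} {c : Sym2 V → ℕ} {v : V} {f : ℕ} :
    f ∈ S H c v ↔ Sees H c v f := by
  simp [S, Sees]

theorem setup [Fintype V] [DecidableEq V] {G : SimpleGraph V} {c : Sym2 V → ℕ} {D : ℕ} {u v : V}
    {a b : ℕ} (hG : G.Adj u v) (hno : ¬ ∃ c, Good G c (D + 2)) (h : Good (del G u v) c (D + 2))
    (hdu : ∀ c, (S (del G u v) c u).card ≤ 2)
    (hdu' : ∀ c, (S (del G u v) c u).card + 1 ≤ D)
    (hdv : ∀ c, (S (del G u v) c v).card + 1 ≤ D)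
    (hdn : ∀ c w, (del G u v).Adj v w → (S (del G u v) c w).card ≤ 3)
    (hau : a ∈ S (del G u v) c u) (hav : a ∈ S (del G u v) c v)
    (hbu : b ∈ S (del G u v) c u) (hbv : b ∉ S (del G u v) c v) :
    ∃ C v1, C = Finset.range (D + 2) \ (insert b (S (del G u v) c v)) ∧ C.card = 2 ∧
      S (del G u v) c u = {a, b} ∧ b < D + 2 ∧
      (del G u v).Adj v v1 ∧ c s(v, v1) = a ∧ S (del G u v) c v1 = insert a C ∧
      (∃ x ∈ S (del G u v) c v, x ≠ a) ∧
      ∀ f ∈ insert b C, ∀ x w, (del G u v).Adj v w → c s(v, w) = x → x ≠ a →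
        f ∉ S (del G u v) c w →
        ∃ y w', y ∈ S (del G u v) c w ∧ y ≠ x ∧ y ≠ a ∧ (del G u v).Adj v w' ∧
          c s(v, w') = y ∧ f ∈ S (del G u v) c w' := by
  have hab : a ≠ b := by rintro rfl; exact hbv hav
  have hSu : S (del G u v) c u = {a, b} := by
    symm
    apply Finset.eq_of_subset_of_card_le
    · intro g hg
      simp only [Finset.mem_insert, Finset.mem_singleton] at hg
      rcases hg with rfl | rfl <;> assumption
    · rw [Finset.card_pair hab]; exact hdu c
  have hD : 3 ≤ D := by
    have := hdu' c
    rw [hSu, Finset.card_pair hab] at this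
    exact this
  have hSv : S (del G u v) c v ⊆ Finset.range (D + 2) := by
    intro g hg
    obtain ⟨w, hw, rfl⟩ := mem_S.1 hg
    exact Finset.mem_range.2 (h.lt _ _ hw)
  have hbk : b < D + 2 := by
    obtain ⟨w, hw, rfl⟩ := mem_S.1 hbu
    exact h.lt _ _ hw
  obtain ⟨v1, hv1, ha⟩ := mem_S.1 hav
  obtain ⟨C, hC⟩ : ∃ C, C = Finset.range (D + 2) \ (insert b (S (del G u v) c v)) := ⟨_, rfl⟩
  have hCmem : ∀ f, f ∈ C ↔ f < D + 2 ∧ f ≠ b ∧ f ∉ S (del G u v) c v := by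
    intro f
    rw [hC]; simp
  have hCcard : C.card + (S (del G u v) c v).card = D + 1 := by
    have h1 : insert b (S (del G u v) c v) ⊆ Finset.range (D + 2) :=
      Finset.insert_subset (Finset.mem_range.2 hbk) hSv
    have h2 := Finset.card_sdiff_add_card_eq_card h1
    rw [← hC, Finset.card_insert_of_notMem hbv, Finset.card_range] at h2
    omega
  have hCu : ∀ f ∈ C, f ∉ S (del G u v) c u := by
    intro f hf hfu
    rw [hCmem] at hf
    rw [hSu] at hfu
    simp only [Finset.mem_insert, Finset.mem_singleton] at hfu
    rcases hfu with rfl | rfl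
    · exact hf.2.2 hav
    · exact hf.2.1 rfl
  have haC : a ∉ C := fun h' => ((hCmem a).1 h').2.2 hav
  have hblk : ∀ f ∈ C, (bi (del G u v) c f a).Reachable v u ∧ f ∈ S (del G u v) c v1 := by
    intro f hf
    have hf' := (hCmem f).1 hf
    obtain ⟨y, hyu, hr, v2, hv2, hc2, hs⟩ := blocked hG hno h hf'.1
      (fun hs => hCu f hf (mem_S.2 hs)) (fun hs => hf'.2.2 (mem_S.2 hs))
    have hya : y = a := by
      have h1 := mem_S.2 hyu
      rw [hSu] at h1
      simp only [Finset.mem_insert, Finset.mem_singleton] at h1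
      rcases h1 with h1 | rfl
      · exact h1
      · exact absurd (mem_S.2 ⟨v2, hv2, hc2⟩) hbv
    subst hya
    have : v2 = v1 := h.proper _ _ _ hv2 hv1 (hc2.trans ha.symm)
    subst this
    exact ⟨hr, mem_S.2 hs⟩
  have hav1 : a ∈ S (del G u v) c v1 := mem_S.2 ⟨v, hv1.symm, by rw [Sym2.eq_swap]; exact ha⟩
  have hsub : insert a C ⊆ S (del G u v) c v1 :=
    Finset.insert_subset hav1 (fun f hf => (hblk f hf).2)
  have hc3 : (insert a C).card = C.card + 1 := Finset.card_insert_of_notMem haC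
  have h3 := hdn c v1 hv1
  have h4 := Finset.card_le_card hsub
  have h5 := hdv c
  have hC2 : C.card = 2 := by omega
  have hSv1 : S (del G u v) c v1 = insert a C :=
    (Finset.eq_of_subset_of_card_le hsub (by omega)).symm
  refine ⟨C, v1, hC, hC2, hSu, hbk, hv1, ha, hSv1, ?_, ?_⟩
  · have : 1 < (S (del G u v) c v).card := by omega
    exact Finset.exists_mem_ne this a
  · intro f hf x w hw hx hxa hfw
    have key := core (f := f) (w := w) (x := x) (a := a) (b := b) hG hno h
      (by
        intro g hg
        have := mem_S.2 hg
        rw [hSu] at this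
        simpa using this)
      (fun hs => hbv (mem_S.2 hs)) hv1 ha
      (by
        intro g hg1 hgv
        have := mem_S.2 hg1
        rw [hSv1, Finset.mem_insert] at this
        rcases this with h' | h'
        · exact h'
        · exact absurd (mem_S.2 hgv) ((hCmem g).1 h').2.2)
      (by
        intro hs
        have := mem_S.2 hs
        rw [hSv1, Finset.mem_insert] at this
        rcases this with h' | h'
        · exact hab h'.symm
        · exact ((hCmem b).1 h').2.1 rfl)
      (by
        rcases Finset.mem_insert.1 hf with rfl | hf
        · exact hbk
        · exact ((hCmem f).1 hf).1)
      (by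
        intro hs
        rcases Finset.mem_insert.1 hf with rfl | hf
        · exact hbv (mem_S.2 hs)
        · exact ((hCmem f).1 hf).2.2 (mem_S.2 hs))
      (by
        rcases Finset.mem_insert.1 hf with rfl | hf
        · exact Or.inl rfl
        · exact Or.inr ⟨fun hs => hCu f hf (mem_S.2 hs), (hblk f hf).1⟩)
      hw hx hxa (fun hs => hfw (mem_S.2 hs))
    obtain ⟨y, w', k1, k2, k3, k4, k5, k6⟩ := key
    exact ⟨y, w', mem_S.2 k1, k2, k3, k4, k5, mem_S.2 k6⟩

/-- The counting argument of the main case. -/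
theorem counting {X Q : Finset ℕ} (P : ℕ → Finset ℕ) (hX : X.Nonempty) (hQ : Q.card = 4)
    (hdis : ∀ q ∈ Q, q ∉ X) (hP : ∀ x ∈ X, (P x).card ≤ 2)
    (hb : ∀ x ∈ X, ∀ q ∈ Q, q ∈ P x ∨ ∃ y ∈ P x, y ∈ X ∧ q ∈ P y) : False := by
  have hsub : ∀ x ∈ X, P x ⊆ X := by
    intro x hx
    have h1 : Q ⊆ (P x \ X) ∪ (P x ∩ X).biUnion P := by
      intro q hq
      rw [Finset.mem_union]
      rcases hb x hx q hq with h' | ⟨y, hy, hyX, hqy⟩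
      · exact Or.inl (Finset.mem_sdiff.2 ⟨h', hdis q hq⟩)
      · exact Or.inr (Finset.mem_biUnion.2 ⟨y, Finset.mem_inter.2 ⟨hy, hyX⟩, hqy⟩)
    have h2 := Finset.card_le_card h1
    have h3 := Finset.card_union_le (P x \ X) ((P x ∩ X).biUnion P)
    have h4 : ((P x ∩ X).biUnion P).card ≤ (P x ∩ X).card * 2 :=
      Finset.card_biUnion_le_card_mul _ _ _ (fun y hy => hP y (Finset.mem_inter.1 hy).2)
    have h5 := Finset.card_sdiff_add_card_inter (P x) X
    have h6 := hP x hx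
    have h7 : (P x \ X).card = 0 := by omega
    rw [Finset.card_eq_zero, Finset.sdiff_eq_empty_iff_subset] at h7
    exact h7
  obtain ⟨x, hx⟩ := hX
  obtain ⟨q, hq⟩ : Q.Nonempty := by rw [← Finset.card_pos]; omega
  rcases hb x hx q hq with h' | ⟨y, hy, hyX, hqy⟩
  · exact hdis q hq (hsub x hx h')
  · exact hdis q hq (hsub y hyX hqy)

theorem case1 [Fintype V] [DecidableEq V] {G : SimpleGraph V} {c : Sym2 V → ℕ} {D : ℕ} {u v : V}
    {a b : ℕ} (hG : G.Adj u v) (hno : ¬ ∃ c, Good G c (D + 2)) (h : Good (del G u v) c (D + 2))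
    (hdu : ∀ c, (S (del G u v) c u).card ≤ 2)
    (hdu' : ∀ c, (S (del G u v) c u).card + 1 ≤ D)
    (hdv : ∀ c, (S (del G u v) c v).card + 1 ≤ D)
    (hdn : ∀ c w, (del G u v).Adj v w → (S (del G u v) c w).card ≤ 3)
    (hau : a ∈ S (del G u v) c u) (hav : a ∈ S (del G u v) c v)
    (hbu : b ∈ S (del G u v) c u) (hbv : b ∉ S (del G u v) c v) : False := by
  have hab : a ≠ b := by rintro rfl; exact hbv hav
  obtain ⟨C, v1, hC, hC2, hSu, hbk, hv1, ha, hSv1, ⟨x0, hx0, hx0a⟩, hmain⟩ :=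
    setup hG hno h hdu hdu' hdv hdn hau hav hbu hbv
  have hCmem : ∀ f, f ∈ C ↔ f < D + 2 ∧ f ≠ b ∧ f ∉ S (del G u v) c v := by
    intro f
    rw [hC]; simp
  have hnu : ∀ z, (del G u v).Adj v z → z ≠ u := by
    rintro z hz rfl
    exact hz.2 (Sym2.eq_swap)
  have hbv1 : b ∉ S (del G u v) c v1 := by
    rw [hSv1, Finset.mem_insert]
    rintro (h' | h')
    · exact hab h'.symm
    · exact ((hCmem b).1 h').2.1 rfl
  have good' : Good (del G u v) (Function.update c s(v, v1) b) (D + 2) := by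
    refine recolor h hv1 ha hbk (fun hs => hbv (mem_S.2 hs)) (fun hs => hbv1 (mem_S.2 hs)) ?_
    intro y hy1 hyv
    have := mem_S.2 hy1
    rw [hSv1, Finset.mem_insert] at this
    rcases this with h' | h'
    · exact h'
    · exact absurd (mem_S.2 hyv) ((hCmem y).1 h').2.2
  have Sother : ∀ z, z ≠ v → z ≠ v1 →
      S (del G u v) (Function.update c s(v, v1) b) z = S (del G u v) c z := by
    intro z hz hz1
    ext g
    rw [mem_S, mem_S, sees_recolor_other hz hz1]
  have Sself : ∀ g, g ∈ S (del G u v) (Function.update c s(v, v1) b) v ↔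
      g = b ∨ (g ∈ S (del G u v) c v ∧ g ≠ a) := by
    intro g
    rw [mem_S, mem_S, sees_recolor_self h hv1 ha]
  have Su := Sother u hG.ne (hnu v1 hv1).symm
  obtain ⟨C', v1', -, -, -, -, -, -, -, -, hmain'⟩ :=
    setup (a := b) (b := a) hG hno good' hdu hdu' hdv hdn (by rw [Su]; exact hbu)
      ((Sself b).2 (Or.inl rfl)) (by rw [Su]; exact hau)
      (by
        rw [Sself]
        rintro (h' | h')
        · exact hab h'
        · exact h'.2 rfl)
  have hch : ∀ x, ∃ w, x ∈ S (del G u v) c v → (del G u v).Adj v w ∧ c s(v, w) = x := by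
    intro x
    by_cases hx : x ∈ S (del G u v) c v
    · obtain ⟨w, hw⟩ := mem_S.1 hx
      exact ⟨w, fun _ => hw⟩
    · exact ⟨v, fun h' => absurd h' hx⟩
  choose W hW using hch
  have hWeq : ∀ x w, (del G u v).Adj v w → c s(v, w) = x → w = W x := by
    intro x w hw hc
    have := hW x (mem_S.2 ⟨w, hw, hc⟩)
    exact h.proper _ _ _ hw this.1 (hc.trans this.2.symm)
  have haC : a ∉ C := fun h' => ((hCmem a).1 h').2.2 hav
  have hbC : b ∉ C := fun h' => ((hCmem b).1 h').2.1 rfl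
  refine counting (X := (S (del G u v) c v).erase a) (Q := insert a (insert b C))
    (fun x => (S (del G u v) c (W x)).erase x) ⟨x0, Finset.mem_erase.2 ⟨hx0a, hx0⟩⟩ ?_ ?_ ?_ ?_
  · rw [Finset.card_insert_of_notMem, Finset.card_insert_of_notMem hbC, hC2]
    rw [Finset.mem_insert]
    rintro (h' | h')
    · exact hab h'
    · exact haC h'
  · intro q hq hqX
    rw [Finset.mem_erase] at hqX
    rcases Finset.mem_insert.1 hq with rfl | hq
    · exact hqX.1 rfl
    rcases Finset.mem_insert.1 hq with rfl | hq
    · exact hbv hqX.2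
    · exact ((hCmem q).1 hq).2.2 hqX.2
  · intro x hx
    rw [Finset.mem_erase] at hx
    obtain ⟨hw, hc⟩ := hW x hx.2
    have hmem : x ∈ S (del G u v) c (W x) :=
      mem_S.2 ⟨v, hw.symm, by rw [Sym2.eq_swap]; exact hc⟩
    rw [Finset.card_erase_of_mem hmem]
    have := hdn c _ hw
    omega
  · intro x hx q hq
    have hqX : q ∉ (S (del G u v) c v) ∨ q = a := by
      rcases Finset.mem_insert.1 hq with rfl | hq
      · exact Or.inr rfl
      rcases Finset.mem_insert.1 hq with rfl | hq
      · exact Or.inl hbv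
      · exact Or.inl ((hCmem q).1 hq).2.2
    rw [Finset.mem_erase] at hx
    have hqx : q ≠ x := by
      rintro rfl
      rcases hqX with h' | h'
      · exact h' hx.2
      · exact hx.1 h'
    obtain ⟨hw, hc⟩ := hW x hx.2
    by_cases hqw : q ∈ S (del G u v) c (W x)
    · exact Or.inl (Finset.mem_erase.2 ⟨hqx, hqw⟩)
    · right
      have fin : ∀ y w', y ∈ S (del G u v) c (W x) → y ≠ x → y ≠ a → (del G u v).Adj v w' →
          c s(v, w') = y → q ∈ S (del G u v) c w' →
          ∃ y ∈ (S (del G u v) c (W x)).erase x, y ∈ (S (del G u v) c v).erase a ∧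
            q ∈ (S (del G u v) c (W y)).erase y := by
        intro y w' k1 k2 k3 k4 k5 k6
        have hyv : y ∈ S (del G u v) c v := mem_S.2 ⟨w', k4, k5⟩
        refine ⟨y, Finset.mem_erase.2 ⟨k2, k1⟩, Finset.mem_erase.2 ⟨k3, hyv⟩,
          Finset.mem_erase.2 ⟨?_, ?_⟩⟩
        · rintro rfl
          rcases hqX with h' | h'
          · exact h' hyv
          · exact k3 h'
        · rw [← hWeq y w' k4 k5]; exact k6
      rcases Finset.mem_insert.1 hq with rfl | hq
      · have hxb : x ≠ b := by rintro rfl; exact hbv hx.2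
        have hWv1 : W x ≠ v1 := by
          intro h'
          rw [h', ha] at hc
          exact hx.1 hc.symm
        have SW := Sother (W x) hw.1.ne' hWv1
        have hne : ∀ z, z ≠ v1 → s(v, z) ≠ s(v, v1) := fun z hz h' => hz (Sym2.congr_right.1 h')
        obtain ⟨y, w', k1, k2, k3, k4, k5, k6⟩ := hmain' q (Finset.mem_insert_self _ _) x (W x) hw
          (by rw [Function.update_of_ne (hne _ hWv1)]; exact hc) hxb (by rw [SW]; exact hqw)
        have hw'1 : w' ≠ v1 := by
          rintro rfl
          rw [Function.update_self] at k5
          exact k3 k5.symm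
        rw [Function.update_of_ne (hne _ hw'1)] at k5
        rw [SW] at k1
        rw [Sother w' k4.1.ne' hw'1] at k6
        refine fin y w' k1 k2 ?_ k4 k5 k6
        rintro rfl
        exact hqw k1
      · obtain ⟨y, w', k1, k2, k3, k4, k5, k6⟩ := hmain q hq x (W x) hw hc hx.1 hqw
        exact fin y w' k1 k2 k3 k4 k5 k6

theorem case0 [Fintype V] [DecidableEq V] {G : SimpleGraph V} {c : Sym2 V → ℕ} {D : ℕ} {u v : V}
    (hG : G.Adj u v) (hno : ¬ ∃ c, Good G c (D + 2)) (h : Good (del G u v) c (D + 2))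
    (hdu : ∀ c, (S (del G u v) c u).card ≤ 2)
    (hdv : ∀ c, (S (del G u v) c v).card + 1 ≤ D)
    (hdis : ∀ y ∈ S (del G u v) c u, y ∉ S (del G u v) c v) : False := by
  have hcard : (S (del G u v) c u ∪ S (del G u v) c v).card < (Finset.range (D + 2)).card := by
    have h1 := Finset.card_union_le (S (del G u v) c u) (S (del G u v) c v)
    have h2 := hdu c
    have h3 := hdv c
    rw [Finset.card_range]
    omega
  obtain ⟨f, hf, hfn⟩ := Finset.exists_mem_notMem_of_card_lt_card hcard
  rw [Finset.mem_union, not_or] at hfn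
  obtain ⟨y, hyu, -, v1, hv1, hc, -⟩ := blocked hG hno h (Finset.mem_range.1 hf)
    (fun hs => hfn.1 (mem_S.2 hs)) (fun hs => hfn.2 (mem_S.2 hs))
  exact hdis y (mem_S.2 hyu) (mem_S.2 ⟨v1, hv1, hc⟩)

theorem case01 [Fintype V] [DecidableEq V] {G : SimpleGraph V} {c : Sym2 V → ℕ} {D : ℕ} {u v : V}
    (hG : G.Adj u v) (hno : ¬ ∃ c, Good G c (D + 2)) (h : Good (del G u v) c (D + 2))
    (hdu : ∀ c, (S (del G u v) c u).card ≤ 2)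
    (hdu' : ∀ c, (S (del G u v) c u).card + 1 ≤ D)
    (hdv : ∀ c, (S (del G u v) c v).card + 1 ≤ D)
    (hdn : ∀ c w, (del G u v).Adj v w → (S (del G u v) c w).card ≤ 3) :
    S (del G u v) c u ⊆ S (del G u v) c v := by
  intro b hb
  by_contra hbv
  refine case0 hG hno h hdu hdv ?_
  intro a hau hav
  exact case1 hG hno h hdu hdu' hdv hdn hau hav hb hbv

theorem step [Fintype V] [DecidableEq V] {G : SimpleGraph V} {c : Sym2 V → ℕ} {D : ℕ} {u v : V}
    (hG : G.Adj u v) (hno : ¬ ∃ c, Good G c (D + 2)) (h : Good (del G u v) c (D + 2))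
    (hdu : ∀ c, (S (del G u v) c u).card ≤ 2)
    (hdu' : ∀ c, (S (del G u v) c u).card + 1 ≤ D)
    (hdv : ∀ c, (S (del G u v) c v).card + 1 ≤ D)
    (hdn : ∀ c w, (del G u v).Adj v w → (S (del G u v) c w).card ≤ 3) : False := by
  have hsub := case01 hG hno h hdu hdu' hdv hdn
  obtain ⟨F, hF⟩ : ∃ F, F = Finset.range (D + 2) \ (S (del G u v) c v) := ⟨_, rfl⟩
  have hFmem : ∀ f, f ∈ F ↔ f < D + 2 ∧ f ∉ S (del G u v) c v := by
    intro f
    rw [hF]; simp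
  have hFcard : 3 ≤ F.card := by
    have h1 := Finset.le_card_sdiff (S (del G u v) c v) (Finset.range (D + 2))
    rw [← hF, Finset.card_range] at h1
    have := hdv c
    omega
  have hnu : ∀ z, (del G u v).Adj v z → z ≠ u := by
    rintro z hz rfl
    exact hz.2 (Sym2.eq_swap)
  have hch : ∀ x, ∃ w, x ∈ S (del G u v) c v → (del G u v).Adj v w ∧ c s(v, w) = x := by
    intro x
    by_cases hx : x ∈ S (del G u v) c v
    · obtain ⟨w, hw⟩ := mem_S.1 hx
      exact ⟨w, fun _ => hw⟩
    · exact ⟨v, fun h' => absurd h' hx⟩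
  choose W hW using hch
  have hcov : F ⊆ (S (del G u v) c u).biUnion (fun y => F ∩ S (del G u v) c (W y)) := by
    intro f hf
    have hf' := (hFmem f).1 hf
    obtain ⟨y, hyu, -, v1, hv1, hc, hs⟩ := blocked hG hno h hf'.1
      (fun hs => hf'.2 (hsub (mem_S.2 hs))) (fun hs => hf'.2 (mem_S.2 hs))
    have hy := hW y (hsub (mem_S.2 hyu))
    have : v1 = W y := h.proper _ _ _ hv1 hy.1 (hc.trans hy.2.symm)
    subst this
    exact Finset.mem_biUnion.2 ⟨y, mem_S.2 hyu, Finset.mem_inter.2 ⟨hf, mem_S.2 hs⟩⟩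
  obtain ⟨a, hau, ha2⟩ : ∃ a ∈ S (del G u v) c u, 2 ≤ (F ∩ S (del G u v) c (W a)).card := by
    by_contra hcon
    push Not at hcon
    have h1 := Finset.card_le_card hcov
    have h2 := Finset.card_biUnion_le_card_mul (S (del G u v) c u)
      (fun y => F ∩ S (del G u v) c (W y)) 1 (fun y hy => by have := hcon y hy; omega)
    have h3 := hdu c
    omega
  obtain ⟨hv1, ha⟩ := hW a (hsub hau)
  have haF : a ∉ F := fun h' => ((hFmem a).1 h').2 (hsub hau)
  have hSv1 : insert a (F ∩ S (del G u v) c (W a)) = S (del G u v) c (W a) := by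
    apply Finset.eq_of_subset_of_card_le
    · refine Finset.insert_subset ?_ Finset.inter_subset_right
      exact mem_S.2 ⟨v, hv1.symm, by rw [Sym2.eq_swap]; exact ha⟩
    · rw [Finset.card_insert_of_notMem (fun h' => haF (Finset.mem_inter.1 h').1)]
      have := hdn c _ hv1
      omega
  have hlt : ((S (del G u v) c (W a)).erase a).card < F.card := by
    have h1 : a ∈ S (del G u v) c (W a) :=
      mem_S.2 ⟨v, hv1.symm, by rw [Sym2.eq_swap]; exact ha⟩
    have := hdn c _ hv1
    rw [Finset.card_erase_of_mem h1]
    omega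
  obtain ⟨f, hf, hfn⟩ := Finset.exists_mem_notMem_of_card_lt_card hlt
  have hfa : f ≠ a := by rintro rfl; exact haF hf
  have hf1 : f ∉ S (del G u v) c (W a) := fun h' => hfn (Finset.mem_erase.2 ⟨hfa, h'⟩)
  have hf' := (hFmem f).1 hf
  have good' : Good (del G u v) (Function.update c s(v, W a) f) (D + 2) := by
    refine recolor h hv1 ha hf'.1 (fun hs => hf'.2 (mem_S.2 hs)) (fun hs => hf1 (mem_S.2 hs)) ?_
    intro y hy1 hyv
    have := mem_S.2 hy1
    rw [← hSv1, Finset.mem_insert] at this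
    rcases this with h' | h'
    · exact h'
    · exact absurd (mem_S.2 hyv) ((hFmem y).1 (Finset.mem_inter.1 h').1).2
  have hsub' := case01 hG hno good' hdu hdu' hdv hdn
  have hau' : a ∈ S (del G u v) (Function.update c s(v, W a) f) u := by
    rw [mem_S, sees_recolor_other hG.ne (hnu _ hv1).symm, ← mem_S]
    exact hau
  have := hsub' hau'
  rw [mem_S, sees_recolor_self h hv1 ha] at this
  rcases this with h' | h'
  · exact hfa h'.symm
  · exact h'.2 rfl

open Classical in
/-- Neighbours as a finset. -/
noncomputable def nb [Fintype V] (G : SimpleGraph V) (v : V) : Finset V :=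
  Finset.univ.filter (fun w => G.Adj v w)

theorem card_S_le [Fintype V] (G : SimpleGraph V) (c : Sym2 V → ℕ) (v : V) :
    (S G c v).card ≤ (nb G v).card := Finset.card_image_le

theorem nb_mono [Fintype V] {G H : SimpleGraph V} (hle : ∀ x y, H.Adj x y → G.Adj x y) (v : V) :
    (nb H v).card ≤ (nb G v).card := by
  apply Finset.card_le_card
  intro w hw
  simp only [nb, Finset.mem_filter, Finset.mem_univ, true_and] at hw ⊢
  exact hle _ _ hw

theorem nb_lt [Fintype V] {G H : SimpleGraph V} (hle : ∀ x y, H.Adj x y → G.Adj x y) {v w : V}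
    (h1 : G.Adj v w) (h2 : ¬ H.Adj v w) :
    (nb H v).card < (nb G v).card := by
  apply Finset.card_lt_card
  rw [Finset.ssubset_iff_of_subset]
  · exact ⟨w, by simpa [nb] using h1, by simpa [nb] using h2⟩
  · intro w hw
    simp only [nb, Finset.mem_filter, Finset.mem_univ, true_and] at hw ⊢
    exact hle _ _ hw

theorem main [Fintype V] [DecidableEq V] (D : ℕ) (G : SimpleGraph V) :
    (∀ v, (nb G v).card ≤ D) → (∀ u v, G.Adj u v → (nb G u).card ≤ 3 ∨ (nb G v).card ≤ 3) →
    ∃ c, Good G c (D + 2) := by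
  induction G using WellFoundedLT.induction with
  | _ G ih =>
  intro hD hs
  by_cases hE : ∀ x y, ¬ G.Adj x y
  · refine ⟨fun _ => 0, ⟨fun x y z hy => absurd hy (hE _ _), fun a b hab => ?_,
      fun x y hy => absurd hy (hE _ _)⟩⟩
    refine SimpleGraph.isAcyclic_bot.anti ?_
    rintro x y ⟨hxy, -⟩
    exact absurd hxy (hE _ _)
  push Not at hE
  obtain ⟨x, y, hxy⟩ := hE
  obtain ⟨v, -, hv⟩ := Finset.exists_max_image Finset.univ (fun v => (nb G v).card)
    ⟨x, Finset.mem_univ x⟩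
  have hvpos : 0 < (nb G v).card :=
    lt_of_lt_of_le (Finset.card_pos.2 ⟨y, by simpa [nb] using hxy⟩) (hv x (Finset.mem_univ x))
  obtain ⟨u, hu⟩ := Finset.card_pos.1 hvpos
  have hvu : G.Adj v u := by simpa [nb] using hu
  have hn : ∀ w, G.Adj v w → (nb G w).card ≤ 3 := by
    intro w hw
    rcases hs v w hw with h' | h'
    · exact (hv w (Finset.mem_univ w)).trans h'
    · exact h'
  have hle : ∀ p q, (del G u v).Adj p q → G.Adj p q := fun p q hpq => hpq.1
  have hlt : del G u v < G := by
    refine lt_of_le_of_ne (fun p q hpq => hpq.1) ?_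
    intro h'
    have h2 : (del G u v).Adj u v := by rw [h']; exact hvu.symm
    exact h2.2 rfl
  have hmono := fun z => nb_mono hle z
  obtain ⟨c, hc⟩ := ih (del G u v) hlt (fun z => (hmono z).trans (hD z)) (fun p q hpq =>
    (hs p q (hle p q hpq)).imp (fun h' => (hmono p).trans h') (fun h' => (hmono q).trans h'))
  by_contra hno
  have hdu : (nb (del G u v) u).card < (nb G u).card :=
    nb_lt hle hvu.symm (fun h' => h'.2 rfl)
  have hdv : (nb (del G u v) v).card < (nb G v).card :=
    nb_lt hle hvu (fun h' => h'.2 Sym2.eq_swap)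
  refine step hvu.symm hno hc ?_ ?_ ?_ ?_
  · intro c
    have := card_S_le (del G u v) c u
    have := hn u hvu
    omega
  · intro c
    have := card_S_le (del G u v) c u
    have := hD u
    omega
  · intro c
    have := card_S_le (del G u v) c v
    have := hD v
    omega
  · intro c w hw
    exact (card_S_le (del G u v) c w).trans ((hmono w).trans (hn w hw.1))

theorem nb_eq_degree [Fintype V] (G : SimpleGraph V) [DecidableRel G.Adj] (v : V) :
    (nb G v).card = G.degree v := by
  rw [← SimpleGraph.card_neighborFinset_eq_degree]
  congr 1
  ext w
  simp [nb]

end ThreeSparse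

/-- Every 3-sparse graph `G` with maximum degree `Δ` satisfies `a'(G) ≤ Δ + 2`:
it admits an acyclic edge coloring with at most `Δ + 2` colors. -/
theorem three_sparse_aci_le_maxDegree_add_two {V : Type*} [Fintype V] [DecidableEq V]
    (G : SimpleGraph V) [DecidableRel G.Adj]
    (hsparse : ∀ u v : V, G.Adj u v → G.degree u ≤ 3 ∨ G.degree v ≤ 3) :
    HasAEC G (G.maxDegree + 2) := by
  obtain ⟨c, hc⟩ := ThreeSparse.main G.maxDegree G
    (fun v => by rw [ThreeSparse.nb_eq_degree]; exact G.degree_le_maxDegree v)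
    (fun u v huv => by
      rw [ThreeSparse.nb_eq_degree, ThreeSparse.nb_eq_degree]; exact hsparse u v huv)
  exact hc.acyclicEC
end
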